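/- Let (ΛV,d) be a pure coformal elliptic minimal Sullivan model. Then the generating function F(x) = Σ_{r≥1} MTC_{r+1}(ΛV)·x^r is a rational function of the form P(x)/(1−x)², where P(x) is a polynomial with integer coefficients satisfying P(1) = cat(ΛV). -/

import Mathlib

noncomputable section

namespace RHT

/-- A graded-commutative differential graded algebra over `ℚ`, graded by `ℕ`,
with a degree `+1` differential satisfying the graded Leibniz rule. -/
class GCDGA (A : Type) extends Ring A, Algebra ℚ A where
  grading : ℕ → Submodule ℚ A
  gradedAlgebra : GradedAlgebra grading
  grading_comm : ∀ (i j : ℕ) (a b : A), a ∈ grading i → b ∈ grading j →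
    a * b = ((-1 : ℚ) ^ (i * j)) • (b * a)
  d : A →ₗ[ℚ] A
  d_sq : ∀ a : A, d (d a) = 0
  d_grading : ∀ (i : ℕ) (a : A), a ∈ grading i → d a ∈ grading (i + 1)
  d_leibniz : ∀ (i : ℕ) (a b : A), a ∈ grading i →
    d (a * b) = d a * b + ((-1 : ℚ) ^ i) • (a * d b)

/-- The grading of a gcdga, with the algebra explicit. -/
def Gr (A : Type) [GCDGA A] : ℕ → Submodule ℚ A := GCDGA.grading

/-- The differential of a gcdga, with the algebra explicit. -/
def Dd (A : Type) [GCDGA A] : A →ₗ[ℚ] A := GCDGA.d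

/-- Morphisms of cdga's: `ℚ`-algebra morphisms preserving the grading and
commuting with the differentials. -/
def IsDGAHom {A B : Type} [GCDGA A] [GCDGA B] (f : A →ₐ[ℚ] B) : Prop :=
  (∀ a : A, f (Dd A a) = Dd B (f a)) ∧
    ∀ (i : ℕ) (a : A), a ∈ Gr A i → f a ∈ Gr B i

theorem isDGAHom_id (A : Type) [GCDGA A] : IsDGAHom (AlgHom.id ℚ A) :=
  ⟨fun _ => rfl, fun _ _ h => h⟩

/-- A quasi-isomorphism: a morphism inducing an isomorphism in cohomology
(stated elementwise: surjectivity and injectivity on cohomology classes). -/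
def QuasiIso {A B : Type} [GCDGA A] [GCDGA B] (f : A →ₐ[ℚ] B) : Prop :=
  (∀ b : B, Dd B b = 0 → ∃ a : A, Dd A a = 0 ∧ ∃ c : B, f a - b = Dd B c) ∧
    ∀ a : A, Dd A a = 0 → (∃ c : B, f a = Dd B c) → ∃ e : A, a = Dd A e

/-- Injectivity in cohomology, stated elementwise. -/
def CohomologyInjective {A B : Type} [GCDGA A] [GCDGA B] (f : A →ₐ[ℚ] B) : Prop :=
  ∀ a : A, Dd A a = 0 → (∃ c : B, f a = Dd B c) → ∃ e : A, a = Dd A e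

/-- A homotopy retraction for a morphism `ρ` of cdga's: a factorization of `ρ`
through a surjective quasi-isomorphism `q : C → Q` (playing the role of the
relative Sullivan model of `ρ`) together with a cdga retraction `τ`. -/
structure HtpyRetraction {T Q : Type} [GCDGA T] [GCDGA Q] (ρ : T →ₐ[ℚ] Q) where
  C : Type
  [instC : GCDGA C]
  j : T →ₐ[ℚ] C
  q : C →ₐ[ℚ] Q
  τ : C →ₐ[ℚ] T
  j_dga : IsDGAHom j
  q_dga : IsDGAHom q
  τ_dga : IsDGAHom τ
  q_surj : Function.Surjective q
  q_quasi : QuasiIso q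
  hqj : q.comp j = ρ
  hτj : τ.comp j = AlgHom.id ℚ T

attribute [instance] HtpyRetraction.instC

/-- A homotopy retraction of `T`-modules for a morphism `ρ : T → Q` of cdga's:
as above, but the retraction `τ` is only required to be a morphism of
differential `T`-modules. -/
structure ModHtpyRetraction {T Q : Type} [GCDGA T] [GCDGA Q] (ρ : T →ₐ[ℚ] Q) where
  C : Type
  [instC : GCDGA C]
  j : T →ₐ[ℚ] C
  q : C →ₐ[ℚ] Q
  τ : C →ₗ[ℚ] T
  j_dga : IsDGAHom j
  q_dga : IsDGAHom q
  q_surj : Function.Surjective q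
  q_quasi : QuasiIso q
  hqj : q.comp j = ρ
  τ_chain : ∀ c : C, τ (Dd C c) = Dd T (τ c)
  τ_mod : ∀ (t : T) (c : C), τ (j t * c) = t * τ c
  hτj : ∀ t : T, τ (j t) = t

attribute [instance] ModHtpyRetraction.instC

/-- `T`, together with the morphisms `ι j : A → T`, is the `r`-fold (graded)
tensor power of `A`, characterized as the `r`-fold coproduct of copies of `A`
in the category of cdga's. -/
structure TensorPower (A : Type) [GCDGA A] (r : ℕ) (T : Type) [GCDGA T] where
  ι : Fin r → (A →ₐ[ℚ] T)
  ι_dga : ∀ j, IsDGAHom (ι j)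
  coprod : ∀ (B : Type) [GCDGA B] (f : Fin r → (A →ₐ[ℚ] B)), (∀ j, IsDGAHom (f j)) →
    ∃! g : T →ₐ[ℚ] B, IsDGAHom g ∧ ∀ j, g.comp (ι j) = f j

/-- The `r`-fold multiplication morphism `μ : A^{⊗ r} → A`, i.e. the fold map
of the coproduct. -/
noncomputable def TensorPower.mu {A : Type} [GCDGA A] {r : ℕ} {T : Type} [GCDGA T]
    (TP : TensorPower A r T) : T →ₐ[ℚ] A :=
  (TP.coprod A (fun _ => AlgHom.id ℚ A) (fun _ => isDGAHom_id A)).choose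

/-- The kernel of the `r`-fold multiplication, as a `ℚ`-submodule (ideal). -/
noncomputable def TensorPower.kerMu {A : Type} [GCDGA A] {r : ℕ} {T : Type} [GCDGA T]
    (TP : TensorPower A r T) : Submodule ℚ T :=
  LinearMap.ker TP.mu.toLinearMap

/-- A witness that `TC_r(ΛV) ≤ n`: the projection
`ρ^r_n : (ΛV)^{⊗ r} → (ΛV)^{⊗ r}/(ker μ^r)^{n+1}` admits a homotopy retraction
of cdga's.  The quotient is encoded as a surjective cdga morphism with kernel
`(ker μ^r)^{n+1}`. -/
structure TCWitness (A : Type) [GCDGA A] (r n : ℕ) where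
  T : Type
  [instT : GCDGA T]
  TP : TensorPower A r T
  Q : Type
  [instQ : GCDGA Q]
  ρ : T →ₐ[ℚ] Q
  ρ_dga : IsDGAHom ρ
  ρ_surj : Function.Surjective ρ
  ρ_ker : LinearMap.ker ρ.toLinearMap = TP.kerMu ^ (n + 1)
  retr : Nonempty (HtpyRetraction ρ)

/-- The higher rational topological complexity `TC_r`. -/
noncomputable def TC (A : Type) [GCDGA A] (r : ℕ) : ℕ :=
  sInf {n | Nonempty (TCWitness A r n)}

/-- A witness that `MTC_r(ΛV) ≤ n`: `ρ^r_n` admits a homotopy retraction of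
`(ΛV)^{⊗ r}`-modules. -/
structure MTCWitness (A : Type) [GCDGA A] (r n : ℕ) where
  T : Type
  [instT : GCDGA T]
  TP : TensorPower A r T
  Q : Type
  [instQ : GCDGA Q]
  ρ : T →ₐ[ℚ] Q
  ρ_dga : IsDGAHom ρ
  ρ_surj : Function.Surjective ρ
  ρ_ker : LinearMap.ker ρ.toLinearMap = TP.kerMu ^ (n + 1)
  retr : Nonempty (ModHtpyRetraction ρ)

/-- The higher module rational topological complexity `MTC_r`. -/
noncomputable def MTC (A : Type) [GCDGA A] (r : ℕ) : ℕ :=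
  sInf {n | Nonempty (MTCWitness A r n)}

/-- A witness that `HTC_r(ΛV) ≤ n`: `ρ^r_n` is injective in cohomology. -/
structure HTCWitness (A : Type) [GCDGA A] (r n : ℕ) where
  T : Type
  [instT : GCDGA T]
  TP : TensorPower A r T
  Q : Type
  [instQ : GCDGA Q]
  ρ : T →ₐ[ℚ] Q
  ρ_dga : IsDGAHom ρ
  ρ_surj : Function.Surjective ρ
  ρ_ker : LinearMap.ker ρ.toLinearMap = TP.kerMu ^ (n + 1)
  inj : CohomologyInjective ρ

/-- The invariant `HTC_r`. -/
noncomputable def HTC (A : Type) [GCDGA A] (r : ℕ) : ℕ :=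
  sInf {n | Nonempty (HTCWitness A r n)}

/-- A minimal Sullivan model structure on a gcdga `A`: a simply-connected
graded space of generators `V` of finite type, the word-length grading `lam`
(`lam k` is `Λ^k V`), freeness of `A` over `V` as a graded-commutative
algebra (expressed by the universal property), and minimality `d V ⊆ Λ^{≥2}V`. -/
structure MinimalSullivan (A : Type) [GCDGA A] where
  V : ℕ → Submodule ℚ A
  lam : ℕ → Submodule ℚ A
  V_le : ∀ n, V n ≤ Gr A n
  V0 : V 0 = ⊥
  V1 : V 1 = ⊥
  V_fin : ∀ n, FiniteDimensional ℚ (V n)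
  lam_zero : lam 0 = 1
  lam_one : lam 1 = ⨆ n, V n
  lam_mul : ∀ p q, lam p * lam q ≤ lam (p + q)
  lam_internal : DirectSum.IsInternal lam
  minimal : ∀ (n : ℕ), ∀ v ∈ V n, Dd A v ∈ ⨆ k, ⨆ (_ : 2 ≤ k), lam k
  free : ∀ (B : Type) [GCDGA B] (f : ∀ n, V n →ₗ[ℚ] B),
    (∀ (n : ℕ) (v : V n), f n v ∈ Gr B n) →
    ∃! g : A →ₐ[ℚ] B, (∀ (i : ℕ) (a : A), a ∈ Gr A i → g a ∈ Gr B i) ∧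
      ∀ (n : ℕ) (v : V n), g (v : A) = f n v

namespace MinimalSullivan

variable {A : Type} [GCDGA A] (S : MinimalSullivan A)

/-- The even part of the space of generators. -/
def Veven : Submodule ℚ A := ⨆ n, S.V (2 * n)

/-- The odd part of the space of generators. -/
def Vodd : Submodule ℚ A := ⨆ n, S.V (2 * n + 1)

/-- The homotopy characteristic `χ_π = dim V^even - dim V^odd`. -/
noncomputable def chiPi : ℤ :=
  (Module.finrank ℚ S.Veven : ℤ) - (Module.finrank ℚ S.Vodd : ℤ)

/-- Purity: `d V^even = 0` and `d V^odd ⊆ Λ V^even`. -/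
def Pure : Prop :=
  (∀ a ∈ S.Veven, Dd A a = 0) ∧
    ∀ a ∈ S.Vodd, Dd A a ∈ Algebra.adjoin ℚ (S.Veven : Set A)

/-- Coformality: the differential is quadratic, `d V ⊆ Λ² V`. -/
def Coformal : Prop := ∀ (n : ℕ), ∀ v ∈ S.V n, Dd A v ∈ S.lam 2

/-- Constant length `l` of the differential: `d V ⊆ Λ^l V`. -/
def ConstantLength (l : ℕ) : Prop := ∀ (n : ℕ), ∀ v ∈ S.V n, Dd A v ∈ S.lam l

end MinimalSullivan

/-- The cohomology of a gcdga, as a `ℚ`-module. -/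
def CohClasses (A : Type) [GCDGA A] :=
  LinearMap.ker (Dd A) ⧸ ((LinearMap.range (Dd A)).comap (LinearMap.ker (Dd A)).subtype)

instance (A : Type) [GCDGA A] : AddCommGroup (CohClasses A) := by
  unfold CohClasses; infer_instance

instance (A : Type) [GCDGA A] : Module ℚ (CohClasses A) := by
  unfold CohClasses; infer_instance

/-- Ellipticity: both the generating space `V` and the cohomology are
finite-dimensional. -/
def Elliptic (A : Type) [GCDGA A] (S : MinimalSullivan A) : Prop :=
  FiniteDimensional ℚ (⨆ n, S.V n : Submodule ℚ A) ∧ FiniteDimensional ℚ (CohClasses A)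

/-- A witness of formality: a quasi-isomorphism to a gcdga with zero
differential. -/
structure FormalityWitness (A : Type) [GCDGA A] where
  B : Type
  [instB : GCDGA B]
  hd : Dd B = 0
  ψ : A →ₐ[ℚ] B
  ψ_dga : IsDGAHom ψ
  ψ_quasi : QuasiIso ψ

/-- Formality of a (Sullivan) cdga. -/
def Formal (A : Type) [GCDGA A] : Prop := Nonempty (FormalityWitness A)

/-- A witness that `cat(ΛV) ≤ n`: the projection `ΛV → ΛV/Λ^{>n}V` admits a
homotopy retraction.  The quotient is encoded as a surjective cdga morphism
whose kernel is `Λ^{>n}V`. -/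
structure CatWitness (A : Type) [GCDGA A] (S : MinimalSullivan A) (n : ℕ) where
  Q : Type
  [instQ : GCDGA Q]
  π : A →ₐ[ℚ] Q
  π_dga : IsDGAHom π
  π_surj : Function.Surjective π
  π_ker : LinearMap.ker π.toLinearMap = ⨆ k, ⨆ (_ : n < k), S.lam k
  retr : Nonempty (HtpyRetraction π)

/-- The rational LS-category. -/
noncomputable def cat (A : Type) [GCDGA A] (S : MinimalSullivan A) : ℕ :=
  sInf {n | Nonempty (CatWitness A S n)}

/-- A witness that `zcl_r(ΛV) ≥ p`: `p` cocycles in `(ΛV)^{⊗ r}` whose classes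
are zero-divisors (killed by `H(μ^r)`) and whose product is not exact. -/
structure ZclWitness (A : Type) [GCDGA A] (r p : ℕ) where
  T : Type
  [instT : GCDGA T]
  TP : TensorPower A r T
  a : Fin p → T
  closed : ∀ i, Dd T (a i) = 0
  zero_div : ∀ i, ∃ b : A, TP.mu (a i) = Dd A b
  prod_ne : ∀ b : T, (List.ofFn a).prod ≠ Dd T b

/-- The `r`-zero-divisor-cuplength `zcl_r`. -/
noncomputable def zcl (A : Type) [GCDGA A] (r : ℕ) : ℕ :=
  sSup {p | Nonempty (ZclWitness A r p)}

/-- A witness that `cl_ℚ(ΛV) ≥ p`: `p` cocycles of positive degree with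
non-exact product. -/
structure ClWitness (A : Type) [GCDGA A] (p : ℕ) where
  a : Fin p → A
  pos : ∀ i, a i ∈ ⨆ k, ⨆ (_ : 0 < k), Gr A k
  closed : ∀ i, Dd A (a i) = 0
  prod_ne : ∀ b : A, (List.ofFn a).prod ≠ Dd A b

/-- The rational cuplength `cl_ℚ`. -/
noncomputable def clQ (A : Type) [GCDGA A] : ℕ :=
  sSup {p | Nonempty (ClWitness A p)}

set_option linter.unusedSectionVars false

section

open scoped TensorProduct

/-- The free graded-commutative algebra on even generators `β` and odd generators `o`. -/
def KA (β o : Type) : Type := MvPolynomial β ℚ ⊗[ℚ] ExteriorAlgebra ℚ (o →₀ ℚ)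

namespace KA

variable {β o : Type}

instance : Ring (KA β o) :=
  inferInstanceAs (Ring (MvPolynomial β ℚ ⊗[ℚ] ExteriorAlgebra ℚ (o →₀ ℚ)))

instance : Algebra ℚ (KA β o) :=
  inferInstanceAs (Algebra ℚ (MvPolynomial β ℚ ⊗[ℚ] ExteriorAlgebra ℚ (o →₀ ℚ)))

/-- The inclusion of the polynomial part. -/
def pol : MvPolynomial β ℚ →ₐ[ℚ] KA β o :=
  (Algebra.TensorProduct.includeLeft :
    MvPolynomial β ℚ →ₐ[ℚ] MvPolynomial β ℚ ⊗[ℚ] ExteriorAlgebra ℚ (o →₀ ℚ))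

/-- The inclusion of the exterior part. -/
def ext : ExteriorAlgebra ℚ (o →₀ ℚ) →ₐ[ℚ] KA β o :=
  (Algebra.TensorProduct.includeRight :
    ExteriorAlgebra ℚ (o →₀ ℚ) →ₐ[ℚ] MvPolynomial β ℚ ⊗[ℚ] ExteriorAlgebra ℚ (o →₀ ℚ))

/-- The even generators. -/
def x (b : β) : KA β o := pol (MvPolynomial.X b)

/-- The odd generators. -/
def y (j : o) : KA β o := ext (ExteriorAlgebra.ι ℚ (Finsupp.single j 1))

theorem tmul_eq (r : MvPolynomial β ℚ) (l : ExteriorAlgebra ℚ (o →₀ ℚ)) :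
    (r ⊗ₜ[ℚ] l : MvPolynomial β ℚ ⊗[ℚ] ExteriorAlgebra ℚ (o →₀ ℚ)) =
      (pol r * ext l : KA β o) :=
  ((Algebra.TensorProduct.tmul_mul_tmul r 1 1 l).trans (by simp)).symm

theorem pol_mul_ext (r : MvPolynomial β ℚ) (l : ExteriorAlgebra ℚ (o →₀ ℚ)) :
    (pol r * ext l : KA β o) = ext l * pol r :=
  (Algebra.TensorProduct.tmul_mul_tmul r 1 1 l).trans
    (((by simp : _ = ((1 * r) ⊗ₜ[ℚ] (l * 1) : MvPolynomial β ℚ ⊗[ℚ] ExteriorAlgebra ℚ (o →₀ ℚ)))).trans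
    (Algebra.TensorProduct.tmul_mul_tmul 1 r l 1).symm)

theorem ext_ι (m : o →₀ ℚ) :
    (ext (ExteriorAlgebra.ι ℚ m) : KA β o) = m.sum fun j c => c • y j := by
  conv_lhs => rw [← Finsupp.sum_single m]
  rw [Finsupp.sum, map_sum, map_sum, Finsupp.sum]
  refine Finset.sum_congr rfl fun j _ => ?_
  rw [y, ← map_smul, ← map_smul, Finsupp.smul_single, smul_eq_mul, mul_one]

/-- Every element is obtained from polynomials by left multiplication by odd generators. -/
theorem induction_on {P : KA β o → Prop} (a : KA β o)
    (hadd : ∀ a b, P a → P b → P (a + b)) (hpol : ∀ r, P (pol r))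
    (hy : ∀ j a, P a → P (y j * a)) : P a := by
  have h0 : P 0 := by simpa using hpol 0
  have key : ∀ (l : ExteriorAlgebra ℚ (o →₀ ℚ)) (r : MvPolynomial β ℚ),
      P (pol r * ext l) := by
    intro l
    refine CliffordAlgebra.left_induction (P := fun l => ∀ r : MvPolynomial β ℚ,
      P (pol r * ext l)) _ ?_ ?_ ?_ l
    · intro c r
      have : (pol r * ext (algebraMap ℚ _ c) : KA β o) = pol (c • r) := by
        rw [AlgHom.commutes, map_smul, Algebra.smul_def]
        exact (Algebra.commutes _ _).symm
      exact this ▸ hpol _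
    · intro l₁ l₂ h₁ h₂ r
      rw [map_add, mul_add]
      exact hadd _ _ (h₁ r) (h₂ r)
    · intro l m h r
      have : (pol r * ext (CliffordAlgebra.ι 0 m * l) : KA β o) =
          m.sum fun j c => y j * (pol (c • r) * ext l) := by
        rw [map_mul, ← mul_assoc, pol_mul_ext, mul_assoc]
        change ext (ExteriorAlgebra.ι ℚ m) * _ = _
        rw [ext_ι, Finsupp.sum, Finset.sum_mul, Finsupp.sum]
        refine Finset.sum_congr rfl fun j _ => ?_
        rw [map_smul, smul_mul_assoc, smul_mul_assoc, mul_smul_comm]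
      rw [this]
      refine Finset.sum_induction _ P hadd h0 fun j _ => hy j _ (h _)
  refine TensorProduct.induction_on
    (motive := P) a h0 (fun r l => ?_) (fun a b => hadd a b)
  exact (tmul_eq r l) ▸ key l r

theorem pol_comm (r : MvPolynomial β ℚ) (a : KA β o) : pol r * a = a * pol r := by
  induction a using induction_on with
  | hadd a b ha hb => rw [mul_add, add_mul, ha, hb]
  | hpol s => rw [← map_mul, ← map_mul, mul_comm]
  | hy j a ha => rw [← mul_assoc, y, pol_mul_ext, mul_assoc, ha, mul_assoc]

theorem pol_left_comm (r : MvPolynomial β ℚ) (a b : KA β o) :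
    a * (pol r * b) = pol r * (a * b) := by
  rw [← mul_assoc, ← pol_comm, mul_assoc]

theorem y_mul_y_add (j k : o) : (y j * y k + y k * y j : KA β o) = 0 := by
  rw [y, y, ← map_mul ext, ← map_mul ext, ← map_add ext, ExteriorAlgebra.ι_add_mul_swap, map_zero]

theorem y_mul_y (j k : o) : (y j * y k : KA β o) = -(y k * y j) :=
  eq_neg_of_add_eq_zero_left (y_mul_y_add j k)

theorem y_mul_self (j : o) : (y j * y j : KA β o) = 0 := by
  rw [y, ← map_mul, ExteriorAlgebra.ι_sq_zero, map_zero]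

/-- Applying a linear operator to the polynomial coefficients. -/
def coef (f : MvPolynomial β ℚ →ₗ[ℚ] MvPolynomial β ℚ) : KA β o →ₗ[ℚ] KA β o :=
  (LinearMap.rTensor (ExteriorAlgebra ℚ (o →₀ ℚ)) f :)

theorem coef_pol_mul_ext (f : MvPolynomial β ℚ →ₗ[ℚ] MvPolynomial β ℚ)
    (r : MvPolynomial β ℚ) (l : ExteriorAlgebra ℚ (o →₀ ℚ)) :
    coef f (pol r * ext l : KA β o) = pol (f r) * ext l := by
  rw [← tmul_eq, ← tmul_eq]
  exact LinearMap.rTensor_tmul _ _ _ _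

theorem coef_pol (f : MvPolynomial β ℚ →ₗ[ℚ] MvPolynomial β ℚ) (r : MvPolynomial β ℚ) :
    coef f (pol r : KA β o) = pol (f r) := by
  simpa using coef_pol_mul_ext f r (1 : ExteriorAlgebra ℚ (o →₀ ℚ))

/-- Induction on elementary products. -/
theorem induction_pol_ext {P : KA β o → Prop} (a : KA β o)
    (hadd : ∀ a b, P a → P b → P (a + b)) (h : ∀ r l, P (pol r * ext l)) : P a :=
  TensorProduct.induction_on (motive := P) a
    (by
      have h0 := h 0 0
      rw [map_zero, zero_mul] at h0
      exact h0)
    (fun r l => (tmul_eq r l) ▸ h r l) (fun a b => hadd a b)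

theorem coef_y_mul (f : MvPolynomial β ℚ →ₗ[ℚ] MvPolynomial β ℚ) (j : o) (a : KA β o) :
    coef f (y j * a) = y j * coef f a := by
  induction a using induction_pol_ext with
  | hadd a b ha hb => rw [mul_add, map_add, ha, hb, map_add, mul_add]
  | h r l => rw [pol_left_comm, y, ← map_mul, coef_pol_mul_ext, coef_pol_mul_ext, pol_left_comm,
      map_mul]

/-- Contraction with the coordinate functional of an odd generator. -/
def contr (j : o) : KA β o →ₗ[ℚ] KA β o :=
  (LinearMap.lTensor (MvPolynomial β ℚ)
    (CliffordAlgebra.contractLeft (Q := (0 : QuadraticForm ℚ (o →₀ ℚ))) (Finsupp.lapply j)) :)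

theorem contr_pol_mul_ext (j : o) (r : MvPolynomial β ℚ) (l : ExteriorAlgebra ℚ (o →₀ ℚ)) :
    contr j (pol r * ext l : KA β o) = pol r *
      ext (CliffordAlgebra.contractLeft (Q := (0 : QuadraticForm ℚ (o →₀ ℚ)))
        (Finsupp.lapply j) l) := by
  rw [← tmul_eq, ← tmul_eq]
  exact LinearMap.lTensor_tmul _ _ _ _

theorem contr_pol_mul (j : o) (r : MvPolynomial β ℚ) (a : KA β o) :
    contr j (pol r * a) = pol r * contr j a := by
  induction a using induction_pol_ext with
  | hadd a b ha hb => rw [mul_add, map_add, ha, hb, map_add, mul_add]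
  | h s l => rw [← mul_assoc, ← map_mul, contr_pol_mul_ext, contr_pol_mul_ext, map_mul, mul_assoc]

theorem contr_y_mul [DecidableEq o] (j k : o) (a : KA β o) :
    contr j (y k * a) = (if k = j then a else 0) - y k * contr j a := by
  induction a using induction_pol_ext with
  | hadd a b ha hb =>
    rw [mul_add, map_add, ha, hb, map_add, mul_add]
    split_ifs <;> abel
  | h r l =>
    rw [pol_left_comm, y, ← map_mul, contr_pol_mul_ext, contr_pol_mul_ext]
    have := CliffordAlgebra.contractLeft_ι_mul (Q := (0 : QuadraticForm ℚ (o →₀ ℚ)))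
      (Finsupp.lapply j) (Finsupp.single k 1) l
    rw [ExteriorAlgebra.ι, this, map_sub, map_smul, map_mul, pol_left_comm, mul_sub, mul_smul_comm,
      Finsupp.lapply_apply, Finsupp.single_apply]
    split_ifs <;> simp

section Fintype
variable [Fintype o]

/-- Contraction with a polynomial-valued functional on the odd generators. -/
def C (φ : o → MvPolynomial β ℚ) : KA β o →ₗ[ℚ] KA β o :=
  ∑ j, (LinearMap.mulLeft ℚ (pol (φ j))) ∘ₗ contr j

theorem C_apply (φ : o → MvPolynomial β ℚ) (a : KA β o) :
    C φ a = ∑ j, pol (φ j) * contr j a := by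
  simp [C, LinearMap.sum_apply]

theorem C_pol (φ : o → MvPolynomial β ℚ) (r : MvPolynomial β ℚ) : C φ (pol r : KA β o) = 0 := by
  rw [C_apply]
  refine Finset.sum_eq_zero fun j _ => ?_
  have := contr_pol_mul_ext j r (1 : ExteriorAlgebra ℚ (o →₀ ℚ))
  rw [map_one, mul_one] at this
  rw [this]
  have h1 : CliffordAlgebra.contractLeft (Q := (0 : QuadraticForm ℚ (o →₀ ℚ)))
    (Finsupp.lapply j) 1 = 0 := CliffordAlgebra.contractLeft_one _ _
  rw [h1, map_zero, mul_zero, mul_zero]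

theorem C_one (φ : o → MvPolynomial β ℚ) : C φ (1 : KA β o) = 0 := by
  simpa using C_pol φ (1 : MvPolynomial β ℚ)

theorem C_pol_mul (φ : o → MvPolynomial β ℚ) (r : MvPolynomial β ℚ) (a : KA β o) :
    C φ (pol r * a) = pol r * C φ a := by
  simp only [C_apply, contr_pol_mul, Finset.mul_sum]
  exact Finset.sum_congr rfl fun j _ => pol_left_comm _ _ _

theorem C_y_mul (φ : o → MvPolynomial β ℚ) (k : o) (a : KA β o) :
    C φ (y k * a) = pol (φ k) * a - y k * C φ a := by
  classical
  simp only [C_apply, contr_y_mul, Finset.mul_sum, mul_sub, Finset.sum_sub_distrib, mul_ite,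
    mul_zero]
  rw [Finset.sum_ite_eq Finset.univ k]
  simp only [Finset.mem_univ, if_true]
  congr 1
  exact Finset.sum_congr rfl fun j _ => (pol_left_comm _ _ _).symm

theorem C_y (φ : o → MvPolynomial β ℚ) (k : o) : C φ (y k : KA β o) = pol (φ k) := by
  simpa [C_one] using C_y_mul φ k (1 : KA β o)

theorem C_C_add (φ ψ : o → MvPolynomial β ℚ) (a : KA β o) :
    C φ (C ψ a) + C ψ (C φ a) = 0 := by
  induction a using induction_on with
  | hadd a b ha hb =>
    simp only [map_add]
    rw [add_add_add_comm, ha, hb, add_zero]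
  | hpol r => simp [C_pol]
  | hy j a ha =>
    simp only [C_y_mul, map_sub, C_pol_mul]
    rw [sub_sub_eq_add_sub, sub_sub_eq_add_sub]
    have : y j * C φ (C ψ a) = - (y j * C ψ (C φ a)) := by
      rw [← mul_neg, eq_neg_of_add_eq_zero_left ha]
    rw [this]; abel

theorem C_C (φ ψ : o → MvPolynomial β ℚ) (a : KA β o) :
    C φ (C ψ a) = - C ψ (C φ a) := eq_neg_of_add_eq_zero_left (C_C_add φ ψ a)

theorem C_sq (φ : o → MvPolynomial β ℚ) (a : KA β o) : C φ (C φ a) = 0 := by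
  have h := C_C_add φ φ a
  rw [← two_smul ℚ] at h
  simpa using h

end Fintype

/-- The map induced on the free graded-commutative algebra by images of the generators. -/
def lift {B : Type} [Ring B] [Algebra ℚ B] (f : β → B) (g : o → B)
    (hf : ∀ i b, Commute (f i) b) (hg : ∀ j k, g j * g k + g k * g j = 0) :
    KA β o →ₐ[ℚ] B :=
  (Algebra.TensorProduct.lift (S := ℚ) (A := MvPolynomial β ℚ) (C := B)
    ((Subalgebra.center ℚ B).val.comp (MvPolynomial.aeval fun i =>
      (⟨f i, Subalgebra.mem_center_iff.mpr fun b => (hf i b).symm⟩ : Subalgebra.center ℚ B)))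
    (ExteriorAlgebra.lift ℚ ⟨Finsupp.linearCombination ℚ g, fun m => by
      have h2 : ∀ m m' : o →₀ ℚ, Finsupp.linearCombination ℚ g m * Finsupp.linearCombination ℚ g m'
          + Finsupp.linearCombination ℚ g m' * Finsupp.linearCombination ℚ g m = 0 := by
        intro m m'
        induction m using Finsupp.induction_linear with
        | zero => simp
        | add a b ha hb =>
          rw [map_add, add_mul, mul_add, add_add_add_comm, ha, hb, add_zero]
        | single j c =>
          induction m' using Finsupp.induction_linear with
          | zero => simp
          | add a b ha hb =>
            rw [map_add, add_mul, mul_add, add_add_add_comm, ha, hb, add_zero]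
          | single k c' =>
            simp only [Finsupp.linearCombination_single, smul_mul_assoc, mul_smul_comm]
            rw [smul_comm c' c, ← smul_add, ← smul_add, hg]
            simp
      have := h2 m m
      rw [← two_smul ℚ] at this
      simpa using this⟩)
    (fun a b => (Subalgebra.mem_center_iff.mp (Subtype.property _) _).symm) :)

theorem lift_x {B : Type} [Ring B] [Algebra ℚ B] (f : β → B) (g : o → B)
    (hf : ∀ i b, Commute (f i) b) (hg : ∀ j k, g j * g k + g k * g j = 0) (i : β) :
    lift f g hf hg (x i) = f i := by
  unfold lift x pol
  erw [Algebra.TensorProduct.lift_tmul]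
  simp

theorem lift_y {B : Type} [Ring B] [Algebra ℚ B] (f : β → B) (g : o → B)
    (hf : ∀ i b, Commute (f i) b) (hg : ∀ j k, g j * g k + g k * g j = 0) (j : o) :
    lift f g hf hg (y j) = g j := by
  unfold lift y ext
  erw [Algebra.TensorProduct.lift_tmul]
  simp

/-- The free algebra is generated by its generators. -/
theorem adjoin_eq_top :
    Algebra.adjoin ℚ (Set.range (x : β → KA β o) ∪ Set.range (y : o → KA β o)) = ⊤ := by
  refine eq_top_iff.mpr fun a _ => ?_
  induction a using induction_on with
  | hadd a b ha hb => exact add_mem (ha trivial) (hb trivial)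
  | hpol r =>
    induction r using MvPolynomial.induction_on with
    | C c =>
      rw [show (MvPolynomial.C c : MvPolynomial β ℚ) = algebraMap ℚ _ c from rfl, AlgHom.commutes]
      exact Subalgebra.algebraMap_mem _ _
    | add p q hp hq => rw [map_add]; exact add_mem (hp trivial) (hq trivial)
    | mul_X p i hp =>
      rw [map_mul]
      exact mul_mem (hp trivial) (Algebra.subset_adjoin (Or.inl ⟨i, rfl⟩))
  | hy j a ha => exact mul_mem (Algebra.subset_adjoin (Or.inr ⟨j, rfl⟩)) (ha trivial)

theorem algHom_ext {B : Type} [Ring B] [Algebra ℚ B] {f g : KA β o →ₐ[ℚ] B}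
    (hx : ∀ i, f (x i) = g (x i)) (hy : ∀ j, f (y j) = g (y j)) : f = g :=
  AlgHom.ext_of_adjoin_eq_top adjoin_eq_top fun a ha => by
    rcases ha with ⟨i, rfl⟩ | ⟨j, rfl⟩
    · exact hx i
    · exact hy j

end KA

end

section

/-- An independent family of submodules which contains one, is closed under products, and
contains a set of algebra generators. -/
structure IsGenGraded {E I : Type} [Ring E] [Algebra ℚ E] [AddMonoid I]
    (G : I → Submodule ℚ E) (s : Set E) : Prop where
  indep : iSupIndep G
  one_mem : (1 : E) ∈ G 0
  mul_mem : ∀ i j a b, a ∈ G i → b ∈ G j → a * b ∈ G (i + j)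
  gen : ∀ a ∈ s, ∃ i, a ∈ G i
  adjoin : Algebra.adjoin ℚ s = ⊤

theorem iSup_eq_top_of_gen {E I : Type} [Ring E] [Algebra ℚ E] [AddMonoid I]
    {G : I → Submodule ℚ E} {s : Set E} (one_mem : (1 : E) ∈ G 0)
    (mul_mem : ∀ i j a b, a ∈ G i → b ∈ G j → a * b ∈ G (i + j))
    (gen : ∀ a ∈ s, ∃ i, a ∈ G i) (hs : Algebra.adjoin ℚ s = ⊤) : ⨆ i, G i = ⊤ := by
  refine eq_top_iff.mpr fun a _ => ?_
  have ha : a ∈ Algebra.adjoin ℚ s := hs ▸ trivial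
  induction ha using Algebra.adjoin_induction with
  | mem a ha =>
    obtain ⟨i, hi⟩ := gen a ha
    exact Submodule.mem_iSup_of_mem i hi
  | algebraMap c =>
    rw [Algebra.algebraMap_eq_smul_one]
    exact Submodule.smul_mem _ _ (Submodule.mem_iSup_of_mem 0 one_mem)
  | add a b _ _ ha hb => exact add_mem (ha trivial) (hb trivial)
  | mul a b _ _ ha hb =>
    replace ha := ha trivial
    replace hb := hb trivial
    clear * - ha hb mul_mem
    induction ha using Submodule.iSup_induction' with
    | zero => simp
    | add a a' _ _ h h' => rw [add_mul]; exact add_mem h h'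
    | mem i a hi =>
      induction hb using Submodule.iSup_induction' with
      | zero => simp
      | add b b' _ _ h h' => rw [mul_add]; exact add_mem h h'
      | mem j b hj => exact Submodule.mem_iSup_of_mem (i + j) (mul_mem i j a b hi hj)

theorem split_iSup {E I : Type} [AddCommGroup E] [Module ℚ E] (G : I → Submodule ℚ E) (i : I)
    (a : E) (ha : a ∈ ⨆ i, G i) : ∃ b ∈ G i, ∃ c ∈ ⨆ (j) (_ : j ≠ i), G j, a = b + c := by
  have : ⨆ i, G i ≤ G i ⊔ ⨆ (j) (_ : j ≠ i), G j := by
    refine iSup_le fun j => ?_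
    by_cases h : j = i
    · subst h; exact le_sup_left
    · exact le_sup_of_le_right (le_iSup₂_of_le j h le_rfl)
  obtain ⟨b, hb, c, hc, h⟩ := Submodule.mem_sup.mp (this ha)
  exact ⟨b, hb, c, hc, h.symm⟩

theorem eq_of_le_of_iSup_eq_top {E I : Type} [AddCommGroup E] [Module ℚ E]
    {G G' : I → Submodule ℚ E} (hG : iSupIndep G) (hle : ∀ i, G' i ≤ G i)
    (htop : ⨆ i, G' i = ⊤) (i : I) : G i ≤ G' i := by
  intro a ha
  obtain ⟨b, hb, c, hc, h⟩ := split_iSup G' i a (htop ▸ trivial)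
  have hc' : c ∈ ⨆ (j) (_ : j ≠ i), G j := iSup₂_mono (fun j _ => hle j) hc
  have : c = a - b := by rw [h]; abel
  have hc0 : c = 0 := Submodule.disjoint_def.mp (hG i) c (this ▸ sub_mem ha (hle i hb)) hc'
  rw [h, hc0, add_zero]; exact hb

/-- A homogeneous element in the image of an operator shifting degrees has a homogeneous
preimage. -/
theorem exists_homogeneous_preimage {E F I J : Type} [AddCommGroup E] [Module ℚ E]
    [AddCommGroup F] [Module ℚ F]
    {G : I → Submodule ℚ E} {H : J → Submodule ℚ F} (hH : iSupIndep H) (htop : ⨆ i, G i = ⊤)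
    (f : E →ₗ[ℚ] F) (σ : I → J) (hσ : Function.Injective σ) (hf : ∀ i, ∀ a ∈ G i, f a ∈ H (σ i))
    (i : I) (b : E) (hb : f b ∈ H (σ i)) : ∃ b' ∈ G i, f b' = f b := by
  obtain ⟨b₁, hb₁, b₂, hb₂, h⟩ := split_iSup G i b (htop ▸ trivial)
  refine ⟨b₁, hb₁, ?_⟩
  have h2 : f b₂ ∈ ⨆ (j) (_ : j ≠ σ i), H j := by
    have : (⨆ (j) (_ : j ≠ i), G j).map f ≤ ⨆ (j) (_ : j ≠ σ i), H j := by
      simp only [Submodule.map_iSup]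
      refine iSup₂_le fun j hj => ?_
      refine le_iSup₂_of_le (σ j) (fun h => hj (hσ h)) ?_
      rintro _ ⟨a, ha, rfl⟩
      exact hf j a ha
    exact this ⟨_, hb₂, rfl⟩
  have : f b₂ = f b - f b₁ := by rw [h, map_add]; abel
  have h0 : f b₂ = 0 := Submodule.disjoint_def.mp (hH (σ i)) _
    (this ▸ sub_mem hb (hf i _ hb₁)) h2
  rw [h, map_add, h0, add_zero]

namespace IsGenGraded

variable {E I : Type} [Ring E] [Algebra ℚ E] [AddMonoid I] {G : I → Submodule ℚ E} {s : Set E}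

theorem iSup_eq_top (h : IsGenGraded G s) : ⨆ i, G i = ⊤ :=
  iSup_eq_top_of_gen h.one_mem h.mul_mem h.gen h.adjoin

/-- A multiplicative subfamily containing the generators is the whole family. -/
theorem le_of_gen (h : IsGenGraded G s) {G' : I → Submodule ℚ E} (hle : ∀ i, G' i ≤ G i)
    (one_mem : (1 : E) ∈ G' 0)
    (mul_mem : ∀ i j a b, a ∈ G' i → b ∈ G' j → a * b ∈ G' (i + j))
    (gen : ∀ a ∈ s, ∃ i, a ∈ G' i) (i : I) : G i ≤ G' i :=
  eq_of_le_of_iSup_eq_top h.indep hle (iSup_eq_top_of_gen one_mem mul_mem gen h.adjoin) i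

/-- Homogeneous induction. -/
theorem induction (h : IsGenGraded G s) (P : I → Submodule ℚ E)
    (one_mem : (1 : E) ∈ P 0)
    (mul_mem : ∀ i j a b, a ∈ G i → b ∈ G j → a ∈ P i → b ∈ P j → a * b ∈ P (i + j))
    (gen : ∀ a ∈ s, ∃ i, a ∈ G i ∧ a ∈ P i) (i : I) (a : E) (ha : a ∈ G i) : a ∈ P i :=
  (h.le_of_gen (G' := fun i => G i ⊓ P i) (fun _ => inf_le_left) ⟨h.one_mem, one_mem⟩
    (fun i j a b ha hb => ⟨h.mul_mem i j a b ha.1 hb.1, mul_mem i j a b ha.1 hb.1 ha.2 hb.2⟩)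
    gen i ha).2

/-- An algebra map with homogeneous values on generators preserves degrees. -/
theorem map_mem (h : IsGenGraded G s) {B : Type} [Ring B] [Algebra ℚ B]
    {H : I → Submodule ℚ B} (one_mem : (1 : B) ∈ H 0)
    (mul_mem : ∀ i j a b, a ∈ H i → b ∈ H j → a * b ∈ H (i + j)) (f : E →ₐ[ℚ] B)
    (gen : ∀ a ∈ s, ∃ i, a ∈ G i ∧ f a ∈ H i) (i : I) (a : E) (ha : a ∈ G i) : f a ∈ H i :=
  h.induction (fun i => (H i).comap f.toLinearMap) (by simpa using one_mem)
    (fun i j a b _ _ ha hb => by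
      simp only [Submodule.mem_comap, AlgHom.toLinearMap_apply, map_mul] at *
      exact mul_mem i j _ _ ha hb) gen i a ha

end IsGenGraded

namespace KA

variable {β o : Type} [Fintype o]

/-- The Euler operator for weights `w` on even and `v` on odd generators. -/
def NW (w : β → ℚ) (v : o → ℚ) : Module.End ℚ (KA β o) :=
  coef (MvPolynomial.mkDerivation ℚ fun b => w b • MvPolynomial.X b).toLinearMap +
    ∑ j, v j • (LinearMap.mulLeft ℚ (y j) ∘ₗ contr j)

theorem contr_pol (j : o) (r : MvPolynomial β ℚ) : contr j (pol r : KA β o) = 0 := by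
  classical
  have h := C_pol (o := o) (fun k => if k = j then 1 else 0) r
  rw [C_apply] at h
  simpa [apply_ite, ite_mul] using h

theorem NW_pol (w : β → ℚ) (v : o → ℚ) (r : MvPolynomial β ℚ) :
    NW w v (pol r : KA β o) =
      pol (MvPolynomial.mkDerivation ℚ (fun b => w b • MvPolynomial.X b) r) := by
  simp [NW, coef_pol, LinearMap.sum_apply, contr_pol]

theorem NW_y_mul (w : β → ℚ) (v : o → ℚ) (k : o) (a : KA β o) :
    NW w v (y k * a) = v k • (y k * a) + y k * NW w v a := by
  classical
  simp only [NW, LinearMap.add_apply, coef_y_mul, LinearMap.sum_apply, LinearMap.smul_apply,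
    LinearMap.comp_apply, LinearMap.mulLeft_apply, contr_y_mul, mul_add, mul_sub, Finset.mul_sum,
    smul_sub, Finset.sum_sub_distrib]
  rw [add_left_comm, sub_eq_add_neg, ← Finset.sum_neg_distrib]
  congr 1
  congr 1
  · rw [Finset.sum_eq_single k] <;> simp +contextual [eq_comm]
  · refine Finset.sum_congr rfl fun j _ => ?_
    rw [← mul_assoc, y_mul_y, neg_mul, smul_neg, neg_neg, mul_assoc, mul_smul_comm]

theorem NW_mul (w : β → ℚ) (v : o → ℚ) (a b : KA β o) :
    NW w v (a * b) = NW w v a * b + a * NW w v b := by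
  induction a using induction_on with
  | hadd a a' ha hb => simp only [add_mul, map_add, ha, hb]; abel
  | hy j a ha =>
    simp only [mul_assoc, NW_y_mul, ha, mul_add, add_mul, smul_mul_assoc]
    abel
  | hpol r =>
    induction b using induction_on with
    | hadd a a' ha hb => simp only [mul_add, map_add, ha, hb]; abel
    | hpol s => simp only [← map_mul, NW_pol, Derivation.leibniz, map_add, smul_eq_mul]
                rw [add_comm, mul_comm s]
    | hy j a ha =>
      rw [pol_left_comm .. |>.symm, NW_y_mul, NW_y_mul, ha, mul_add, mul_add, NW_pol,
        mul_smul_comm, pol_left_comm, pol_left_comm, pol_left_comm]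
      abel

/-- Weight spaces. -/
def G (w : β → ℚ) (v : o → ℚ) (g : ℚ) : Submodule ℚ (KA β o) :=
  Module.End.eigenspace (NW w v) g

theorem mem_G {w : β → ℚ} {v : o → ℚ} {g : ℚ} {a : KA β o} :
    a ∈ G w v g ↔ NW w v a = g • a := Module.End.mem_eigenspace_iff

theorem one_mem_G (w : β → ℚ) (v : o → ℚ) : (1 : KA β o) ∈ G w v 0 := by
  rw [mem_G, ← map_one pol, NW_pol]
  simp

theorem mul_mem_G {w : β → ℚ} {v : o → ℚ} (g g' : ℚ) (a b : KA β o) (ha : a ∈ G w v g)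
    (hb : b ∈ G w v g') : a * b ∈ G w v (g + g') := by
  rw [mem_G] at *
  rw [NW_mul, ha, hb, add_smul, smul_mul_assoc, mul_smul_comm]

theorem x_mem_G (w : β → ℚ) (v : o → ℚ) (b : β) : (x b : KA β o) ∈ G w v (w b) := by
  rw [mem_G, x, NW_pol, MvPolynomial.mkDerivation_X, map_smul]

theorem y_mem_G (w : β → ℚ) (v : o → ℚ) (j : o) : (y j : KA β o) ∈ G w v (v j) := by
  rw [mem_G]
  have := NW_y_mul w v j (1 : KA β o)
  rwa [mul_one, mem_G.mp (one_mem_G w v), zero_smul, mul_zero, add_zero] at this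

theorem isGenGraded (w : β → ℚ) (v : o → ℚ) :
    IsGenGraded (G w v) (Set.range (x : β → KA β o) ∪ Set.range (y : o → KA β o)) where
  indep := Module.End.eigenspaces_iSupIndep _
  one_mem := one_mem_G w v
  mul_mem := mul_mem_G
  gen := by
    rintro _ (⟨i, rfl⟩ | ⟨j, rfl⟩)
    · exact ⟨_, x_mem_G w v i⟩
    · exact ⟨_, y_mem_G w v j⟩
  adjoin := adjoin_eq_top

theorem C_mem_G {w : β → ℚ} {v : o → ℚ} (φ : o → MvPolynomial β ℚ) (s : ℚ)
    (hφ : ∀ j, (pol (φ j) : KA β o) ∈ G w v (v j - s)) {g : ℚ} {a : KA β o} (ha : a ∈ G w v g) :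
    C φ a ∈ G w v (g - s) := by
  have key : ∀ a : KA β o, NW w v (C φ a) = C φ (NW w v a) - s • C φ a := by
    intro a
    induction a using induction_on with
    | hadd a b ha hb => simp only [map_add, ha, hb, smul_add]; abel
    | hpol r => simp [C_pol, NW_pol]
    | hy j a ha =>
      rw [C_y_mul, map_sub, NW_mul, mem_G.mp (hφ j), NW_y_mul, NW_y_mul, ha, map_add, map_smul,
        C_y_mul, C_y_mul, sub_smul, mul_sub, smul_sub, smul_sub, mul_smul_comm, sub_mul,
        smul_mul_assoc, smul_mul_assoc]
      abel
  rw [mem_G] at *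
  rw [key, ha, map_smul, sub_smul]

end KA

end

section

/-- A complex with anticommuting contractions `c b`, odd multiplications `s b` bounding
operators `ξ b`, and null-homotopies `h b` of powers of `ξ b`, all graded by `G`. -/
structure KoszulSystem {N β : Type} [AddCommGroup N] [Module ℚ N] [DecidableEq β]
    (D : Module.End ℚ N) (c s ξ h : β → Module.End ℚ N) (L : β → ℕ)
    (G : ℚ → Submodule ℚ N) (σ δ : ℚ) : Prop where
  pos : 0 ≤ σ + δ
  cc : ∀ b b' a, c b (c b' a) = -c b' (c b a)
  cs : ∀ b b' a, c b (s b' a) = (if b = b' then a else 0) - s b' (c b a)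
  Dc : ∀ b a, D (c b a) = -c b (D a)
  Ds : ∀ b a, D (s b a) = ξ b a - s b (D a)
  cξ : ∀ b b' a, c b' (ξ b a) = ξ b (c b' a)
  Dξ : ∀ b a, D (ξ b a) = ξ b (D a)
  Dh : ∀ b a, D (h b a) = (ξ b ^ L b) a - h b (D a)
  ch : ∀ b b' a, c b' (h b a) = -h b (c b' a)
  cG : ∀ b g a, a ∈ G g → c b a ∈ G (g - σ)
  sG : ∀ b g a, a ∈ G g → s b a ∈ G (g + σ)
  ξG : ∀ b g a, a ∈ G g → ξ b a ∈ G (g + (σ + δ))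
  hG : ∀ b g a, a ∈ G g → h b a ∈ G (g + L b * (σ + δ) - δ)

namespace KoszulSystem

variable {N β : Type} [AddCommGroup N] [Module ℚ N] [DecidableEq β]
  {D : Module.End ℚ N} {c s ξ h : β → Module.End ℚ N} {L : β → ℕ}
  {G : ℚ → Submodule ℚ N} {σ δ : ℚ}

/-- Vanishing of cohomology above a bound descends to the common kernels of contractions. -/
theorem vanishing (K : KoszulSystem D c s ξ h L G σ δ) (m : ℚ)
    (base : ∀ g, m < g → ∀ a ∈ G g, D a = 0 → ∃ e ∈ G (g - δ), D e = a) (S : Finset β) :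
    ∀ g, m - σ * S.card < g → ∀ a ∈ G g, (∀ b ∈ S, c b a = 0) → D a = 0 →
      ∃ e ∈ G (g - δ), (∀ b ∈ S, c b e = 0) ∧ D e = a := by
  induction S using Finset.induction_on with
  | empty =>
    intro g hg a ha _ hDa
    obtain ⟨e, he, h⟩ := base g (by simpa using hg) a ha hDa
    exact ⟨e, he, by simp, h⟩
  | insert k S hk ih =>
    intro g hg a ha hca hDa
    rw [Finset.card_insert_of_notMem hk] at hg
    push_cast at hg
    have ξpow : ∀ (l : ℕ) (b' : β) (a : N), c b' ((ξ k ^ l) a) = (ξ k ^ l) (c b' a) := by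
      intro l b' a
      induction l with
      | zero => simp
      | succ l ih => rw [pow_succ', Module.End.mul_apply, Module.End.mul_apply, K.cξ, ih]
    have Dpow : ∀ (l : ℕ) (a : N), D ((ξ k ^ l) a) = (ξ k ^ l) (D a) := by
      intro l a
      induction l with
      | zero => simp
      | succ l ih => rw [pow_succ', Module.End.mul_apply, Module.End.mul_apply, K.Dξ, ih]
    have Gpow : ∀ l : ℕ, (ξ k ^ l) a ∈ G (g + l * (σ + δ)) := by
      intro l
      induction l with
      | zero => simpa using ha
      | succ l ih =>
        rw [pow_succ', Module.End.mul_apply]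
        have := K.ξG k _ _ ih
        convert this using 2
        push_cast; ring
    have desc : ∀ l : ℕ, l ≤ L k → ∃ e ∈ G (g + ((L k - l : ℕ) : ℚ) * (σ + δ) - δ),
        (∀ b ∈ insert k S, c b e = 0) ∧ D e = (ξ k ^ (L k - l)) a := by
      intro l
      induction l with
      | zero =>
        intro _
        refine ⟨h k a, K.hG k g a ha, fun b hb => ?_, ?_⟩
        · rw [K.ch, hca b hb, map_zero, neg_zero]
        · rw [K.Dh, hDa, map_zero, sub_zero, Nat.sub_zero]
      | succ l ihl =>
        intro hl
        obtain ⟨b, hbG, hbc, hDb⟩ := ihl (by omega)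
        obtain ⟨t, ht⟩ : ∃ t, L k - (l + 1) = t := ⟨_, rfl⟩
        have ht' : L k - l = t + 1 := by omega
        rw [ht'] at hbG hDb
        rw [ht]
        set a' := (ξ k ^ t) a with ha'
        have hDb' : D b = ξ k a' := by rw [hDb, pow_succ', Module.End.mul_apply]
        have hca' : ∀ b' ∈ insert k S, c b' a' = 0 := fun b' hb' => by
          rw [ha', ξpow, hca b' hb', map_zero]
        have hDa' : D a' = 0 := by rw [ha', Dpow, hDa, map_zero]
        obtain ⟨e, heG, hec, hDe⟩ := ih (g + t * (σ + δ) + σ) (by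
            have := mul_nonneg (Nat.cast_nonneg (α := ℚ) t) K.pos
            linarith)
          (s k a' - b) (sub_mem (K.sG k _ _ (Gpow t)) (by
            convert hbG using 2; push_cast; ring)) (fun b' hb' => by
            have hne : b' ≠ k := fun h => hk (h ▸ hb')
            rw [map_sub, K.cs, if_neg hne, hca' b' (Finset.mem_insert_of_mem hb'), map_zero,
              hbc b' (Finset.mem_insert_of_mem hb')]
            simp) (by rw [map_sub, K.Ds, hDa', map_zero, hDb', sub_zero, sub_self])
        refine ⟨-c k e, neg_mem (by
            convert K.cG k _ _ heG using 2; ring), fun b' hb' => ?_, ?_⟩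
        · rw [map_neg, K.cc]
          rcases Finset.mem_insert.mp hb' with rfl | hb''
          · have := K.cc b' b' e
            rw [← this]
            have h2 : (2 : ℚ) • c b' (c b' e) = 0 := by
              rw [two_smul]; nth_rewrite 1 [this]; simp
            simpa using h2
          · rw [hec b' hb'']; simp
        · rw [map_neg, K.Dc, neg_neg, hDe, map_sub, K.cs, if_pos rfl,
            hca' k (Finset.mem_insert_self _ _), hbc k (Finset.mem_insert_self _ _)]
          simp
    obtain ⟨e, he, hc, hD⟩ := desc (L k) le_rfl
    refine ⟨e, by simpa using he, hc, by simpa using hD⟩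

theorem c_self (K : KoszulSystem D c s ξ h L G σ δ) (b : β) (a : N) : c b (c b a) = 0 := by
  have h2 : (2 : ℚ) • c b (c b a) = 0 := by
    rw [two_smul]; nth_rewrite 1 [K.cc b b a]; simp
  simpa using h2

/-- Iterated contraction of a non-exact cocycle remains non-exact, as long as the cohomology of
the intermediate complexes vanishes in the relevant degrees. -/
theorem nonexact (K : KoszulSystem D c s ξ h L G σ δ) (hσ : σ = 1) (hδ : δ = -1) (m : ℚ)
    (base : ∀ g, m < g → ∀ a ∈ G g, D a = 0 → ∃ e ∈ G (g - δ), D e = a)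
    (Ω : N) (hΩ : Ω ∈ G m) (hDΩ : D Ω = 0) (hne : ∀ η ∈ G (m + 1), D η ≠ Ω)
    (l : List β) (hl : l.Nodup) :
    (∀ b ∈ l, c b (l.foldr (fun b a => c b a) Ω) = 0) ∧
    D (l.foldr (fun b a => c b a) Ω) = 0 ∧ l.foldr (fun b a => c b a) Ω ∈ G (m - l.length) ∧
      ∀ η ∈ G (m - l.length + 1), (∀ b ∈ l, c b η = 0) → D η ≠ l.foldr (fun b a => c b a) Ω := by
  subst hσ hδ
  induction l with
  | nil => simpa using ⟨hDΩ, hΩ, hne⟩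
  | cons k l ih =>
    obtain ⟨ih1, ih2, ih3, ih4⟩ := ih hl.of_cons
    rw [List.foldr_cons]
    set ω := l.foldr (fun b a => c b a) Ω
    have hlen : ((k :: l).length : ℚ) = l.length + 1 := by simp
    refine ⟨fun b hb => ?_, ?_, ?_, ?_⟩
    · rcases List.mem_cons.mp hb with rfl | hb
      · exact K.c_self b ω
      · rw [K.cc, ih1 b hb]; simp
    · rw [K.Dc, ih2]; simp
    · rw [hlen, ← sub_sub]; exact K.cG k _ _ ih3
    · intro η hη hcη hDη
      rw [hlen] at hη
      have hkη := hcη k List.mem_cons_self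
      have hη' : η ∈ G (m - l.length) := by convert hη using 2; ring
      have hsη : s k η ∈ G (m - l.length + 1) := K.sG k _ _ hη'
      have hDs : D (s k η) = ξ k η - s k (c k ω) := by rw [K.Ds, hDη]
      have hDsG : D (s k η) ∈ G (m - l.length) := by
        rw [hDs]
        refine sub_mem ?_ ?_
        · simpa using K.ξG k _ _ hη'
        · simpa using K.sG k _ _ (K.cG k _ _ ih3)
      obtain ⟨e, heG, hec, hDe⟩ := K.vanishing m base (k :: l).toFinset (m - l.length) (by
          rw [List.toFinset_card_of_nodup hl, hlen]; linarith)
        (ω + D (s k η)) (add_mem ih3 hDsG) (fun b hb => by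
          have hb := List.mem_toFinset.mp hb
          have hcD : c b (D (s k η)) = -D (c b (s k η)) := by rw [K.Dc, neg_neg]
          rw [map_add, hcD, K.cs, hcη b hb, map_zero, sub_zero]
          rcases List.mem_cons.mp hb with rfl | hb'
          · rw [if_pos rfl, hDη, add_neg_cancel]
          · have hbk : b ≠ k := fun h => (List.nodup_cons.mp hl).1 (h ▸ hb')
            rw [if_neg hbk, ih1 b hb']; simp) (by
          rw [map_add, ih2, zero_add, hDs, map_sub, K.Dξ, K.Ds, K.Dc, ih2, hDη]; simp)
      refine ih4 (e - s k η) (sub_mem (by simpa using heG) hsη) (fun b hb => ?_) ?_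
      · have hbk : b ≠ k := fun h => (List.nodup_cons.mp hl).1 (h ▸ hb)
        rw [map_sub, hec b (List.mem_toFinset.mpr (List.mem_cons_of_mem _ hb)), K.cs,
          if_neg hbk, hcη b (List.mem_cons_of_mem _ hb)]
        simp
      · rw [map_sub, hDe, add_sub_cancel_right]

end KoszulSystem

end

section

namespace KA

section LinMap
variable {β κ o : Type} [Fintype o]

/-- The element `∑ r_k y_k`. -/
def lin (r : o → MvPolynomial β ℚ) : KA β o := ∑ k, pol (r k) * y k

theorem C_lin_mul (φ r : o → MvPolynomial β ℚ) (a : KA β o) :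
    C φ (lin r * a) = pol (∑ k, r k * φ k) * a - lin r * C φ a := by
  simp only [lin, Finset.sum_mul, map_sum, mul_assoc, C_pol_mul, C_y_mul, mul_sub,
    Finset.sum_sub_distrib, map_mul]

theorem C_lin (φ r : o → MvPolynomial β ℚ) : C φ (lin r) = pol (∑ k, r k * φ k) := by
  simpa [C_one] using C_lin_mul φ r 1

theorem lin_mul_y_add (r : o → MvPolynomial β ℚ) (j : o) :
    (lin r * y j + y j * lin r : KA β o) = 0 := by
  simp only [lin, Finset.sum_mul, Finset.mul_sum, ← Finset.sum_add_distrib]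
  refine Finset.sum_eq_zero fun k _ => ?_
  rw [pol_left_comm, mul_assoc, ← mul_add, y_mul_y_add, mul_zero]

theorem lin_mul_lin_add (r s : o → MvPolynomial β ℚ) :
    (lin r * lin s + lin s * lin r : KA β o) = 0 := by
  conv_lhs => enter [1]; rw [lin.eq_def s]
  conv_lhs => enter [2]; rw [lin.eq_def s]
  simp only [Finset.sum_mul, Finset.mul_sum, ← Finset.sum_add_distrib]
  refine Finset.sum_eq_zero fun k _ => ?_
  rw [pol_left_comm, mul_assoc, ← mul_add, lin_mul_y_add, mul_zero]

theorem lin_single [DecidableEq o] (j : o) : (lin (Pi.single j 1) : KA β o) = y j := by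
  rw [lin, Finset.sum_eq_single j]
  · simp
  · intro k _ hk; simp [hk]
  · simp

theorem lin_zero : (lin 0 : KA β o) = 0 := by simp [lin]

theorem lin_mem_G {w : β → ℚ} {v : o → ℚ} {r : o → MvPolynomial β ℚ} {g : ℚ}
    (h : ∀ k, (pol (r k) : KA β o) ∈ G w v (g - v k)) : lin r ∈ G w v g :=
  Submodule.sum_mem _ fun k _ => by
    simpa using mul_mem_G _ _ _ _ (h k) (y_mem_G w v k)

variable {β' : Type}

/-- The map sending even generators to polynomials and odd generators to linear
combinations of odd generators. -/
def linMap (f : β → MvPolynomial β' ℚ) (r : κ → o → MvPolynomial β' ℚ) :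
    KA β κ →ₐ[ℚ] KA β' o :=
  lift (fun b => pol (f b)) (fun k => lin (r k)) (fun _ _ => pol_comm _ _)
    fun _ _ => lin_mul_lin_add _ _

theorem linMap_x (f : β → MvPolynomial β' ℚ) (r : κ → o → MvPolynomial β' ℚ) (b : β) :
    linMap f r (x b) = pol (f b) := lift_x _ _ _ _ _

theorem linMap_y (f : β → MvPolynomial β' ℚ) (r : κ → o → MvPolynomial β' ℚ) (k : κ) :
    linMap f r (y k) = lin (r k) := lift_y _ _ _ _ _

theorem linMap_pol (f : β → MvPolynomial β' ℚ) (r : κ → o → MvPolynomial β' ℚ)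
    (p : MvPolynomial β ℚ) : linMap f r (pol p) = pol (MvPolynomial.aeval f p) := by
  have : (linMap f r).comp pol = pol.comp (MvPolynomial.aeval f) :=
    MvPolynomial.algHom_ext fun i => by
      simpa [x] using linMap_x f r i
  exact DFunLike.congr_fun this p

theorem linMap_lin [Fintype κ] (f : β → MvPolynomial β' ℚ) (r : κ → o → MvPolynomial β' ℚ)
    (s : κ → MvPolynomial β ℚ) :
    linMap f r (lin s) = lin fun j => ∑ k, MvPolynomial.aeval f (s k) * r k j := by
  simp only [lin, map_sum, map_mul, linMap_pol, linMap_y, Finset.mul_sum, Finset.sum_mul]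
  rw [Finset.sum_comm]
  simp only [mul_assoc]

theorem C_linMap [Fintype κ] (f : β → MvPolynomial β' ℚ) (r : κ → o → MvPolynomial β' ℚ)
    (φ : κ → MvPolynomial β ℚ) (φ' : o → MvPolynomial β' ℚ)
    (h : ∀ k, ∑ j, r k j * φ' j = MvPolynomial.aeval f (φ k)) (a : KA β κ) :
    C φ' (linMap f r a) = linMap f r (C φ a) := by
  induction a using induction_on with
  | hadd a b ha hb => simp only [map_add, ha, hb]
  | hpol p => rw [C_pol, linMap_pol, C_pol, map_zero]
  | hy k a ha =>
    rw [map_mul, linMap_y, C_lin_mul, ha, h, C_y_mul, map_sub, map_mul, map_mul, linMap_y,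
      linMap_pol]

theorem linMap_mem_G [Fintype κ] {f : β → MvPolynomial β' ℚ} {r : κ → o → MvPolynomial β' ℚ}
    {w : β → ℚ} {v : κ → ℚ} {w' : β' → ℚ} {v' : o → ℚ}
    (hf : ∀ b, (pol (f b) : KA β' o) ∈ G w' v' (w b))
    (hr : ∀ k j, (pol (r k j) : KA β' o) ∈ G w' v' (v k - v' j)) {g : ℚ} {a : KA β κ}
    (ha : a ∈ G w v g) : linMap f r a ∈ G w' v' g :=
  (isGenGraded w v).map_mem (one_mem_G _ _) mul_mem_G _
    (by
      rintro _ (⟨b, rfl⟩ | ⟨k, rfl⟩)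
      · exact ⟨_, x_mem_G _ _ _, by rw [linMap_x]; exact hf b⟩
      · exact ⟨_, y_mem_G _ _ _, by rw [linMap_y]; exact lin_mem_G (hr k)⟩) g a ha

theorem pol_single_mem_G [DecidableEq o] {w : β → ℚ} {v : o → ℚ} (j k : o) :
    (pol ((Pi.single j 1 : o → MvPolynomial β ℚ) k) : KA β o) ∈ G w v (v j - v k) := by
  by_cases h : k = j
  · subst h; simpa using one_mem_G w v
  · simp [h]

theorem pol_X_mem_G {w : β → ℚ} {v : o → ℚ} (b : β) :
    (pol (MvPolynomial.X b) : KA β o) ∈ G w v (w b) := x_mem_G w v b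

end LinMap

section Weights
variable {β o : Type} [Fintype o]

/-- For non-negative weights, the weight zero part is generated by weight zero generators. -/
theorem G_zero_le {w : β → ℚ} {v : o → ℚ} (hw : ∀ b, 0 ≤ w b) (hv : ∀ j, 0 ≤ v j)
    (S : Subalgebra ℚ (KA β o)) (hx : ∀ b, w b = 0 → x b ∈ S) (hy : ∀ j, v j = 0 → y j ∈ S)
    {a : KA β o} (ha : a ∈ G w v 0) : a ∈ S := by
  have key := (isGenGraded w v).le_of_gen
    (G' := fun g => if g < 0 then ⊥ else if g = 0 then Subalgebra.toSubmodule S ⊓ G w v 0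
      else G w v g) ?_ ?_ ?_ ?_ 0 ha
  · simp at key
    exact key.1
  · intro g
    split_ifs with h1 h2
    · exact bot_le
    · subst h2; exact inf_le_right
    · exact le_rfl
  · rw [if_neg (lt_irrefl _), if_pos rfl]
    exact ⟨S.one_mem, one_mem_G w v⟩
  · intro i j a b ha hb
    split_ifs at ha with h1 h2
    · rw [(Submodule.mem_bot ℚ).mp ha, zero_mul]; exact zero_mem _
    · split_ifs at hb with h3 h4
      · rw [(Submodule.mem_bot ℚ).mp hb, mul_zero]; exact zero_mem _
      · subst h2 h4
        simp only [add_zero, lt_irrefl, if_false, if_true]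
        exact ⟨S.mul_mem ha.1 hb.1, by simpa using mul_mem_G _ _ _ _ ha.2 hb.2⟩
      · have : ¬ (i + j < 0) := by rw [not_lt] at *; linarith
        rw [if_neg this, if_neg (by rw [h2, zero_add]; exact h4)]
        have ha' := ha.2
        rw [← h2] at ha'
        exact mul_mem_G _ _ _ _ ha' hb
    · have hi : 0 < i := lt_of_le_of_ne (not_lt.mp h1) (Ne.symm h2)
      split_ifs at hb with h3 h4
      · rw [(Submodule.mem_bot ℚ).mp hb, mul_zero]; exact zero_mem _
      · subst h4
        rw [if_neg (by linarith), if_neg (by linarith)]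
        exact mul_mem_G _ _ _ _ ha hb.2
      · rw [not_lt] at h3
        rw [if_neg (by linarith), if_neg (by linarith)]
        exact mul_mem_G _ _ _ _ ha hb
  · rintro _ (⟨b, rfl⟩ | ⟨k, rfl⟩)
    · refine ⟨w b, ?_⟩
      rw [if_neg (not_lt.mpr (hw b))]
      split_ifs with h
      · have := x_mem_G (o := o) w v b
        exact ⟨hx b h, h ▸ this⟩
      · exact x_mem_G _ _ _
    · refine ⟨v k, ?_⟩
      rw [if_neg (not_lt.mpr (hv k))]
      split_ifs with h
      · have := y_mem_G (β := β) w v k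
        exact ⟨hy k h, h ▸ this⟩
      · exact y_mem_G _ _ _

theorem contr_eq_C [DecidableEq o] (j : o) (a : KA β o) : contr j a = C (Pi.single j 1) a := by
  rw [C_apply, Finset.sum_eq_single j]
  · simp
  · intro k _ hk; simp [hk]
  · simp

theorem contr_mem_G {w : β → ℚ} {v : o → ℚ} (j : o) {g : ℚ} {a : KA β o} (ha : a ∈ G w v g) :
    contr j a ∈ G w v (g - v j) := by
  classical
  rw [contr_eq_C]
  refine C_mem_G _ _ (fun k => ?_) ha
  by_cases h : k = j
  · subst h; simpa using one_mem_G w v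
  · simp [h]

theorem NW_zero_left (v : o → ℚ) (a : KA β o) :
    NW 0 v a = ∑ j, v j • (y j * contr j a) := by
  have h : (MvPolynomial.mkDerivation ℚ fun b : β =>
      (0 : β → ℚ) b • (MvPolynomial.X b : MvPolynomial β ℚ)).toLinearMap = 0 := by
    have : (MvPolynomial.mkDerivation ℚ fun b : β =>
      (0 : β → ℚ) b • (MvPolynomial.X b : MvPolynomial β ℚ)) = 0 :=
      MvPolynomial.derivation_ext fun i => by simp
    rw [this]; rfl
  have h0 : coef (0 : MvPolynomial β ℚ →ₗ[ℚ] MvPolynomial β ℚ) a = 0 := by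
    induction a using induction_on with
    | hadd a b ha hb => rw [map_add, ha, hb, add_zero]
    | hpol r => rw [coef_pol]; simp
    | hy j a ha => rw [coef_y_mul, ha, mul_zero]
  simp only [NW, LinearMap.add_apply, h, h0, LinearMap.sum_apply, LinearMap.smul_apply,
    LinearMap.comp_apply, LinearMap.mulLeft_apply, zero_add]

/-- There are no elements of exterior length exceeding the number of odd generators. -/
theorem eq_zero_of_card_lt {g : ℚ} (hg : Fintype.card o < g) {a : KA β o}
    (ha : a ∈ G 0 1 g) : a = 0 := by
  classical
  have key : ∀ (S : Finset o) (g : ℚ) (a : KA β o), (S.card : ℚ) < g →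
      a ∈ G (0 : β → ℚ) (fun j => if j ∈ S then 1 else 0) g → a = 0 := by
    intro S
    induction S using Finset.induction_on with
    | empty =>
      intro g a hg ha
      rw [mem_G, NW_zero_left] at ha
      simp only [Finset.notMem_empty, if_false, zero_smul, Finset.sum_const_zero] at ha
      have : g ≠ 0 := by simp at hg; exact hg.ne'
      exact (smul_eq_zero.mp ha.symm).resolve_left this
    | insert k S hk ih =>
      intro g a hg ha
      rw [Finset.card_insert_of_notMem hk] at hg
      push_cast at hg
      have hv : ∀ b : KA β o, NW 0 (fun j => if j ∈ insert k S then 1 else 0) b =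
          y k * contr k b + NW 0 (fun j => if j ∈ S then 1 else 0) b := by
        intro b
        rw [NW_zero_left, NW_zero_left, ← Finset.sum_erase_add _ _ (Finset.mem_univ k), add_comm,
          ← Finset.sum_erase_add (f := fun j => (if j ∈ S then (1 : ℚ) else 0) • (y j * contr j b))
            _ (Finset.mem_univ k)]
        simp only [Finset.mem_insert_self, if_true, one_smul, hk, if_false, zero_smul, add_zero]
        congr 1
        refine Finset.sum_congr rfl fun j hj => ?_
        simp [Finset.ne_of_mem_erase hj]
      have he : y k * contr k a ∈ G (0 : β → ℚ) (fun j => if j ∈ insert k S then 1 else 0) g := by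
        have := mul_mem_G _ _ _ _ (y_mem_G (0 : β → ℚ)
          (fun j => if j ∈ insert k S then 1 else 0) k) (contr_mem_G k ha)
        simpa using this
      have hee : y k * contr k (y k * contr k a) = y k * contr k a := by
        rw [contr_y_mul, if_pos rfl, mul_sub, ← mul_assoc, y_mul_self]; simp
      have h1 : y k * contr k a = 0 := by
        refine ih (g - 1) _ (by linarith) ?_
        rw [mem_G] at he ⊢
        rw [hv, hee] at he
        rw [sub_smul, one_smul, ← he]; abel
      refine ih g a (by linarith) ?_
      rw [mem_G] at ha ⊢
      rwa [hv, h1, zero_add] at ha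
  refine key Finset.univ g a (by simpa using hg) ?_
  have : (fun j : o => if j ∈ (Finset.univ : Finset o) then (1 : ℚ) else 0) = 1 := by
    ext; simp
  rwa [this]

end Weights
end KA

end

section

namespace KA

open MvPolynomial (X pderiv)

section Resolution
variable {β κ : Type} [Fintype β] [Fintype κ]

variable (β κ) in
/-- The Koszul differential resolving the even generators. -/
def hatD : KA β (κ ⊕ β) →ₗ[ℚ] KA β (κ ⊕ β) := C (Sum.elim 0 X)

variable (β κ) in
/-- The standard null-homotopy of the Koszul differential. -/
def hatH : KA β (κ ⊕ β) →ₗ[ℚ] KA β (κ ⊕ β) :=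
  ∑ b, LinearMap.mulLeft ℚ (y (Sum.inr b)) ∘ₗ coef (pderiv b).toLinearMap

theorem hatD_hatH (a : KA β (κ ⊕ β)) :
    hatD β κ (hatH β κ a) + hatH β κ (hatD β κ a) = NW 1 (Sum.elim 0 1) a := by
  classical
  have hh : ∀ a, hatH β κ a = ∑ b, y (Sum.inr b) * coef (pderiv b).toLinearMap a := by
    intro a; simp [hatH, LinearMap.sum_apply]
  have hy : ∀ k a, hatH β κ (y k * a) = - (y k * hatH β κ a) := by
    intro k a
    rw [hh, hh, Finset.mul_sum, ← Finset.sum_neg_distrib]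
    refine Finset.sum_congr rfl fun b _ => ?_
    rw [coef_y_mul, ← mul_assoc, y_mul_y, neg_mul, mul_assoc]
  have hX : ∀ b a, hatH β κ (pol (X b) * a) = y (Sum.inr b) * a + pol (X b) * hatH β κ a := by
    intro b a
    rw [hh, hh, Finset.mul_sum]
    have : ∀ b', y (Sum.inr b') * coef (pderiv b').toLinearMap (pol (X b) * a) =
        (if b' = b then y (Sum.inr b') * a else 0) +
          pol (X b) * (y (Sum.inr b') * coef (pderiv b').toLinearMap a) := by
      intro b'
      have h2 : coef (pderiv b').toLinearMap (pol (X b) * a) =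
          (if b' = b then a else 0) + pol (X b) * coef (pderiv b').toLinearMap a := by
        induction a using induction_on with
        | hadd a c ha hc =>
          rw [mul_add, map_add, ha, hc, map_add, mul_add]
          split_ifs <;> abel
        | hpol r =>
          rw [← map_mul, coef_pol, coef_pol]
          by_cases h : b' = b
          · subst h
            simp [mul_comm]
          · simp [h, MvPolynomial.pderiv_X_of_ne (Ne.symm h)]
        | hy j a ha =>
          rw [← pol_left_comm, coef_y_mul, ha, mul_add, coef_y_mul, pol_left_comm]
          split_ifs <;> simp
      rw [h2, mul_add, pol_left_comm]
      split_ifs <;> simp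
    simp only [this, Finset.sum_add_distrib, Finset.sum_ite_eq', Finset.mem_univ, if_true]
  induction a using induction_on with
  | hadd a b ha hb => simp only [map_add, ← ha, ← hb]; abel
  | hpol r =>
    rw [hatD, C_pol, map_zero, add_zero, NW_pol, hh, map_sum]
    simp only [coef_pol, C_y_mul, C_pol, mul_zero, sub_zero, Sum.elim_inr, ← map_mul, ← map_sum]
    congr 1
    have : (∑ b, (X b : MvPolynomial β ℚ) • pderiv (R := ℚ) b) =
        MvPolynomial.mkDerivation ℚ fun b => (1 : β → ℚ) b • X b :=
      MvPolynomial.derivation_ext fun i => by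
        rw [MvPolynomial.mkDerivation_X]
        have hc : ∀ (s : Finset β), (∑ b ∈ s, (X b : MvPolynomial β ℚ) • pderiv (R := ℚ) b) (X i) =
            ∑ b ∈ s, X b * pderiv b (X i) := by
          intro s
          induction s using Finset.induction_on with
          | empty => simp
          | insert b s hb ih => rw [Finset.sum_insert hb, Finset.sum_insert hb,
              Derivation.add_apply, ih]; rfl
        rw [hc, Finset.sum_eq_single i]
        · simp
        · intro b _ hb; rw [MvPolynomial.pderiv_X_of_ne hb.symm, mul_zero]
        · simp
    rw [← this]
    have hc : ∀ (s : Finset β), (∑ b ∈ s, (X b : MvPolynomial β ℚ) • pderiv (R := ℚ) b) r =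
        ∑ b ∈ s, X b * pderiv b r := by
      intro s
      induction s using Finset.induction_on with
      | empty => simp
      | insert b s hb ih => rw [Finset.sum_insert hb, Finset.sum_insert hb,
          Derivation.add_apply, ih]; rfl
    rw [hc]; rfl
  | hy k a ha =>
    rw [NW_y_mul, ← ha, hy, map_neg, hatD, C_y_mul, C_y_mul, map_sub, ← hatD, hy]
    rcases k with j | b
    · simp only [Sum.elim_inl, Pi.zero_apply, map_zero, zero_mul, zero_smul, mul_add]
      abel
    · simp only [Sum.elim_inr, hX, mul_add, Pi.one_apply, one_smul]
      abel

variable (β κ) in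
/-- The projection killing the even generators and their resolving odd generators. -/
def hatProj : KA β (κ ⊕ β) →ₐ[ℚ] KA Empty κ := by
  classical
  exact linMap 0 (Sum.elim (fun j => Pi.single j 1) 0)

variable (β κ) in
/-- The inclusion of the exterior algebra on the remaining odd generators. -/
def hatIncl : KA Empty κ →ₐ[ℚ] KA β (κ ⊕ β) := by
  classical
  exact linMap Empty.elim fun j => Pi.single (Sum.inl j) 1

theorem hatProj_hatIncl (a : KA Empty κ) : hatProj β κ (hatIncl β κ a) = a := by
  classical
  have : (hatProj β κ).comp (hatIncl β κ) = AlgHom.id ℚ _ :=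
    algHom_ext (fun i => i.elim) fun j => by
      simp [hatProj, hatIncl, linMap_y, lin_single]
  exact DFunLike.congr_fun this a

theorem hatProj_hatD (a : KA β (κ ⊕ β)) : hatProj β κ (hatD β κ a) = 0 := by
  classical
  have := C_linMap (0 : β → MvPolynomial Empty ℚ) (Sum.elim (fun j : κ => Pi.single j 1) 0)
    (Sum.elim 0 X) (0 : κ → MvPolynomial Empty ℚ) (by rintro (j | b) <;> simp) a
  rw [hatD, hatProj, ← this]
  simp [C_apply]

theorem hatD_hatIncl (a : KA Empty κ) : hatD β κ (hatIncl β κ a) = 0 := by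
  classical
  have := C_linMap Empty.elim (fun j : κ => Pi.single (Sum.inl j) 1)
    (0 : κ → MvPolynomial Empty ℚ) (Sum.elim (0 : κ → MvPolynomial β ℚ) X) (by
      intro j
      rw [Finset.sum_eq_single (Sum.inl j)]
      · simp
      · intro k _ hk; simp [hk]
      · simp) a
  rw [hatD, hatIncl, this]
  simp [C_apply]

theorem hatD_exact (a : KA β (κ ⊕ β)) (ha : hatD β κ a = 0) :
    ∃ e, a = hatIncl β κ (hatProj β κ a) + hatD β κ e := by
  classical
  have hincl0 : ∀ a ∈ G (1 : β → ℚ) (Sum.elim (0 : κ → ℚ) (1 : β → ℚ)) 0,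
      ∃ c, hatIncl β κ c = a := fun a ha =>
    G_zero_le (fun _ => zero_le_one) (by rintro (j | b) <;> simp) (hatIncl β κ).range
      (fun b hb => by simp at hb) (by
        rintro (j | b) h
        · exact ⟨y j, by simp [hatIncl, linMap_y, lin_single]⟩
        · simp at h) ha
  have key : ∀ a : KA β (κ ⊕ β), a - hatIncl β κ (hatProj β κ a) ∈
      LinearMap.range (NW (1 : β → ℚ) (Sum.elim (0 : κ → ℚ) (1 : β → ℚ))) := by
    intro a
    have ht := (isGenGraded (1 : β → ℚ) (Sum.elim (0 : κ → ℚ) (1 : β → ℚ))).iSup_eq_top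
    have ha : a ∈ ⨆ i, G (1 : β → ℚ) (Sum.elim (0 : κ → ℚ) (1 : β → ℚ)) i := ht ▸ trivial
    induction ha using Submodule.iSup_induction' with
    | zero => simp
    | add a b _ _ ha hb =>
      rw [map_add, map_add, add_sub_add_comm]
      exact add_mem ha hb
    | mem g a ha =>
      by_cases hg : g = 0
      · subst hg
        obtain ⟨c, rfl⟩ := hincl0 a ha
        rw [hatProj_hatIncl, sub_self]
        exact zero_mem _
      · have h0 : hatProj β κ a = 0 := by
          have := (isGenGraded (1 : β → ℚ) (Sum.elim (0 : κ → ℚ) (1 : β → ℚ))).map_mem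
            (H := fun g => if g = 0 then (⊤ : Submodule ℚ (KA Empty κ)) else ⊥) (by simp)
            (by
              intro i j a b ha hb
              split_ifs at ha hb with h1 h2 h2
              · subst h1 h2; simp
              · rw [(Submodule.mem_bot ℚ).mp hb, mul_zero]; exact zero_mem _
              · rw [(Submodule.mem_bot ℚ).mp ha, zero_mul]; exact zero_mem _
              · rw [(Submodule.mem_bot ℚ).mp ha, zero_mul]; exact zero_mem _) (hatProj β κ)
            (by
              rintro _ (⟨b, rfl⟩ | ⟨j | b, rfl⟩)
              · exact ⟨_, x_mem_G _ _ _, by simp [hatProj, linMap_x]⟩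
              · exact ⟨_, y_mem_G _ _ _, by simp⟩
              · exact ⟨_, y_mem_G _ _ _, by simp [hatProj, linMap_y, lin_zero]⟩) g a ha
          simpa [hg] using this
        rw [h0, map_zero, sub_zero]
        refine ⟨g⁻¹ • a, ?_⟩
        rw [map_smul, mem_G.mp ha, smul_smul, inv_mul_cancel₀ hg, one_smul]
  obtain ⟨b, hb⟩ := key a
  have hDb : hatD β κ b = 0 := by
    have h1 : NW (1 : β → ℚ) (Sum.elim (0 : κ → ℚ) (1 : β → ℚ)) (hatD β κ b) = 0 := by
      rw [← hatD_hatH]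
      have h2 : hatD β κ (hatD β κ b) = 0 := C_sq _ _
      rw [h2, map_zero, add_zero]
      have h3 := congrArg (hatD β κ) hb
      rw [← hatD_hatH, map_add, map_sub, ha, hatD_hatIncl, sub_zero] at h3
      have h4 : hatD β κ (hatD β κ (hatH β κ b)) = 0 := C_sq _ _
      rwa [h4, zero_add] at h3
    obtain ⟨c, hc⟩ := hincl0 (hatD β κ b) (by rw [mem_G, h1, zero_smul])
    have h5 := hatProj_hatD b
    rw [← hc, hatProj_hatIncl] at h5
    rw [← hc, h5, map_zero]
  refine ⟨hatH β κ b, ?_⟩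
  rw [← hatD_hatH, hDb, map_zero, add_zero] at hb
  rw [hb]; abel

/-- Vanishing of the cohomology of the resolution above the top degree. -/
theorem hatD_vanishing (w : β → ℚ) (vs : β → ℚ) (δ : ℚ) (hδ : ∀ b, w b = vs b + δ) (g : ℚ)
    (hg : Fintype.card κ < g) (a : KA β (κ ⊕ β)) (ha : a ∈ G w (Sum.elim 1 vs) g)
    (hDa : hatD β κ a = 0) : ∃ e ∈ G w (Sum.elim 1 vs) (g - δ), hatD β κ e = a := by
  classical
  have hp : hatProj β κ a = 0 := by
    refine eq_zero_of_card_lt hg ?_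
    refine (isGenGraded w (Sum.elim 1 vs)).map_mem (H := G 0 1) (one_mem_G _ _) mul_mem_G
      (hatProj β κ) ?_ g a ha
    rintro _ (⟨b, rfl⟩ | ⟨j | b, rfl⟩)
    · exact ⟨_, x_mem_G _ _ _, by simp [hatProj, linMap_x]⟩
    · refine ⟨_, y_mem_G _ _ _, ?_⟩
      simpa [hatProj, linMap_y, lin_single] using y_mem_G (0 : Empty → ℚ) (1 : κ → ℚ) j
    · exact ⟨_, y_mem_G _ _ _, by simp [hatProj, linMap_y, lin_zero]⟩
  obtain ⟨e, he⟩ := hatD_exact a hDa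
  rw [hp, map_zero, zero_add] at he
  have hh : ∀ i, ∀ a ∈ G w (Sum.elim (1 : κ → ℚ) vs) i,
      hatD β κ a ∈ G w (Sum.elim (1 : κ → ℚ) vs) (i + δ) := by
    intro i a ha
    have := C_mem_G (Sum.elim 0 X) (-δ) (by
      rintro (j | b)
      · simp
      · simpa [hδ] using pol_X_mem_G (w := w) (v := Sum.elim (1 : κ → ℚ) vs) b) ha
    simpa [hatD] using this
  obtain ⟨e', he', h⟩ := exists_homogeneous_preimage (isGenGraded w (Sum.elim 1 vs)).indep
    (isGenGraded w (Sum.elim 1 vs)).iSup_eq_top (hatD β κ) (fun i => i + δ)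
    (add_left_injective δ) hh (g - δ) e (by rw [← he]; simpa using ha)
  exact ⟨e', he', by rw [h, he]⟩

/-- The product of the odd generators does not bound in the resolution. -/
theorem exists_top : ∃ Ω : KA β (κ ⊕ β), hatD β κ Ω = 0 ∧ (∀ η, hatD β κ η ≠ Ω) ∧
    ∀ (w : β → ℚ) (v : κ → ℚ) (vs : β → ℚ), Ω ∈ G w (Sum.elim v vs) (∑ j, v j) := by
  classical
  let P : KA Empty κ := (Finset.univ.toList.map y).prod
  have hP : P ≠ 0 := by
    have key : ∀ l : List κ, l.Nodup → (l.foldl (fun a j => contr j a) (l.map y).prod :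
        KA Empty κ) = 1 := by
      intro l
      induction l with
      | nil => intro _; simp
      | cons k l ih =>
        intro hl
        rw [List.foldl_cons, List.map_cons, List.prod_cons, contr_y_mul, if_pos rfl]
        have : ∀ l : List κ, k ∉ l → contr k (l.map y).prod = (0 : KA Empty κ) := by
          intro l
          induction l with
          | nil =>
            intro _
            simpa using contr_pol (β := Empty) k 1
          | cons i l ih2 =>
            intro hk
            rw [List.map_cons, List.prod_cons, contr_y_mul, if_neg (by rintro rfl; simp at hk),
              ih2 (fun h => hk (List.mem_cons_of_mem _ h))]
            simp
        rw [this l (List.nodup_cons.mp hl).1, mul_zero, sub_zero, ih hl.of_cons]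
    intro h0
    have h1 := key Finset.univ.toList (Finset.nodup_toList _)
    change (Finset.univ.toList.foldl (fun a j => contr j a) P : KA Empty κ) = 1 at h1
    rw [h0] at h1
    have : ∀ l : List κ, (l.foldl (fun a j => contr j a) 0 : KA Empty κ) = 0 := by
      intro l
      induction l with
      | nil => rfl
      | cons k l ih => rw [List.foldl_cons, map_zero, ih]
    rw [this] at h1
    have h2 := congrArg (linMap (κ := κ) (o := Empty) (β' := Empty) Empty.elim 0) h1
    have h3 : Function.Injective (algebraMap ℚ (KA Empty Empty)) := by
      have : Nontrivial (KA Empty Empty) := by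
        unfold KA
        infer_instance
      exact FaithfulSMul.algebraMap_injective ℚ _
    rw [map_zero, map_one] at h2
    exact zero_ne_one (h3 (by rw [map_zero, map_one]; exact h2))
  refine ⟨hatIncl β κ P, hatD_hatIncl P, fun η hη => hP ?_, fun w v vs => ?_⟩
  · rw [← hatProj_hatIncl (β := β) P, ← hη, hatProj_hatD]
  · have hPG : ∀ l : List κ, hatIncl β κ (l.map y).prod ∈
        G w (Sum.elim v vs) (l.map v).sum := by
      intro l
      induction l with
      | nil => simpa using one_mem_G _ _
      | cons k l ih =>
        rw [List.map_cons, List.map_cons, List.prod_cons, map_mul, List.sum_cons]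
        refine mul_mem_G _ _ _ _ ?_ ih
        simpa [hatIncl, linMap_y, lin_single] using
          y_mem_G w (Sum.elim v vs) (Sum.inl k : κ ⊕ β)
    have := hPG Finset.univ.toList
    rwa [Finset.sum_map_toList] at this

end Resolution
end KA

end

section

namespace KA

open MvPolynomial (X)

theorem C_homogeneous_preimage {β o : Type} [Fintype o] {w : β → ℚ} {v : o → ℚ}
    (φ : o → MvPolynomial β ℚ) (s : ℚ)
    (hφ : ∀ j, (pol (φ j) : KA β o) ∈ G w v (v j - s)) {g : ℚ} {b : KA β o}
    (hb : C φ b ∈ G w v g) : ∃ b' ∈ G w v (g + s), C φ b' = C φ b :=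
  exists_homogeneous_preimage (isGenGraded w v).indep (isGenGraded w v).iSup_eq_top (C φ)
    (fun i => i - s) sub_left_injective (fun _ _ ha => C_mem_G φ s hφ ha) (g + s) b
    (by rwa [add_sub_cancel_right])

section Koszul
variable {β κ : Type} [Fintype β] [Fintype κ] [DecidableEq β] [DecidableEq κ]

/-- The contraction of the resolution attached to a matrix of polynomials. -/
def hatC (a : κ → β → MvPolynomial β ℚ) (b : β) : Module.End ℚ (KA β (κ ⊕ β)) :=
  C (Sum.elim (fun j => -a j b) (Pi.single b 1))

/-- The embedding into the resolution attached to a matrix of polynomials. -/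
def hatT (a : κ → β → MvPolynomial β ℚ) : KA β κ →ₐ[ℚ] KA β (κ ⊕ β) :=
  linMap X fun j => Sum.elim (Pi.single j 1) (a j)

variable (β κ) in
/-- The projection of the resolution killing the resolving odd generators. -/
def hatR : KA β (κ ⊕ β) →ₐ[ℚ] KA β κ := linMap X (Sum.elim (fun j => Pi.single j 1) 0)

theorem hatR_hatT (a : κ → β → MvPolynomial β ℚ) (e : KA β κ) : hatR β κ (hatT a e) = e := by
  have : (hatR β κ).comp (hatT a) = AlgHom.id ℚ _ :=
    algHom_ext (fun i => by simp [hatR, hatT, linMap_x, linMap_pol]; rfl) fun j => by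
      rw [AlgHom.comp_apply, hatT, linMap_y, hatR, linMap_lin, AlgHom.id_apply, ← lin_single]
      congr 1
      ext1 k
      rw [Fintype.sum_sum_type, Finset.sum_eq_single j]
      · simp
      · intro i _ hi; simp [hi]
      · simp
  exact DFunLike.congr_fun this e

theorem hatC_hatT (a : κ → β → MvPolynomial β ℚ) (b : β) (e : KA β κ) :
    hatC a b (hatT a e) = 0 := by
  have := C_linMap X (fun j => Sum.elim (Pi.single j 1) (a j))
    (0 : κ → MvPolynomial β ℚ) (Sum.elim (fun j => -a j b) (Pi.single b 1)) (by
      intro k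
      rw [Fintype.sum_sum_type, Finset.sum_eq_single k, Finset.sum_eq_single b]
      · simp
      · intro i _ hi; simp [hi]
      · simp
      · intro i _ hi; simp [hi]
      · simp) e
  rw [hatC, hatT, this]
  simp [C_apply]

theorem hatD_hatT {a : κ → β → MvPolynomial β ℚ} {p : κ → MvPolynomial β ℚ}
    (hp : ∀ j, ∑ b, a j b * X b = p j) (e : KA β κ) :
    hatD β κ (hatT a e) = hatT a (C p e) :=
  C_linMap X (fun j => Sum.elim (Pi.single j 1) (a j)) p (Sum.elim 0 X) (by
    intro k
    rw [Fintype.sum_sum_type]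
    simp [hp]) e

theorem hatR_hatD {a : κ → β → MvPolynomial β ℚ} {p : κ → MvPolynomial β ℚ}
    (hp : ∀ j, ∑ b, a j b * X b = p j) {e : KA β (κ ⊕ β)} (he : ∀ b, hatC a b e = 0) :
    hatR β κ (hatD β κ e) = C p (hatR β κ e) := by
  have h1 : hatR β κ (C (Sum.elim p 0) e) = C p (hatR β κ e) := by
    refine (C_linMap X _ (Sum.elim p 0) p ?_ e).symm
    rintro (j | b)
    · rw [Finset.sum_eq_single j]
      · simp
      · intro i _ hi; simp [hi]
      · simp
    · simp
  have h2 : hatD β κ e = ∑ b, pol (X b) * hatC a b e + C (Sum.elim p 0) e := by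
    simp only [hatD, hatC, C_apply, Finset.mul_sum]
    rw [Finset.sum_comm, ← Finset.sum_add_distrib]
    refine Finset.sum_congr rfl fun k _ => ?_
    simp only [← mul_assoc, ← map_mul, ← Finset.sum_mul, ← add_mul, ← map_sum, ← map_add]
    congr 2
    rcases k with j | b
    · simp [← hp, mul_comm]
    · rw [Finset.sum_eq_single b]
      · simp
      · intro i _ hi; simp [hi.symm]
      · simp
  rw [h2, map_add, h1]
  simp [he]

theorem hatT_hatR (a : κ → β → MvPolynomial β ℚ) {e : KA β (κ ⊕ β)}
    (he : ∀ b, hatC a b e = 0) : hatT a (hatR β κ e) = e := by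
  let Ψ : KA β (κ ⊕ β) →ₐ[ℚ] KA β (κ ⊕ β) := linMap X
    (Sum.elim (fun j => Sum.elim (Pi.single j 1) (a j)) fun b => Pi.single (Sum.inr b) 1)
  let Ψ' : KA β (κ ⊕ β) →ₐ[ℚ] KA β (κ ⊕ β) := linMap X
    (Sum.elim (fun j => Sum.elim (Pi.single j 1) (-a j)) fun b => Pi.single (Sum.inr b) 1)
  let ι : KA β κ →ₐ[ℚ] KA β (κ ⊕ β) := linMap X fun j => Pi.single (Sum.inl j) 1
  have h1 : Ψ.comp Ψ' = AlgHom.id ℚ _ :=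
    algHom_ext (fun i => by simp [Ψ, Ψ', linMap_x, linMap_pol]; rfl) (by
      rintro (j | b)
      · simp only [Ψ, Ψ', AlgHom.comp_apply, linMap_y, linMap_lin, AlgHom.id_apply]
        rw [← lin_single]
        congr 1
        ext1 k
        rw [Fintype.sum_sum_type]
        simp only [Sum.elim_inl, Sum.elim_inr]
        rw [Finset.sum_eq_single j]
        · rcases k with i | b
          · by_cases h : i = j
            · subst h; simp
            · simp [h]
          · rw [Finset.sum_eq_single b]
            · simp
            · intro i _ hi
              simp [hi.symm]
            · simp
        · intro i _ hi; simp [hi]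
        · simp
      · simp [Ψ, Ψ', linMap_y, lin_single])
  have h2 : Ψ.comp ι = hatT a := algHom_ext (fun i => by simp [Ψ, ι, hatT, linMap_x, linMap_pol])
    fun j => by simp [Ψ, ι, hatT, linMap_y, lin_single]
  have h3 : ∀ b, C (Pi.single (Sum.inr b) 1) (Ψ' e) = 0 := by
    intro b
    have := C_linMap X (Sum.elim (fun j : κ => Sum.elim (Pi.single j 1) (-a j))
      fun b => Pi.single (Sum.inr b) 1) (Sum.elim (fun j => -a j b) (Pi.single b 1))
      (Pi.single (Sum.inr b) 1) (by
        intro k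
        rw [Finset.sum_eq_single (Sum.inr b)]
        · rcases k with j | i
          · simp
          · by_cases h : i = b
            · subst h; simp
            · simp [h, Ne.symm h]
        · intro i _ hi; simp [hi]
        · simp) e
    refine this.trans ?_
    have h := he b
    rw [hatC] at h
    rw [h, map_zero]
  have h4 : Ψ' e ∈ G (0 : β → ℚ) (Sum.elim (0 : κ → ℚ) 1) 0 := by
    rw [mem_G, NW_zero_left, Fintype.sum_sum_type]
    simp only [contr_eq_C, h3]
    simp
  obtain ⟨e', he'⟩ : ∃ e', ι e' = Ψ' e :=
    G_zero_le (fun _ => le_rfl) (by rintro (j | b) <;> simp) ι.range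
      (fun b _ => ⟨x b, by simp [ι, linMap_x]; rfl⟩) (by
        rintro (j | b) h
        · exact ⟨y j, by simp [ι, linMap_y, lin_single]⟩
        · simp at h) h4
  have h5 : e = hatT a e' := by
    rw [← h2, AlgHom.comp_apply, he', ← AlgHom.comp_apply, h1, AlgHom.id_apply]
  rw [h5, hatR_hatT]

theorem hatT_mem_G {a : κ → β → MvPolynomial β ℚ} {w : β → ℚ} {v : κ → ℚ} {vs : β → ℚ}
    (ha : ∀ j b, (pol (a j b) : KA β (κ ⊕ β)) ∈ G w (Sum.elim v vs) (v j - vs b)) {g : ℚ}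
    {e : KA β κ} (he : e ∈ G w v g) : hatT a e ∈ G w (Sum.elim v vs) g :=
  linMap_mem_G (fun b => pol_X_mem_G b) (by
    rintro j (i | b)
    · by_cases h : i = j
      · subst h; simpa using one_mem_G _ _
      · simp [h]
    · exact ha j b) he

theorem hatR_mem_G {w : β → ℚ} {v : κ → ℚ} {vs : β → ℚ} {g : ℚ}
    {e : KA β (κ ⊕ β)} (he : e ∈ G w (Sum.elim v vs) g) : hatR β κ e ∈ G w v g :=
  linMap_mem_G (fun b => pol_X_mem_G b) (by
    rintro (i | b) j
    · simpa using pol_single_mem_G i j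
    · simp) he

theorem hatC_mem_G {a : κ → β → MvPolynomial β ℚ} {w : β → ℚ} {v : κ → ℚ} {vs : β → ℚ}
    (ha : ∀ j b, (pol (a j b) : KA β (κ ⊕ β)) ∈ G w (Sum.elim v vs) (v j - vs b)) (b : β)
    {g : ℚ} {e : KA β (κ ⊕ β)} (he : e ∈ G w (Sum.elim v vs) g) :
    hatC a b e ∈ G w (Sum.elim v vs) (g - vs b) := by
  refine C_mem_G _ _ ?_ he
  rintro (j | i)
  · simpa using ha j b
  · by_cases h : i = b
    · subst h; simpa using one_mem_G _ _
    · simp [h]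

set_option maxHeartbeats 1000000 in
theorem koszulSystem {a : κ → β → MvPolynomial β ℚ} {p : κ → MvPolynomial β ℚ}
    (hp : ∀ j, ∑ b, a j b * X b = p j) (L : β → ℕ) (r : β → κ → MvPolynomial β ℚ)
    (hr : ∀ b, ∑ j, r b j * p j = X b ^ L b) (σ δ : ℚ) (pos : 0 ≤ σ + δ)
    (ha : ∀ j b, (pol (a j b) : KA β (κ ⊕ β)) ∈
      G (fun _ => σ + δ) (Sum.elim 1 fun _ => σ) (1 - σ))
    (hrG : ∀ b j, (pol (r b j) : KA β κ) ∈ G (fun _ => σ + δ) 1 (L b * (σ + δ) - δ - 1)) :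
    KoszulSystem (hatD β κ) (hatC a) (fun b => LinearMap.mulLeft ℚ (y (Sum.inr b)))
      (fun b => LinearMap.mulLeft ℚ (x b)) (fun b => LinearMap.mulLeft ℚ (hatT a (lin (r b)))) L
      (G (fun _ => σ + δ) (Sum.elim 1 fun _ => σ)) σ δ where
  pos := pos
  cc b b' e := by rw [hatC, hatC, C_C]
  cs b b' e := by
    simp only [LinearMap.mulLeft_apply, hatC, C_y_mul, Sum.elim_inr]
    by_cases h : b = b'
    · subst h; simp
    · simp [h, Ne.symm h]
  Dc b e := by rw [hatC, hatD, C_C]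
  Ds b e := by simp [hatD, C_y_mul, x]
  cξ b b' e := by
    rw [LinearMap.mulLeft_apply, LinearMap.mulLeft_apply, x, hatC, C_pol_mul]
  Dξ b e := by
    rw [LinearMap.mulLeft_apply, LinearMap.mulLeft_apply, x, hatD, C_pol_mul]
  Dh b e := by
    have h1 : (LinearMap.mulLeft ℚ (x b : KA β (κ ⊕ β)) ^ L b) e = pol (X b ^ L b) * e := by
      rw [LinearMap.pow_mulLeft, LinearMap.mulLeft_apply, map_pow]; rfl
    have h2 : hatD β κ (hatT a (lin (r b))) = pol (X b ^ L b) := by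
      rw [hatD_hatT hp, C_lin, hr, hatT, linMap_pol]; simp
    rw [h1, ← h2, LinearMap.mulLeft_apply, LinearMap.mulLeft_apply, hatD, hatT, linMap_lin,
      C_lin_mul, C_lin]
  ch b b' e := by
    have h2 : hatC a b' (hatT a (lin (r b))) = 0 := hatC_hatT _ _ _
    rw [LinearMap.mulLeft_apply, LinearMap.mulLeft_apply]
    rw [hatC, hatT, linMap_lin, C_lin] at h2
    rw [hatC, hatT, linMap_lin, C_lin_mul, h2, zero_mul, zero_sub]
  cG b g e he := hatC_mem_G (by simpa using ha) b he
  sG b g e he := by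
    have := mul_mem_G _ _ _ _ (y_mem_G (fun _ : β => σ + δ) (Sum.elim (1 : κ → ℚ) fun _ => σ)
      (Sum.inr b)) he
    rwa [add_comm _ g] at this
  ξG b g e he := by
    have := mul_mem_G _ _ _ _ (x_mem_G (fun _ : β => σ + δ) (Sum.elim (1 : κ → ℚ) fun _ => σ)
      b) he
    rwa [add_comm _ g] at this
  hG b g e he := by
    have h1 : lin (r b) ∈ G (fun _ : β => σ + δ) (1 : κ → ℚ) (L b * (σ + δ) - δ) :=
      lin_mem_G (hrG b)
    have := mul_mem_G _ _ _ _ (hatT_mem_G (by simpa using ha) h1) he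
    rw [add_comm _ g, ← add_sub_assoc] at this
    exact this

theorem vanishing {a : κ → β → MvPolynomial β ℚ} {p : κ → MvPolynomial β ℚ}
    (hp : ∀ j, ∑ b, a j b * X b = p j) (L : β → ℕ) (r : β → κ → MvPolynomial β ℚ)
    (hr : ∀ b, ∑ j, r b j * p j = X b ^ L b) (σ δ : ℚ) (pos : 0 ≤ σ + δ)
    (ha : ∀ j b, (pol (a j b) : KA β (κ ⊕ β)) ∈
      G (fun _ => σ + δ) (Sum.elim 1 fun _ => σ) (1 - σ))
    (hrG : ∀ b j, (pol (r b j) : KA β κ) ∈ G (fun _ => σ + δ) 1 (L b * (σ + δ) - δ - 1))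
    (g : ℚ) (hg : Fintype.card κ - σ * Fintype.card β < g) (e : KA β κ)
    (he : e ∈ G (fun _ => σ + δ) 1 g) (hDe : C p e = 0) :
    ∃ e' ∈ G (fun _ => σ + δ) 1 (g - δ), C p e' = e := by
  obtain ⟨e', h1, h2, h3⟩ := (koszulSystem hp L r hr σ δ pos ha hrG).vanishing (Fintype.card κ)
    (fun g hg a ha hDa => hatD_vanishing _ _ _ (fun _ => rfl) g hg a ha hDa) Finset.univ g
    (by simpa using hg) (hatT a e) (hatT_mem_G (by simpa using ha) he)
    (fun b _ => hatC_hatT _ _ _) (by rw [hatD_hatT hp, hDe, map_zero])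
  refine ⟨hatR β κ e', hatR_mem_G h1, ?_⟩
  rw [← hatR_hatD hp (fun b => h2 b (Finset.mem_univ b)), h3, hatR_hatT]

theorem pol_mem_G_zero (v : κ → ℚ) (r : MvPolynomial β ℚ) : (pol r : KA β κ) ∈ G 0 v 0 := by
  rw [mem_G, NW_zero_left]; simp [contr_pol]

theorem exists_pow_of_mem_radical {p : κ → MvPolynomial β ℚ}
    (hX : ∀ b, (X b : MvPolynomial β ℚ) ∈ (Ideal.span (Set.range p)).radical) :
    ∃ (L : β → ℕ) (r : β → κ → MvPolynomial β ℚ), ∀ b, ∑ j, r b j * p j = X b ^ L b := by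
  choose L hL using hX
  simp only [Ideal.mem_span_range_iff_exists_fun] at hL
  choose r hr using hL
  exact ⟨L, r, hr⟩

/-- A cocycle of large exterior length is exact. -/
theorem exact_of_lt {a : κ → β → MvPolynomial β ℚ} {p : κ → MvPolynomial β ℚ}
    (hp : ∀ j, ∑ b, a j b * X b = p j)
    (hX : ∀ b, (X b : MvPolynomial β ℚ) ∈ (Ideal.span (Set.range p)).radical)
    (g : ℚ) (hg : (Fintype.card κ : ℚ) - Fintype.card β < g) (e : KA β κ)
    (he : e ∈ G 0 1 g) (hDe : C p e = 0) : ∃ e' ∈ G 0 1 (g + 1), C p e' = e := by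
  obtain ⟨L, r, hr⟩ := exists_pow_of_mem_radical hX
  have h0 : (fun _ : β => (1 : ℚ) + -1) = 0 := by ext; simp
  have := vanishing hp L r hr 1 (-1) (by norm_num)
    (by intro j b; rw [h0]; simpa using pol_mem_G_zero _ _)
    (by intro j b; rw [h0]; simpa using pol_mem_G_zero _ _) g (by simpa using hg) e
    (by rwa [h0]) hDe
  rw [h0] at this
  simpa using this

set_option maxHeartbeats 1000000 in
/-- Non-exact cocycles of prescribed weight. -/
theorem exists_nonexact {a : κ → β → MvPolynomial β ℚ} {p : κ → MvPolynomial β ℚ}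
    (hp : ∀ j, ∑ b, a j b * X b = p j)
    (hX : ∀ b, (X b : MvPolynomial β ℚ) ∈ (Ideal.span (Set.range p)).radical)
    (w : β → ℚ) (v : κ → ℚ) (vs : β → ℚ)
    (ha : ∀ j b, (pol (a j b) : KA β (κ ⊕ β)) ∈ G w (Sum.elim v vs) (v j - vs b)) :
    ∃ ω ∈ G w v (∑ j, v j - ∑ b, vs b), C p ω = 0 ∧ ∀ η, C p η ≠ ω := by
  obtain ⟨L, r, hr⟩ := exists_pow_of_mem_radical hX
  have h0 : (fun _ : β => (1 : ℚ) + -1) = 0 := by ext; simp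
  have K := koszulSystem hp L r hr 1 (-1) (by norm_num)
    (by intro j b; rw [h0]; simpa using pol_mem_G_zero _ _)
    (by intro j b; rw [h0]; simpa using pol_mem_G_zero _ _)
  obtain ⟨Ω, hDΩ, hne, hΩ⟩ := exists_top (β := β) (κ := κ)
  have h1 := hΩ (fun _ : β => (1 : ℚ) + -1) 1 (fun _ => 1)
  obtain ⟨k1, k2, k3, k4⟩ := K.nonexact rfl rfl (Fintype.card κ)
    (fun g hg a ha hDa => hatD_vanishing _ _ _ (fun _ => rfl) g hg a ha hDa) Ω
    (by simpa using h1) hDΩ (fun η _ => hne η) Finset.univ.toList (Finset.nodup_toList _)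
  set ω₀ := Finset.univ.toList.foldr (fun b a_1 => hatC a b a_1) Ω with hω₀
  have kc : ∀ b, hatC a b ω₀ = 0 := fun b => k1 b (Finset.mem_toList.mpr (Finset.mem_univ b))
  refine ⟨hatR β κ ω₀, hatR_mem_G (vs := vs) ?_, ?_, ?_⟩
  · have : ∀ l : List β, l.foldr (fun b a_1 => hatC a b a_1) Ω ∈
        G w (Sum.elim v vs) (∑ j, v j - (l.map vs).sum) := by
      intro l
      induction l with
      | nil => simpa using hΩ w v vs
      | cons b l ih =>
        rw [List.foldr_cons, List.map_cons, List.sum_cons]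
        have := hatC_mem_G ha b ih
        rwa [sub_sub, add_comm] at this
    have h2 := this Finset.univ.toList
    rwa [Finset.sum_map_toList] at h2
  · rw [← hatR_hatD hp kc, k2, map_zero]
  · intro η hη
    have h5 := hatR_mem_G k3
    rw [← hη] at h5
    obtain ⟨η', h2, h3⟩ := C_homogeneous_preimage p 1
      (fun j => by rw [h0]; simpa using pol_mem_G_zero _ _) h5
    refine k4 (hatT a η') (hatT_mem_G ?_ h2) (fun b _ => hatC_hatT _ _ _) ?_
    · intro j b; rw [h0]; simpa using pol_mem_G_zero _ _
    · rw [hatD_hatT hp, h3, hη, hatT_hatR a kc]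

end Koszul
end KA

end

section

theorem exists_finset_sum {E I : Type} [AddCommGroup E] [Module ℚ E] (G : I → Submodule ℚ E)
    (a : E) (ha : a ∈ ⨆ i, G i) :
    ∃ (s : Finset I) (v : I → E), (∀ i, v i ∈ G i) ∧ a = ∑ i ∈ s, v i := by
  classical
  suffices ∃ (s : Finset I) (v : I → E), (∀ i, v i ∈ G i) ∧ (∀ i, i ∉ s → v i = 0) ∧
      a = ∑ i ∈ s, v i by
    obtain ⟨s, v, h1, -, h2⟩ := this
    exact ⟨s, v, h1, h2⟩
  induction ha using Submodule.iSup_induction' with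
  | zero => exact ⟨∅, 0, fun _ => zero_mem _, fun _ _ => rfl, by simp⟩
  | add a b _ _ ha hb =>
    obtain ⟨s, v, h1, h2, h3⟩ := ha
    obtain ⟨t, u, k1, k2, k3⟩ := hb
    refine ⟨s ∪ t, v + u, fun i => add_mem (h1 i) (k1 i), fun i hi => ?_, ?_⟩
    · rw [Finset.mem_union, not_or] at hi
      simp [h2 i hi.1, k2 i hi.2]
    · simp only [Pi.add_apply, Finset.sum_add_distrib]
      rw [h3, k3, Finset.sum_subset (Finset.subset_union_left (s₂ := t)) fun i _ hi => h2 i hi,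
        Finset.sum_subset (Finset.subset_union_right (s₁ := s)) fun i _ hi => k2 i hi]
  | mem i a ha =>
    refine ⟨{i}, Pi.single i a, fun j => ?_, fun j hj => ?_, by simp⟩
    · by_cases h : j = i
      · subst h; simpa using ha
      · simp [h]
    · simp at hj; simp [hj]

/-- Homogeneous components of a cocycle are cocycles. -/
theorem exists_finset_sum_of_map_eq_zero {E F I J : Type} [AddCommGroup E] [Module ℚ E]
    [AddCommGroup F] [Module ℚ F]
    {G : I → Submodule ℚ E} {H : J → Submodule ℚ F} (hH : iSupIndep H) (htop : ⨆ i, G i = ⊤)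
    (f : E →ₗ[ℚ] F) (σ : I → J) (hσ : Function.Injective σ) (hf : ∀ i, ∀ a ∈ G i, f a ∈ H (σ i))
    (a : E) (ha : f a = 0) :
    ∃ (s : Finset I) (v : I → E), (∀ i, v i ∈ G i) ∧ (∀ i ∈ s, f (v i) = 0) ∧
      a = ∑ i ∈ s, v i := by
  classical
  obtain ⟨s, v, h1, h2⟩ := exists_finset_sum G a (htop ▸ trivial)
  refine ⟨s, v, h1, fun i hi => ?_, h2⟩
  have hi' := (iSupIndep_iff_finsetSum_eq_zero_imp_eq_zero _).mp (hH.comp hσ) s (fun i => f (v i))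
    (fun i _ => hf i _ (h1 i)) (by rw [← map_sum, ← h2, ha]) i hi
  exact hi'

namespace KA

open MvPolynomial (X pderiv)

variable {β o : Type}

/-- The projection to the polynomial part. -/
def eps : KA β o →ₐ[ℚ] MvPolynomial β ℚ :=
  lift (B := MvPolynomial β ℚ) X (fun _ => (0 : MvPolynomial β ℚ)) (fun _ _ => Commute.all _ _)
    (fun _ _ => (congrArg₂ (· + ·) (mul_zero (0 : MvPolynomial β ℚ))
      (mul_zero (0 : MvPolynomial β ℚ))).trans (add_zero _))

theorem eps_y (j : o) : eps (y j : KA β o) = 0 := by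
  rw [eps, lift_y]

theorem eps_pol (r : MvPolynomial β ℚ) : eps (pol r : KA β o) = r := by
  have : (eps : KA β o →ₐ[ℚ] _).comp pol = AlgHom.id ℚ _ :=
    MvPolynomial.algHom_ext fun i => by
      rw [AlgHom.comp_apply, AlgHom.id_apply, ← x, eps, lift_x]
  exact DFunLike.congr_fun this r

theorem pol_injective : Function.Injective (pol : MvPolynomial β ℚ → KA β o) :=
  Function.LeftInverse.injective eps_pol

section
variable [Fintype o]

theorem eps_C_mem (φ : o → MvPolynomial β ℚ) (a : KA β o) :
    eps (C φ a) ∈ Ideal.span (Set.range φ) := by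
  rw [C_apply, map_sum]
  refine Submodule.sum_mem _ fun j _ => ?_
  rw [map_mul, eps_pol, mul_comm]
  exact Ideal.mul_mem_left _ _ (Ideal.subset_span ⟨j, rfl⟩)

theorem eq_pol_eps_of_mem {a : KA β o} (ha : a ∈ G 0 1 0) : a = pol (eps a) := by
  obtain ⟨r, hr⟩ : a ∈ (pol : MvPolynomial β ℚ →ₐ[ℚ] KA β o).range :=
    G_zero_le (w := 0) (v := 1) (fun _ => le_rfl) (fun _ => zero_le_one)
      (pol : MvPolynomial β ℚ →ₐ[ℚ] KA β o).range (fun b _ => ⟨X b, rfl⟩)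
      (fun j h => absurd h one_ne_zero) ha
  rw [← hr]
  exact congrArg pol (eps_pol r).symm

theorem pow_mem_G {w : β → ℚ} {v : o → ℚ} {g : ℚ} {a : KA β o} (ha : a ∈ G w v g) (n : ℕ) :
    a ^ n ∈ G w v (n * g) := by
  induction n with
  | zero => simpa using one_mem_G w v
  | succ n ih =>
    rw [pow_succ, Nat.cast_succ, add_mul, one_mul]
    exact mul_mem_G _ _ _ _ ih ha

theorem prod_pol_mem_G {w : β → ℚ} {v : o → ℚ} {ι : Type} (s : Finset ι)
    (f : ι → MvPolynomial β ℚ) (g : ι → ℚ) (h : ∀ i ∈ s, (pol (f i) : KA β o) ∈ G w v (g i)) :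
    (pol (∏ i ∈ s, f i) : KA β o) ∈ G w v (∑ i ∈ s, g i) := by
  classical
  induction s using Finset.induction_on with
  | empty => simpa using one_mem_G w v
  | insert i s hi ih =>
    rw [Finset.prod_insert hi, Finset.sum_insert hi, map_mul]
    exact mul_mem_G _ _ _ _ (h _ (Finset.mem_insert_self _ _))
      (ih fun j hj => h j (Finset.mem_insert_of_mem hj))

theorem pol_mem_G_of_isWeightedHomogeneous {w : β → ℕ} {v : o → ℚ} {r : MvPolynomial β ℚ} {n : ℕ}
    (hr : MvPolynomial.IsWeightedHomogeneous w r n) :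
    (pol r : KA β o) ∈ G (fun b => (w b : ℚ)) v n := by
  rw [r.as_sum, map_sum]
  refine Submodule.sum_mem _ fun d hd => ?_
  have hd := hr (MvPolynomial.mem_support_iff.mp hd)
  rw [MvPolynomial.monomial_eq, ← MvPolynomial.smul_eq_C_mul, map_smul]
  refine Submodule.smul_mem _ _ ?_
  have := prod_pol_mem_G (w := fun b => (w b : ℚ)) (v := v) d.support (fun i => X i ^ d i)
    (fun i => d i * w i) fun i _ => by
      rw [map_pow]; exact pow_mem_G (x_mem_G _ _ i) _
  convert this using 2
  · rw [← hd, Finsupp.weight_apply, Finsupp.sum]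
    push_cast
    simp
  · rfl

theorem pol_mem_G_of_isHomogeneous {v : o → ℚ} {r : MvPolynomial β ℚ} {n : ℕ}
    (hr : r.IsHomogeneous n) : (pol r : KA β o) ∈ G 1 v n := by
  have := pol_mem_G_of_isWeightedHomogeneous (v := v) hr
  have h1 : (fun b : β => ((1 : β → ℕ) b : ℚ)) = 1 := by ext; simp
  rwa [h1] at this

end

section Quadric
variable {β κ : Type} [Fintype β] [Fintype κ]

theorem sum_half_pderiv {p : MvPolynomial β ℚ} (hp : p.IsHomogeneous 2) :
    ∑ b, ((1 / 2 : ℚ) • pderiv b p) * X b = p := by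
  rw [Finset.sum_congr rfl fun b _ => show ((1 / 2 : ℚ) • pderiv b p) * X b =
    (1 / 2 : ℚ) • (X b * pderiv b p) by rw [smul_mul_assoc, mul_comm], ← Finset.smul_sum]
  rw [hp.sum_X_mul_pderiv, ← Nat.cast_smul_eq_nsmul ℚ, smul_smul]
  norm_num

theorem isHomogeneous_half_pderiv {p : MvPolynomial β ℚ} (hp : p.IsHomogeneous 2) (b : β) :
    ((1 / 2 : ℚ) • pderiv b p).IsHomogeneous 1 := by
  have : (pderiv b p).IsHomogeneous (2 - 1) := hp.pderiv
  rw [MvPolynomial.smul_eq_C_mul]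
  simpa using (MvPolynomial.isHomogeneous_C β (1 / 2 : ℚ)).mul this

attribute [local instance] MvPolynomial.gradedAlgebra in
theorem exists_homogeneous_combination {p : κ → MvPolynomial β ℚ}
    (hp : ∀ j, (p j).IsHomogeneous 2) (r : κ → MvPolynomial β ℚ) {f : MvPolynomial β ℚ} {L : ℕ}
    (hf : f.IsHomogeneous (L + 2)) (h : ∑ j, r j * p j = f) :
    ∃ r' : κ → MvPolynomial β ℚ, (∀ j, (r' j).IsHomogeneous L) ∧ ∑ j, r' j * p j = f := by
  classical
  refine ⟨fun j => DirectSum.decompose (MvPolynomial.homogeneousSubmodule β ℚ) (r j) L,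
    fun j => (DirectSum.decompose (MvPolynomial.homogeneousSubmodule β ℚ) (r j) L).2, ?_⟩
  have h1 : ∀ j, ((DirectSum.decompose (MvPolynomial.homogeneousSubmodule β ℚ) (r j) L :
      MvPolynomial β ℚ)) * p j =
      DirectSum.decompose (MvPolynomial.homogeneousSubmodule β ℚ) (r j * p j) (L + 2) := by
    intro j
    rw [DirectSum.coe_decompose_mul_of_right_mem_of_le (i := 2) _ (hp j) (by omega)]
    rw [Nat.add_sub_cancel]
  simp only [h1]
  rw [← DirectSum.decompose_of_mem_same (MvPolynomial.homogeneousSubmodule β ℚ)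
    (show f ∈ MvPolynomial.homogeneousSubmodule β ℚ (L + 2) from hf), ← h,
    DirectSum.decompose_sum]
  simp

/-- Polynomials of degree exceeding the number of quadrics lie in the ideal, provided the
quadrics have no common zero but the origin. -/
theorem mem_span_of_card_lt {p : κ → MvPolynomial β ℚ} (hp : ∀ j, (p j).IsHomogeneous 2)
    (hX : ∀ b, (X b : MvPolynomial β ℚ) ∈ (Ideal.span (Set.range p)).radical)
    {n : ℕ} (hn : Fintype.card κ < n) {f : MvPolynomial β ℚ} (hf : f.IsHomogeneous n) :
    f ∈ Ideal.span (Set.range p) := by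
  classical
  obtain ⟨L, r, hr⟩ := exists_pow_of_mem_radical hX
  have hr' : ∀ b, ∃ r' : κ → MvPolynomial β ℚ, (∀ j, (r' j).IsHomogeneous (L b)) ∧
      ∑ j, r' j * p j = X b ^ (L b + 2) := by
    intro b
    refine exists_homogeneous_combination hp (fun j => X b ^ 2 * r b j) ?_ ?_
    · simpa using (MvPolynomial.isHomogeneous_X ℚ b).pow (L b + 2)
    · simp only [mul_assoc, ← Finset.mul_sum, hr]
      ring
  choose r' h1 h2 using hr'
  have h01 : (fun _ : β => (0 : ℚ) + 1) = 1 := by ext; simp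
  obtain ⟨e, -, he⟩ := vanishing (a := fun j b => (1 / 2 : ℚ) • pderiv b (p j))
    (fun j => sum_half_pderiv (hp j)) (fun b => L b + 2) r' h2 0 1 (by norm_num)
    (fun j b => by
      rw [h01]
      simpa using pol_mem_G_of_isHomogeneous (isHomogeneous_half_pderiv (hp j) b))
    (fun b j => by
      rw [h01]
      have := pol_mem_G_of_isHomogeneous (v := (1 : κ → ℚ)) (h1 b j)
      convert this using 1
      congr 1; push_cast; simp; ring) n (by simpa using hn) (pol f)
    (by rw [h01]; exact pol_mem_G_of_isHomogeneous hf) (C_pol _ _)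
  rw [← eps_pol (o := κ) f, ← he]
  exact eps_C_mem _ _

/-- Acyclicity of the augmentation ideal of the Koszul complex over the quotient. -/
theorem exact_of_eps {p : κ → MvPolynomial β ℚ} (hp : ∀ j, (p j).IsHomogeneous 2)
    (hX : ∀ b, (X b : MvPolynomial β ℚ) ∈ (Ideal.span (Set.range p)).radical)
    (hc : Fintype.card κ ≤ Fintype.card β) (e : KA β κ) (hDe : C p e = 0)
    (he : eps e ∈ Ideal.span (Set.range p)) : ∃ e', C p e' = e := by
  classical
  suffices h : ∀ e : KA β κ, C p e = 0 → eps e = 0 → ∃ e', C p e' = e by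
    obtain ⟨r, hr⟩ := Ideal.mem_span_range_iff_exists_fun.mp he
    obtain ⟨e', he'⟩ := h (e - C p (lin r)) (by rw [map_sub, C_sq, hDe, sub_zero])
      (by rw [map_sub, C_lin, eps_pol, hr, sub_self])
    exact ⟨e' + lin r, by rw [map_add, he', sub_add_cancel]⟩
  clear hDe he e
  intro e hDe he
  have hpG : ∀ j, (pol (p j) : KA β κ) ∈ G 0 1 ((1 : κ → ℚ) j - 1) := fun j => by
    simpa using pol_mem_G_zero (1 : κ → ℚ) (p j)
  obtain ⟨s, u, h1, h2, h3⟩ := exists_finset_sum_of_map_eq_zero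
    (isGenGraded (0 : β → ℚ) (1 : κ → ℚ)).indep (isGenGraded 0 1).iSup_eq_top (C p)
    (fun g => g - 1) sub_left_injective (fun _ _ ha => C_mem_G p 1 hpG ha) e hDe
  have hneg : ∀ g, g < 0 → ∀ a ∈ G (0 : β → ℚ) (1 : κ → ℚ) g, a = 0 := by
    intro g hg a ha
    have := (isGenGraded (0 : β → ℚ) (1 : κ → ℚ)).le_of_gen
      (G' := fun g => if g < 0 then ⊥ else G 0 1 g)
      (fun i => by split_ifs; exacts [bot_le, le_rfl]) (by simpa using one_mem_G _ _)
      (by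
        intro i j a b ha hb
        split_ifs at ha with h
        · rw [(Submodule.mem_bot ℚ).mp ha, zero_mul]; exact zero_mem _
        · split_ifs at hb with h'
          · rw [(Submodule.mem_bot ℚ).mp hb, mul_zero]; exact zero_mem _
          · rw [if_neg (by rw [not_lt] at *; linarith)]
            exact mul_mem_G _ _ _ _ ha hb)
      (by
        rintro _ (⟨b, rfl⟩ | ⟨k, rfl⟩)
        · exact ⟨0, by simpa using x_mem_G (0 : β → ℚ) (1 : κ → ℚ) b⟩
        · refine ⟨1, ?_⟩
          rw [if_neg (by norm_num)]
          exact y_mem_G (0 : β → ℚ) (1 : κ → ℚ) k) g ha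
    simpa [hg] using this
  have heps : ∀ g, g ≠ 0 → ∀ a ∈ G (0 : β → ℚ) (1 : κ → ℚ) g, eps a = 0 := by
    intro g hg a ha
    have := (isGenGraded (0 : β → ℚ) (1 : κ → ℚ)).map_mem
      (H := fun g => if g = 0 then (⊤ : Submodule ℚ (MvPolynomial β ℚ)) else ⊥) (by simp)
      (by
        intro i j a b ha hb
        split_ifs at ha with h1
        · split_ifs at hb with h2
          · subst h1 h2; simp
          · rw [(Submodule.mem_bot ℚ).mp hb, mul_zero]; exact zero_mem _
        · rw [(Submodule.mem_bot ℚ).mp ha, zero_mul]; exact zero_mem _) eps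
      (by
        rintro _ (⟨b, rfl⟩ | ⟨k, rfl⟩)
        · exact ⟨_, x_mem_G _ _ _, by simp⟩
        · exact ⟨_, y_mem_G _ _ _, by simp [eps_y]⟩) g a ha
    simpa [hg] using this
  have h0 : ∀ i ∈ s, ∃ e', C p e' = u i := by
    intro i hi
    rcases lt_trichotomy i 0 with h | h | h
    · exact ⟨0, by rw [map_zero, hneg i h _ (h1 i)]⟩
    · subst h
      refine ⟨0, ?_⟩
      have h4 : eps e = eps (u 0) := by
        rw [h3, map_sum]
        exact Finset.sum_eq_single_of_mem 0 hi fun j _ hj => heps j hj _ (h1 j)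
      rw [map_zero, eq_pol_eps_of_mem (h1 0), ← h4, he, map_zero]
    · obtain ⟨e', -, h'⟩ := exact_of_lt (a := fun j b => (1 / 2 : ℚ) • pderiv b (p j))
        (fun j => sum_half_pderiv (hp j)) hX i (by
          have : (Fintype.card κ : ℚ) ≤ Fintype.card β := by exact_mod_cast hc
          linarith) (u i) (h1 i) (h2 i hi)
      exact ⟨e', h'⟩
  choose! e' he' using h0
  exact ⟨∑ i ∈ s, e' i, by rw [map_sum, h3]; exact Finset.sum_congr rfl he'⟩

end Quadric
end KA

end

section

/-- A graded algebra structure from an independent spanning multiplicative family. -/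
abbrev gradedAlgebraOfInternal {E : Type} [Ring E] [Algebra ℚ E] {G : ℕ → Submodule ℚ E}
    (one_mem : (1 : E) ∈ G 0) (mul_mem : ∀ i j a b, a ∈ G i → b ∈ G j → a * b ∈ G (i + j))
    (indep : iSupIndep G) (top : ⨆ i, G i = ⊤) : GradedAlgebra G :=
  { (DirectSum.isInternal_submodule_of_iSupIndep_of_iSup_eq_top indep top).chooseDecomposition with
    one_mem := one_mem
    mul_mem := fun i j _ _ ha hb => mul_mem i j _ _ ha hb }

section GCDGA
variable {B : Type} [GCDGA B]

theorem iSup_Gr (B : Type) [GCDGA B] : ⨆ i, Gr B i = ⊤ :=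
  letI : GradedAlgebra (Gr B) := GCDGA.gradedAlgebra (A := B)
  (DirectSum.Decomposition.isInternal (Gr B)).submodule_iSup_eq_top

theorem iSupIndep_Gr (B : Type) [GCDGA B] : iSupIndep (Gr B) :=
  letI : GradedAlgebra (Gr B) := GCDGA.gradedAlgebra (A := B)
  (DirectSum.Decomposition.isInternal (Gr B)).submodule_iSupIndep

theorem one_mem_Gr (B : Type) [GCDGA B] : (1 : B) ∈ Gr B 0 :=
  letI : GradedAlgebra (Gr B) := GCDGA.gradedAlgebra (A := B)
  SetLike.GradedOne.one_mem (A := Gr B)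

theorem mul_mem_Gr {i j : ℕ} {a b : B} (ha : a ∈ Gr B i) (hb : b ∈ Gr B j) : a * b ∈ Gr B (i + j) :=
  letI : GradedAlgebra (Gr B) := GCDGA.gradedAlgebra (A := B)
  SetLike.GradedMul.mul_mem (A := Gr B) ha hb

theorem Dd_one (B : Type) [GCDGA B] : Dd B 1 = 0 := by
  have := GCDGA.d_leibniz 0 (1 : B) 1 (one_mem_Gr B)
  simpa [Dd] using this

theorem Dd_sq (b : B) : Dd B (Dd B b) = 0 := GCDGA.d_sq b

theorem Dd_mem_Gr {i : ℕ} {b : B} (hb : b ∈ Gr B i) : Dd B b ∈ Gr B (i + 1) :=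
  GCDGA.d_grading i b hb

theorem Dd_mul {i : ℕ} {a : B} (ha : a ∈ Gr B i) (b : B) :
    Dd B (a * b) = Dd B a * b + (-1 : ℚ) ^ i • (a * Dd B b) := GCDGA.d_leibniz i a b ha

theorem induction_Gr {P : B → Prop} (b : B) (h0 : P 0) (hadd : ∀ a b, P a → P b → P (a + b))
    (h : ∀ i, ∀ a ∈ Gr B i, P a) : P b :=
  Submodule.iSup_induction (motive := P) (Gr B) (iSup_Gr B ▸ Submodule.mem_top : b ∈ ⨆ i, Gr B i) (fun i a ha => h i a ha) h0 hadd

theorem commute_of_even {i : ℕ} {a : B} (ha : a ∈ Gr B (2 * i)) (b : B) : Commute a b := by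
  refine induction_Gr b (Commute.zero_right a) (fun _ _ => Commute.add_right) fun j b hb => ?_
  have := GCDGA.grading_comm _ _ a b ha hb
  rwa [mul_assoc, pow_mul, neg_one_sq, one_pow, one_smul] at this

theorem anticomm_of_odd {i j : ℕ} {a b : B} (ha : a ∈ Gr B (2 * i + 1)) (hb : b ∈ Gr B (2 * j + 1)) :
    a * b + b * a = 0 := by
  have h := GCDGA.grading_comm _ _ a b ha hb
  rw [Odd.neg_one_pow (by rw [Nat.odd_mul]; exact ⟨odd_two_mul_add_one i, odd_two_mul_add_one j⟩),
    neg_one_smul] at h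
  rw [h, neg_add_cancel]

end GCDGA

namespace KA

theorem isGenGraded_nat {β o : Type} [Fintype o] (w : β → ℕ) (v : o → ℕ) :
    IsGenGraded (fun n : ℕ => (G (fun b => (w b : ℚ)) (fun j => (v j : ℚ)) n : Submodule ℚ (KA β o)))
      (Set.range (x : β → KA β o) ∪ Set.range (y : o → KA β o)) where
  indep := (isGenGraded _ _).indep.comp Nat.cast_injective
  one_mem := by simpa using one_mem_G (fun b => (w b : ℚ)) (fun j => (v j : ℚ))
  mul_mem := fun i j a b ha hb => by
    rw [Nat.cast_add]
    exact mul_mem_G _ _ _ _ ha hb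
  gen := by
    rintro _ (⟨b, rfl⟩ | ⟨j, rfl⟩)
    · exact ⟨w b, x_mem_G _ _ b⟩
    · exact ⟨v j, y_mem_G _ _ j⟩
  adjoin := (isGenGraded (fun b => (w b : ℚ)) (fun j => (v j : ℚ))).adjoin

end KA

/-- Degrees and differential of a pure free model. -/
structure Dat (β o : Type) [Fintype o] where
  dx : β → ℕ
  dy : o → ℕ
  q : o → MvPolynomial β ℚ
  hq : ∀ j, (KA.pol (q j) : KA β o) ∈
    KA.G (fun b => ((2 * dx b : ℕ) : ℚ)) (fun k => ((2 * dy k + 1 : ℕ) : ℚ)) ((2 * dy j + 2 : ℕ) : ℚ)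

namespace Dat

variable {β o : Type} [Fintype o] (D : Dat β o)

/-- The degree grading. -/
def gr (n : ℕ) : Submodule ℚ (KA β o) :=
  KA.G (fun b => ((2 * D.dx b : ℕ) : ℚ)) (fun k => ((2 * D.dy k + 1 : ℕ) : ℚ)) n

theorem isGenGraded : IsGenGraded D.gr (Set.range (KA.x : β → KA β o) ∪ Set.range KA.y) :=
  KA.isGenGraded_nat _ _

theorem x_mem (b : β) : KA.x b ∈ D.gr (2 * D.dx b) := KA.x_mem_G _ _ b

theorem y_mem (j : o) : KA.y j ∈ D.gr (2 * D.dy j + 1) := KA.y_mem_G _ _ j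

theorem q_mem (j : o) : KA.pol (D.q j) ∈ D.gr (2 * D.dy j + 2) := D.hq j

theorem C_mem (n : ℕ) (a : KA β o) (ha : a ∈ D.gr n) : KA.C D.q a ∈ D.gr (n + 1) := by
  have := KA.C_mem_G D.q (-1) (fun j => by
    have := D.hq j
    convert this using 1
    congr 1
    push_cast; ring) ha
  unfold gr
  convert this using 1
  congr 1
  push_cast; ring

theorem leibniz (i : ℕ) (a : KA β o) (ha : a ∈ D.gr i) (b : KA β o) :
    KA.C D.q (a * b) = KA.C D.q a * b + (-1 : ℚ) ^ i • (a * KA.C D.q b) := by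
  let P : ℕ → Submodule ℚ (KA β o) := fun i =>
    ⨅ b, LinearMap.ker ((KA.C D.q ∘ₗ LinearMap.mulRight ℚ b) - (LinearMap.mulRight ℚ b ∘ₗ KA.C D.q)
      - (-1 : ℚ) ^ i • LinearMap.mulRight ℚ (KA.C D.q b))
  have hP : ∀ i a, a ∈ P i ↔ ∀ b,
      KA.C D.q (a * b) = KA.C D.q a * b + (-1 : ℚ) ^ i • (a * KA.C D.q b) := by
    intro i a
    simp only [P, Submodule.mem_iInf, LinearMap.mem_ker, LinearMap.sub_apply, LinearMap.comp_apply,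
      LinearMap.mulRight_apply, LinearMap.smul_apply, sub_sub, LinearMap.add_apply, sub_eq_zero]
  refine (hP i a).mp (D.isGenGraded.induction P ?_ ?_ ?_ i a ha) b
  · rw [hP]
    intro b
    simp [KA.C_one]
  · intro i j a b _ _ ha hb
    rw [hP] at *
    intro c
    rw [mul_assoc, ha, hb, ha b, add_mul, pow_add, mul_add, smul_add, mul_smul_comm,
      smul_mul_assoc, smul_smul, mul_assoc, mul_assoc, mul_assoc, add_assoc]
  · rintro _ (⟨b, rfl⟩ | ⟨j, rfl⟩)
    · refine ⟨_, D.x_mem b, (hP _ _).mpr fun c => ?_⟩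
      rw [KA.x, KA.C_pol_mul, KA.C_pol, zero_mul, zero_add, pow_mul, neg_one_sq, one_pow, one_smul]
    · refine ⟨_, D.y_mem j, (hP _ _).mpr fun c => ?_⟩
      rw [KA.C_y_mul, KA.C_y, pow_succ, pow_mul, neg_one_sq, one_pow, one_mul, neg_one_smul,
        sub_eq_add_neg]

theorem y_comm (j : o) (i : ℕ) (a : KA β o) (ha : a ∈ D.gr i) :
    KA.y j * a = (-1 : ℚ) ^ i • (a * KA.y j) := by
  let P : ℕ → Submodule ℚ (KA β o) := fun i =>
    LinearMap.ker (LinearMap.mulLeft ℚ (KA.y j) - (-1 : ℚ) ^ i • LinearMap.mulRight ℚ (KA.y j))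
  have hP : ∀ i a, a ∈ P i ↔ KA.y j * a = (-1 : ℚ) ^ i • (a * KA.y j) := by
    intro i a
    simp only [P, LinearMap.mem_ker, LinearMap.sub_apply, LinearMap.mulLeft_apply,
      LinearMap.mulRight_apply, LinearMap.smul_apply, sub_eq_zero]
  refine (hP i a).mp (D.isGenGraded.induction P ?_ ?_ ?_ i a ha)
  · rw [hP]; simp
  · intro i j a b _ _ ha hb
    rw [hP] at *
    rw [← mul_assoc, ha, smul_mul_assoc, mul_assoc, hb, mul_smul_comm, smul_smul, pow_add,
      mul_assoc]
  · rintro _ (⟨b, rfl⟩ | ⟨k, rfl⟩)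
    · refine ⟨_, D.x_mem b, (hP _ _).mpr ?_⟩
      rw [KA.x, KA.pol_comm, pow_mul, neg_one_sq, one_pow, one_smul]
    · refine ⟨_, D.y_mem k, (hP _ _).mpr ?_⟩
      rw [KA.y_mul_y, pow_succ, pow_mul, neg_one_sq, one_pow, one_mul, neg_one_smul]

theorem comm (i j : ℕ) (a b : KA β o) (ha : a ∈ D.gr i) (hb : b ∈ D.gr j) :
    a * b = (-1 : ℚ) ^ (i * j) • (b * a) := by
  let P : ℕ → Submodule ℚ (KA β o) := fun i =>
    LinearMap.ker (LinearMap.mulRight ℚ b - (-1 : ℚ) ^ (i * j) • LinearMap.mulLeft ℚ b)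
  have hP : ∀ i a, a ∈ P i ↔ a * b = (-1 : ℚ) ^ (i * j) • (b * a) := by
    intro i a
    simp only [P, LinearMap.mem_ker, LinearMap.sub_apply, LinearMap.mulLeft_apply,
      LinearMap.mulRight_apply, LinearMap.smul_apply, sub_eq_zero]
  refine (hP i a).mp (D.isGenGraded.induction P ?_ ?_ ?_ i a ha)
  · rw [hP]; simp
  · intro i k a c _ _ ha hc
    rw [hP] at *
    rw [mul_assoc, hc, mul_smul_comm, ← mul_assoc, ha, smul_mul_assoc, smul_smul, add_mul, pow_add,
      mul_assoc, mul_comm ((-1 : ℚ) ^ (k * j))]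
  · rintro _ (⟨c, rfl⟩ | ⟨k, rfl⟩)
    · refine ⟨_, D.x_mem c, (hP _ _).mpr ?_⟩
      rw [KA.x, KA.pol_comm, mul_assoc, pow_mul, neg_one_sq, one_pow, one_smul]
    · refine ⟨_, D.y_mem k, (hP _ _).mpr ?_⟩
      rw [D.y_comm k j b hb, add_mul, one_mul, pow_add, mul_assoc, pow_mul, neg_one_sq, one_pow,
        one_mul]

/-- The pure model attached to `D`. -/
def Model (_D : Dat β o) : Type := KA β o

instance : Ring D.Model := inferInstanceAs (Ring (KA β o))

instance : Algebra ℚ D.Model := inferInstanceAs (Algebra ℚ (KA β o))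

instance : GCDGA D.Model where
  grading := D.gr
  gradedAlgebra := gradedAlgebraOfInternal D.isGenGraded.one_mem D.isGenGraded.mul_mem
    D.isGenGraded.indep D.isGenGraded.iSup_eq_top
  grading_comm := D.comm
  d := KA.C D.q
  d_sq := KA.C_sq D.q
  d_grading := D.C_mem
  d_leibniz := fun i a b ha => D.leibniz i a ha b

/-- The underlying algebra of the model. -/
def toModel : KA β o ≃ₐ[ℚ] D.Model := AlgEquiv.refl (R := ℚ) (A₁ := KA β o)

theorem Dd_toModel (a : KA β o) : Dd D.Model (D.toModel a) = D.toModel (KA.C D.q a) := rfl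

/-- Morphisms out of a model are determined on generators. -/
theorem isDGAHom_of_gen {B : Type} [GCDGA B] (f : KA β o →ₐ[ℚ] B)
    (hx : ∀ b, f (KA.x b) ∈ Gr B (2 * D.dx b)) (hy : ∀ j, f (KA.y j) ∈ Gr B (2 * D.dy j + 1))
    (hdx : ∀ b, Dd B (f (KA.x b)) = 0) (hdy : ∀ j, Dd B (f (KA.y j)) = f (KA.pol (D.q j))) :
    IsDGAHom (f.comp D.toModel.symm.toAlgHom) := by
  have hgr : ∀ i, ∀ a ∈ D.gr i, f a ∈ Gr B i := by
    refine D.isGenGraded.map_mem (one_mem_Gr B) (fun i j a b => mul_mem_Gr) f ?_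
    rintro _ (⟨b, rfl⟩ | ⟨j, rfl⟩)
    · exact ⟨_, D.x_mem b, hx b⟩
    · exact ⟨_, D.y_mem j, hy j⟩
  suffices h : ∀ a : KA β o, f (KA.C D.q a) = Dd B (f a) from ⟨h, hgr⟩
  intro a
  refine Submodule.iSup_induction (motive := fun a => f (KA.C D.q a) = Dd B (f a)) D.gr
    (D.isGenGraded.iSup_eq_top ▸ Submodule.mem_top : a ∈ ⨆ i, D.gr i) ?_ (by simp) ?_
  · let P : ℕ → Submodule ℚ (KA β o) := fun i =>
      LinearMap.ker (f.toLinearMap ∘ₗ KA.C D.q - Dd B ∘ₗ f.toLinearMap)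
    have hP : ∀ i a, a ∈ P i ↔ f (KA.C D.q a) = Dd B (f a) := by
      intro i a
      simp only [P, LinearMap.mem_ker, LinearMap.sub_apply, LinearMap.comp_apply, sub_eq_zero]
      rfl
    intro i a ha
    refine (hP i a).mp (D.isGenGraded.induction P ?_ ?_ ?_ i a ha)
    · rw [hP 0, KA.C_one, map_one, map_zero, Dd_one]
    · intro i j a b hi _ ha hb
      rw [hP 0] at ha hb ⊢
      rw [D.leibniz i a hi, map_add, map_smul, map_mul, map_mul, map_mul, ha, hb,
        Dd_mul (hgr i a hi)]
    · rintro _ (⟨b, rfl⟩ | ⟨j, rfl⟩)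
      · exact ⟨_, D.x_mem b, (hP 0 _).mpr (by rw [hdx, KA.x, KA.C_pol, map_zero])⟩
      · exact ⟨_, D.y_mem j, (hP 0 _).mpr (by rw [hdy, KA.C_y])⟩
  · intro a b ha hb
    rw [map_add, map_add, map_add, map_add, ha, hb]

/-- The morphism out of the free algebra with prescribed values in a gcdga. -/
def liftHom {B : Type} [GCDGA B] (f : β → B) (g : o → B) (hf : ∀ b, f b ∈ Gr B (2 * D.dx b))
    (hg : ∀ j, g j ∈ Gr B (2 * D.dy j + 1)) : KA β o →ₐ[ℚ] B :=
  KA.lift f g (fun b => commute_of_even (hf b)) fun j k => anticomm_of_odd (hg j) (hg k)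

theorem liftHom_x {B : Type} [GCDGA B] {f : β → B} {g : o → B} (hf : ∀ b, f b ∈ Gr B (2 * D.dx b))
    (hg : ∀ j, g j ∈ Gr B (2 * D.dy j + 1)) (b : β) : D.liftHom f g hf hg (KA.x b) = f b :=
  KA.lift_x ..

theorem liftHom_y {B : Type} [GCDGA B] {f : β → B} {g : o → B} (hf : ∀ b, f b ∈ Gr B (2 * D.dx b))
    (hg : ∀ j, g j ∈ Gr B (2 * D.dy j + 1)) (j : o) : D.liftHom f g hf hg (KA.y j) = g j :=
  KA.lift_y ..

end Dat

end

section

/-- A subspace containing the homogeneous components of its elements. -/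
def IsGradedSub {A : Type} [GCDGA A] (I : Submodule ℚ A) : Prop := I ≤ ⨆ i, I ⊓ Gr A i

theorem IsGradedSub.mem_of_sum_mem {A : Type} [GCDGA A] {I : Submodule ℚ A} (hI : IsGradedSub I)
    (s : Finset ℕ) (v : ℕ → A) (hv : ∀ i ∈ s, v i ∈ Gr A i) (h : ∑ i ∈ s, v i ∈ I) :
    ∀ i ∈ s, v i ∈ I := by
  classical
  obtain ⟨t, u, hu, ht⟩ := exists_finset_sum _ _ (hI h)
  intro i hi
  let z : ℕ → A := fun i => (if i ∈ s then v i else 0) - (if i ∈ t then u i else 0)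
  have hz := (iSupIndep_iff_finsetSum_eq_zero_imp_eq_zero _).mp (iSupIndep_Gr A) (s ∪ t) z
    (fun i _ => by
      refine sub_mem ?_ ?_
      · split_ifs with h
        · exact hv i h
        · exact zero_mem _
      · split_ifs with h
        · exact (hu i).2
        · exact zero_mem _) (by
      rw [Finset.sum_sub_distrib, sub_eq_zero, ← Finset.sum_filter, ← Finset.sum_filter,
        Finset.filter_mem_eq_inter, Finset.filter_mem_eq_inter, Finset.union_inter_cancel_left,
        Finset.union_inter_cancel_right, ht]) i (Finset.mem_union_left _ hi)
  simp only [z, hi, if_true, sub_eq_zero] at hz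
  rw [hz]
  split_ifs
  · exact (hu i).1
  · exact zero_mem _

theorem isGradedSub_of_mem {A : Type} [GCDGA A] {I : Submodule ℚ A}
    (h : ∀ (s : Finset ℕ) (v : ℕ → A), (∀ i ∈ s, v i ∈ Gr A i) → ∑ i ∈ s, v i ∈ I →
      ∀ i ∈ s, v i ∈ I) : IsGradedSub I := by
  intro a ha
  obtain ⟨s, v, hv, rfl⟩ := exists_finset_sum (Gr A) a (iSup_Gr A ▸ Submodule.mem_top)
  exact Submodule.sum_mem _ fun i hi =>
    Submodule.mem_iSup_of_mem i ⟨h s v (fun i _ => hv i) ha i hi, hv i⟩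

theorem isGradedSub_one {A : Type} [GCDGA A] : IsGradedSub (1 : Submodule ℚ A) := by
  intro a ha
  refine Submodule.mem_iSup_of_mem 0 ⟨ha, ?_⟩
  obtain ⟨c, rfl⟩ := Submodule.mem_one.mp ha
  rw [Algebra.algebraMap_eq_smul_one]
  exact Submodule.smul_mem _ _ (one_mem_Gr A)

theorem IsGradedSub.mul {A : Type} [GCDGA A] {I J : Submodule ℚ A} (hI : IsGradedSub I)
    (hJ : IsGradedSub J) : IsGradedSub (I * J) := by
  rw [IsGradedSub, Submodule.mul_le]
  intro a ha b hb
  refine Submodule.iSup_induction (motive := fun a => a * b ∈ ⨆ i, I * J ⊓ Gr A i) _ (hI ha) ?_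
    (by simp) fun a a' h h' => by rw [add_mul]; exact add_mem h h'
  intro i a ha
  refine Submodule.iSup_induction (motive := fun b => a * b ∈ ⨆ i, I * J ⊓ Gr A i) _ (hJ hb) ?_
    (by simp) fun b b' h h' => by rw [mul_add]; exact add_mem h h'
  intro j b hb
  exact Submodule.mem_iSup_of_mem (i + j)
    ⟨Submodule.mul_mem_mul ha.1 hb.1, mul_mem_Gr ha.2 hb.2⟩

theorem IsGradedSub.pow {A : Type} [GCDGA A] {I : Submodule ℚ A} (hI : IsGradedSub I) (n : ℕ) :
    IsGradedSub (I ^ n) := by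
  induction n with
  | zero => exact pow_zero I ▸ isGradedSub_one
  | succ n ih => exact pow_succ I n ▸ ih.mul hI

section Quotient
variable {A : Type} [GCDGA A] (I : Ideal A) [I.IsTwoSided]

theorem quotient_mk_eq_zero {a : A} : Ideal.Quotient.mkₐ ℚ I a = 0 ↔ a ∈ I :=
  Ideal.Quotient.eq_zero_iff_mem

/-- The differential of a quotient. -/
def quotD (hd : ∀ a ∈ I, Dd A a ∈ I) : (A ⧸ I) →ₗ[ℚ] A ⧸ I :=
  Submodule.mapQ (I.restrictScalars ℚ) (I.restrictScalars ℚ) (Dd A) hd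

theorem quotD_mk (hd : ∀ a ∈ I, Dd A a ∈ I) (a : A) :
    quotD I hd (Ideal.Quotient.mkₐ ℚ I a) = Ideal.Quotient.mkₐ ℚ I (Dd A a) := rfl

/-- The quotient by a graded differential ideal. -/
abbrev quotGCDGA (hd : ∀ a ∈ I, Dd A a ∈ I) (hg : IsGradedSub (I.restrictScalars ℚ)) :
    GCDGA (A ⧸ I) where
  grading i := (Gr A i).map (Ideal.Quotient.mkₐ ℚ I).toLinearMap
  gradedAlgebra := gradedAlgebraOfInternal
    ⟨1, one_mem_Gr A, map_one (Ideal.Quotient.mkₐ ℚ I)⟩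
    (by
      rintro i j _ _ ⟨a, ha, rfl⟩ ⟨b, hb, rfl⟩
      exact ⟨a * b, mul_mem_Gr ha hb, map_mul (Ideal.Quotient.mkₐ ℚ I) a b⟩)
    (by
      rw [iSupIndep_iff_finsetSum_eq_zero_imp_eq_zero]
      intro s v hv h
      choose! u hu hv using hv
      intro i hi
      rw [← hv i hi]
      rw [Finset.sum_congr rfl fun i hi => (hv i hi).symm, ← map_sum] at h
      exact (quotient_mk_eq_zero I).mpr (hg.mem_of_sum_mem s u hu
        ((quotient_mk_eq_zero I).mp h) i hi))
    (by
      rw [← Submodule.map_iSup, iSup_Gr, Submodule.map_top, LinearMap.range_eq_top]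
      exact Ideal.Quotient.mkₐ_surjective ℚ I)
  grading_comm := by
    rintro i j _ _ ⟨a, ha, rfl⟩ ⟨b, hb, rfl⟩
    have := congrArg (Ideal.Quotient.mkₐ ℚ I) (GCDGA.grading_comm i j a b ha hb)
    rwa [map_smul, map_mul, map_mul] at this
  d := quotD I hd
  d_sq := by
    intro a
    obtain ⟨a, rfl⟩ := Ideal.Quotient.mkₐ_surjective ℚ I a
    rw [quotD_mk, quotD_mk, Dd_sq, map_zero]
  d_grading := by
    rintro i _ ⟨a, ha, rfl⟩
    exact ⟨_, Dd_mem_Gr ha, rfl⟩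
  d_leibniz := by
    rintro i _ b ⟨a, ha, rfl⟩
    obtain ⟨b, rfl⟩ := Ideal.Quotient.mkₐ_surjective ℚ I b
    have h := congrArg (Ideal.Quotient.mkₐ ℚ I) (Dd_mul ha b)
    rw [map_add, map_smul, map_mul (Ideal.Quotient.mkₐ ℚ I) (Dd A a),
      map_mul (Ideal.Quotient.mkₐ ℚ I) a] at h
    exact h

end Quotient

/-- Products of gcdga's. -/
abbrev prodGCDGA (A B : Type) [GCDGA A] [GCDGA B] : GCDGA (A × B) where
  grading i := (Gr A i).prod (Gr B i)
  gradedAlgebra := gradedAlgebraOfInternal ⟨one_mem_Gr A, one_mem_Gr B⟩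
    (fun i j a b ha hb => ⟨mul_mem_Gr ha.1 hb.1, mul_mem_Gr ha.2 hb.2⟩)
    (by
      rw [iSupIndep_iff_finsetSum_eq_zero_imp_eq_zero]
      intro s v hv h i hi
      refine Prod.ext ?_ ?_
      · exact (iSupIndep_iff_finsetSum_eq_zero_imp_eq_zero _).mp (iSupIndep_Gr A) s
          (fun i => (v i).1) (fun i hi => (hv i hi).1) (by rw [← Prod.fst_sum, h]; rfl) i hi
      · exact (iSupIndep_iff_finsetSum_eq_zero_imp_eq_zero _).mp (iSupIndep_Gr B) s
          (fun i => (v i).2) (fun i hi => (hv i hi).2) (by rw [← Prod.snd_sum, h]; rfl) i hi)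
    (by
      rw [eq_top_iff]
      rintro ⟨a, b⟩ -
      rw [← Prod.fst_add_snd (a, b)]
      refine add_mem ?_ ?_
      · refine induction_Gr (P := fun a => ((a, 0) : A × B) ∈ _) a (zero_mem _)
          (fun a b ha hb => by
            have := add_mem ha hb
            rwa [Prod.mk_add_mk, add_zero] at this)
          fun i a ha => Submodule.mem_iSup_of_mem i ⟨ha, zero_mem _⟩
      · refine induction_Gr (P := fun a => ((0, a) : A × B) ∈ _) b (zero_mem _)
          (fun a b ha hb => by
            have := add_mem ha hb
            rwa [Prod.mk_add_mk, add_zero] at this)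
          fun i a ha => Submodule.mem_iSup_of_mem i ⟨zero_mem _, ha⟩)
  grading_comm := fun i j a b ha hb => Prod.ext (GCDGA.grading_comm i j _ _ ha.1 hb.1)
    (GCDGA.grading_comm i j _ _ ha.2 hb.2)
  d := (Dd A).prodMap (Dd B)
  d_sq := fun a => Prod.ext (Dd_sq _) (Dd_sq _)
  d_grading := fun i a ha => ⟨Dd_mem_Gr ha.1, Dd_mem_Gr ha.2⟩
  d_leibniz := fun i a b ha => Prod.ext (Dd_mul ha.1 _) (Dd_mul ha.2 _)

/-- Graded differential subalgebras. -/
abbrev subGCDGA {A : Type} [GCDGA A] (S : Subalgebra ℚ A) (hd : ∀ a ∈ S, Dd A a ∈ S)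
    (hg : IsGradedSub S.toSubmodule) : GCDGA S where
  grading i := (Gr A i).comap S.val.toLinearMap
  gradedAlgebra := gradedAlgebraOfInternal (one_mem_Gr A)
    (fun i j a b ha hb => mul_mem_Gr (B := A) ha hb)
    (by
      rw [iSupIndep_iff_finsetSum_eq_zero_imp_eq_zero]
      intro s v hv h i hi
      refine Subtype.ext ?_
      exact (iSupIndep_iff_finsetSum_eq_zero_imp_eq_zero _).mp (iSupIndep_Gr A) s
          (fun i => (v i : A)) (fun i hi => hv i hi) (by
            have := congrArg S.val h
            rwa [map_sum, map_zero] at this) i hi)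
    (by
      rw [eq_top_iff]
      rintro ⟨a, ha⟩ -
      obtain ⟨s, v, hv, rfl⟩ := exists_finset_sum _ _ (hg ha)
      have : (⟨_, ha⟩ : S) = ∑ i ∈ s, ⟨v i, (hv i).1⟩ := Subtype.ext (by
        exact (map_sum S.val (fun i => (⟨v i, (hv i).1⟩ : S)) s).symm)
      rw [this]
      exact Submodule.sum_mem _ fun i _ => Submodule.mem_iSup_of_mem i (hv i).2)
  grading_comm := fun i j a b ha hb => Subtype.ext (GCDGA.grading_comm i j _ _ ha hb)
  d := (Dd A).restrict (p := S.toSubmodule) (q := S.toSubmodule) hd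
  d_sq := fun a => Subtype.ext (Dd_sq _)
  d_grading := fun i a ha => Dd_mem_Gr (B := A) ha
  d_leibniz := fun i a b ha => Subtype.ext (Dd_mul (B := A) ha _)


section FibreProduct
variable {A : Type} [GCDGA A] (I J : Ideal A) [I.IsTwoSided] [J.IsTwoSided]

/-- The fibre product of `A` and `A ⧸ I` over `A ⧸ J`. -/
def fibre (hIJ : I ≤ J) : Subalgebra ℚ (A × (A ⧸ I)) :=
  AlgHom.equalizer ((Ideal.Quotient.mkₐ ℚ J).comp (AlgHom.fst ℚ A (A ⧸ I)))
    ((Ideal.Quotient.factorₐ ℚ hIJ).comp (AlgHom.snd ℚ A (A ⧸ I)))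

theorem mem_fibre (hIJ : I ≤ J) (a a' : A) :
    (a, Ideal.Quotient.mkₐ ℚ I a') ∈ fibre I J hIJ ↔ a - a' ∈ J :=
  Ideal.Quotient.eq

/-- A graded acyclic differential ideal yields homotopy retractions for the quotients by smaller
ideals. -/
theorem exists_htpyRetraction (hIJ : I ≤ J) (hId : ∀ a ∈ I, Dd A a ∈ I)
    (hIg : IsGradedSub (I.restrictScalars ℚ)) (hJd : ∀ a ∈ J, Dd A a ∈ J)
    (hJg : IsGradedSub (J.restrictScalars ℚ))
    (hJ : ∀ a ∈ J, Dd A a = 0 → ∃ b ∈ J, Dd A b = a) :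
    ∃ (Q : Type) (_ : GCDGA Q) (π : A →ₐ[ℚ] Q), IsDGAHom π ∧ Function.Surjective π ∧
      LinearMap.ker π.toLinearMap = I.restrictScalars ℚ ∧ Nonempty (HtpyRetraction π) := by
  let _ := quotGCDGA I hId hIg
  let _ := prodGCDGA A (A ⧸ I)
  have hmk : ∀ b : A ⧸ I, ∃ a, Ideal.Quotient.mkₐ ℚ I a = b := Ideal.Quotient.mkₐ_surjective ℚ I
  have hdmk : ∀ a, Dd (A ⧸ I) (Ideal.Quotient.mkₐ ℚ I a) = Ideal.Quotient.mkₐ ℚ I (Dd A a) :=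
    fun _ => rfl
  have hd : ∀ c ∈ fibre I J hIJ, Dd (A × (A ⧸ I)) c ∈ fibre I J hIJ := by
    rintro ⟨a, b⟩ h
    obtain ⟨a', rfl⟩ := hmk b
    refine (mem_fibre I J hIJ (Dd A a) (Dd A a')).mpr ?_
    rw [← map_sub]
    exact hJd _ ((mem_fibre I J hIJ a a').mp h)
  have hg : IsGradedSub (fibre I J hIJ).toSubmodule := by
    refine isGradedSub_of_mem fun s v hv h i hi => ?_
    have hv2 : ∀ i ∈ s, ∃ a ∈ Gr A i, Ideal.Quotient.mkₐ ℚ I a = (v i).2 := fun i hi => (hv i hi).2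
    choose! a ha1 ha2 using hv2
    have hva : ∀ i ∈ s, v i = ((v i).1, Ideal.Quotient.mkₐ ℚ I (a i)) := fun i hi => by
      rw [ha2 i hi]
    have hsum : ∑ i ∈ s, v i = (∑ i ∈ s, (v i).1, Ideal.Quotient.mkₐ ℚ I (∑ i ∈ s, a i)) := by
      rw [Finset.sum_congr rfl hva, map_sum]
      exact Prod.ext Prod.fst_sum Prod.snd_sum
    rw [hsum] at h
    have h' := (mem_fibre I J hIJ _ _).mp h
    rw [← Finset.sum_sub_distrib] at h'
    rw [hva i hi]
    exact (mem_fibre I J hIJ _ _).mpr (hJg.mem_of_sum_mem s _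
      (fun i hi => sub_mem (hv i hi).1 (ha1 i hi)) h' i hi)
  let _ := subGCDGA (fibre I J hIJ) hd hg
  refine ⟨A ⧸ I, inferInstance, Ideal.Quotient.mkₐ ℚ I, ⟨fun _ => rfl, fun i a ha => ⟨a, ha, rfl⟩⟩,
    Ideal.Quotient.mkₐ_surjective ℚ I, Submodule.ext fun a => quotient_mk_eq_zero I, ⟨?_⟩⟩
  refine
    { C := fibre I J hIJ
      j := ((AlgHom.id ℚ A).prod (Ideal.Quotient.mkₐ ℚ I)).codRestrict _ fun a =>
        (mem_fibre I J hIJ a a).mpr (by rw [sub_self]; exact zero_mem _)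
      q := (AlgHom.snd ℚ A (A ⧸ I)).comp (fibre I J hIJ).val
      τ := (AlgHom.fst ℚ A (A ⧸ I)).comp (fibre I J hIJ).val
      j_dga := ⟨fun _ => rfl, fun i a ha => ⟨ha, a, ha, rfl⟩⟩
      q_dga := ⟨fun _ => rfl, fun i a ha => ha.2⟩
      τ_dga := ⟨fun _ => rfl, fun i a ha => ha.1⟩
      q_surj := fun b => ?_
      q_quasi := ⟨fun b hb => ?_, fun c hc hcb => ?_⟩
      hqj := rfl
      hτj := rfl }
  · obtain ⟨a, rfl⟩ := hmk b
    exact ⟨⟨(a, Ideal.Quotient.mkₐ ℚ I a), (mem_fibre I J hIJ a a).mpr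
      (by rw [sub_self]; exact zero_mem _)⟩, rfl⟩
  · obtain ⟨a, rfl⟩ := hmk b
    obtain ⟨e, he, hde⟩ := hJ (Dd A a) (hIJ ((quotient_mk_eq_zero I).mp hb)) (Dd_sq a)
    refine ⟨⟨(a - e, Ideal.Quotient.mkₐ ℚ I a), (mem_fibre I J hIJ _ _).mpr ?_⟩, ?_, 0, ?_⟩
    · rw [sub_sub_cancel_left]
      exact neg_mem he
    · refine Subtype.ext (Prod.ext ?_ hb)
      change Dd A (a - e) = 0
      rw [map_sub, hde, sub_self]
    · rw [map_zero]
      exact sub_self _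
  · obtain ⟨⟨a, b⟩, h⟩ := c
    obtain ⟨a', rfl⟩ := hmk b
    obtain ⟨c, hc'⟩ := hcb
    obtain ⟨c, rfl⟩ := hmk c
    have hda : Dd A a = 0 := congrArg (fun z => z.1.1) hc
    have haa := (mem_fibre I J hIJ a a').mp h
    have hac : a' - Dd A c ∈ I := by
      rw [← quotient_mk_eq_zero, map_sub, sub_eq_zero]
      exact hc'
    obtain ⟨e, he, hde⟩ := hJ (a - Dd A c) (by
      have := add_mem haa (hIJ hac)
      rwa [sub_add_sub_cancel] at this) (by rw [map_sub, hda, Dd_sq, sub_zero])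
    refine ⟨⟨(c + e, Ideal.Quotient.mkₐ ℚ I c), (mem_fibre I J hIJ _ _).mpr
      (by rwa [add_sub_cancel_left])⟩, Subtype.ext (Prod.ext ?_ hc')⟩
    change a = Dd A (c + e)
    rw [map_add, hde, add_sub_cancel]

end FibreProduct

/-- A homotopy retraction of algebras is one of modules. -/
def HtpyRetraction.toMod {T Q : Type} [GCDGA T] [GCDGA Q] {ρ : T →ₐ[ℚ] Q} (R : HtpyRetraction ρ) :
    ModHtpyRetraction ρ where
  C := R.C
  j := R.j
  q := R.q
  τ := R.τ.toLinearMap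
  j_dga := R.j_dga
  q_dga := R.q_dga
  q_surj := R.q_surj
  q_quasi := R.q_quasi
  hqj := R.hqj
  τ_chain := R.τ_dga.1
  τ_mod := fun t c => by
    have := DFunLike.congr_fun R.hτj t
    rw [AlgHom.toLinearMap_apply, map_mul]
    exact congrArg (· * R.τ c) this
  hτj := DFunLike.congr_fun R.hτj

/-- Non-exact cocycles are not killed by a map with a homotopy retraction. -/
theorem ModHtpyRetraction.exact_of_map_eq_zero {T Q : Type} [GCDGA T] [GCDGA Q] {ρ : T →ₐ[ℚ] Q}
    (R : ModHtpyRetraction ρ) {ω : T} (hd : Dd T ω = 0) (h : ρ ω = 0) : ∃ c, Dd T c = ω := by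
  obtain ⟨e, he⟩ := R.q_quasi.2 (R.j ω) (by rw [← R.j_dga.1, hd, map_zero])
    ⟨0, by rw [map_zero, ← h]; exact DFunLike.congr_fun R.hqj ω⟩
  exact ⟨R.τ e, by rw [← R.τ_chain, ← he, R.hτj]⟩

end

section

namespace KA
open MvPolynomial
variable {β o : Type} [Fintype o]

theorem exists_mul_y_eq (j : o) (a : KA β o) : ∃ c, a * y j = y j * c := by
  induction a using induction_on with
  | hadd a b ha hb =>
    obtain ⟨c, hc⟩ := ha
    obtain ⟨d, hd⟩ := hb
    exact ⟨c + d, by rw [add_mul, hc, hd, mul_add]⟩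
  | hpol r => exact ⟨pol r, pol_comm _ _⟩
  | hy k a ha =>
    obtain ⟨c, hc⟩ := ha
    exact ⟨-(y k * c), by rw [mul_assoc, hc, ← mul_assoc, y_mul_y, neg_mul, mul_neg, mul_assoc]⟩

/-- The ideal generated by the marked odd generators and their differentials. -/
def markIdeal (q : o → MvPolynomial β ℚ) (mk : o → Prop) : Ideal (KA β o) :=
  Ideal.span {a | ∃ j, mk j ∧ (a = pol (q j) ∨ a = y j)}

section MarkIdeal
variable {q : o → MvPolynomial β ℚ} {mk : o → Prop}

theorem pol_mul_mem_markIdeal {j : o} (hj : mk j) (a : KA β o) :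
    pol (q j) * a ∈ markIdeal q mk := by
  rw [pol_comm]
  exact Ideal.mul_mem_left _ _ (Ideal.subset_span ⟨j, hj, Or.inl rfl⟩)

theorem y_mem_markIdeal {j : o} (hj : mk j) : y j ∈ markIdeal q mk :=
  Ideal.subset_span ⟨j, hj, Or.inr rfl⟩

theorem y_mul_mem_markIdeal {j : o} (hj : mk j) (a : KA β o) : y j * a ∈ markIdeal q mk := by
  induction a using induction_on with
  | hadd a b ha hb => rw [mul_add]; exact add_mem ha hb
  | hpol r => rw [← pol_comm]; exact Ideal.mul_mem_left _ _ (y_mem_markIdeal hj)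
  | hy k a ha =>
    rw [← mul_assoc, y_mul_y, neg_mul, mul_assoc]
    exact neg_mem (Ideal.mul_mem_left _ _ ha)

theorem markIdeal_induction {P : KA β o → Prop} (h0 : P 0) (hadd : ∀ a b, P a → P b → P (a + b))
    (hq : ∀ j, mk j → ∀ a, P (pol (q j) * a)) (hy : ∀ j, mk j → ∀ a, P (y j * a))
    {a : KA β o} (ha : a ∈ markIdeal q mk) : P a := by
  rw [markIdeal] at ha
  refine Submodule.span_induction (p := fun a _ => ∀ b, P (b * a)) ?_ (by simpa using h0)
    (fun a b _ _ ha hb c => by rw [mul_add]; exact hadd _ _ (ha c) (hb c))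
    (fun c a _ ha b => by rw [smul_eq_mul, ← mul_assoc]; exact ha _) ha 1 |> fun h => by
      rwa [one_mul] at h
  rintro a ⟨j, hj, rfl | rfl⟩ b
  · rw [← pol_comm]
    exact hq j hj b
  · obtain ⟨c, hc⟩ := exists_mul_y_eq j b
    rw [hc]
    exact hy j hj c

instance : (markIdeal q mk).IsTwoSided where
  mul_mem_of_left {a} b ha := by
    refine markIdeal_induction (P := fun a => a * b ∈ markIdeal q mk)
      (by rw [zero_mul]; exact zero_mem _)
      (fun a c ha hc => by rw [add_mul]; exact add_mem ha hc) (fun j hj a => ?_) (fun j hj a => ?_) ha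
    · rw [mul_assoc]; exact pol_mul_mem_markIdeal hj _
    · rw [mul_assoc]; exact y_mul_mem_markIdeal hj _

theorem C_mem_markIdeal {a : KA β o} (ha : a ∈ markIdeal q mk) : C q a ∈ markIdeal q mk := by
  refine markIdeal_induction (P := fun a => C q a ∈ markIdeal q mk)
      (by rw [map_zero]; exact zero_mem _)
      (fun a c ha hc => by rw [map_add]; exact add_mem ha hc) (fun j hj a => ?_) (fun j hj a => ?_) ha
  · rw [C_pol_mul]; exact pol_mul_mem_markIdeal hj _
  · rw [C_y_mul]; exact sub_mem (pol_mul_mem_markIdeal hj _) (y_mul_mem_markIdeal hj _)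

theorem contr_mem_markIdeal {k : o} (hk : ¬ mk k) {a : KA β o} (ha : a ∈ markIdeal q mk) :
    contr k a ∈ markIdeal q mk := by
  classical
  refine markIdeal_induction (P := fun a => contr k a ∈ markIdeal q mk)
      (by rw [map_zero]; exact zero_mem _)
      (fun a c ha hc => by rw [map_add]; exact add_mem ha hc) (fun j hj a => ?_) (fun j hj a => ?_) ha
  · rw [contr_pol_mul]; exact pol_mul_mem_markIdeal hj _
  · rw [contr_y_mul, if_neg (by rintro rfl; exact hk hj), zero_sub]
    exact neg_mem (y_mul_mem_markIdeal hj _)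

theorem pol_mem_markIdeal {r : MvPolynomial β ℚ}
    (hr : r ∈ Ideal.span (Set.range fun j : {j // mk j} => q j)) :
    (pol r : KA β o) ∈ markIdeal q mk := by
  have : Ideal.span (Set.range fun j : {j // mk j} => q j) ≤
      (markIdeal q mk).comap (pol : MvPolynomial β ℚ →ₐ[ℚ] KA β o) := by
    rw [Ideal.span_le]
    rintro _ ⟨j, rfl⟩
    exact Ideal.subset_span ⟨j, j.2, Or.inl rfl⟩
  exact this hr

theorem eps_mem_of_mem_markIdeal {a : KA β o} (ha : a ∈ markIdeal q mk) :
    eps a ∈ Ideal.span (Set.range fun j : {j // mk j} => q j) := by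
  refine markIdeal_induction (P := fun a => eps a ∈ _)
      (by rw [map_zero]; exact zero_mem _)
      (fun a c ha hc => by rw [map_add]; exact add_mem ha hc) (fun j hj a => ?_) (fun j hj a => ?_) ha
  · rw [map_mul, eps_pol]
    exact Ideal.mul_mem_right _ _ (Ideal.subset_span ⟨⟨j, hj⟩, rfl⟩)
  · rw [map_mul, eps_y, zero_mul]; exact zero_mem _

variable (β mk) in
/-- The inclusion of the subalgebra on the marked odd generators. -/
def markIncl : KA β {j // mk j} →ₐ[ℚ] KA β o :=
  lift x (fun j => y j.1) (fun _ _ => pol_comm _ _) fun _ _ => y_mul_y_add _ _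

theorem markIncl_x (b : β) : markIncl β mk (x b) = x b := lift_x ..
theorem markIncl_y (j : {j // mk j}) : markIncl β mk (y j) = y j.1 := lift_y ..

theorem markIncl_pol (r : MvPolynomial β ℚ) : markIncl β mk (pol r) = pol r := by
  have : (markIncl β mk).comp pol = pol := MvPolynomial.algHom_ext fun i => markIncl_x i
  exact DFunLike.congr_fun this r

theorem markIncl_injective : Function.Injective (markIncl β mk) := by
  classical
  let R : KA β o →ₐ[ℚ] KA β {j // mk j} :=
    lift x (fun j => if h : mk j then y ⟨j, h⟩ else 0) (fun _ _ => pol_comm _ _) fun j k => by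
      split_ifs <;> simp [y_mul_y_add]
  have h : R.comp (markIncl β mk) = AlgHom.id ℚ _ := by
    refine algHom_ext (fun b => ?_) fun j => ?_
    · exact (congrArg R (markIncl_x b)).trans (lift_x ..)
    · exact (congrArg R (markIncl_y j)).trans ((lift_y ..).trans (dif_pos j.2))
  exact Function.LeftInverse.injective (DFunLike.congr_fun h)

theorem eps_markIncl (a : KA β {j // mk j}) : eps (markIncl β mk a) = eps a := by
  have h : eps.comp (markIncl β mk) = eps := by
    refine algHom_ext (fun b => ?_) fun j => ?_
    · exact (congrArg eps (markIncl_x (mk := mk) b)).trans ((eps_pol _).trans (eps_pol _).symm)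
    · exact (congrArg eps (markIncl_y j)).trans ((eps_y j.1).trans (eps_y j).symm)
  exact DFunLike.congr_fun h a

theorem C_markIncl [Fintype {j // mk j}] (a : KA β {j // mk j}) :
    C q (markIncl β mk a) = markIncl β mk (C (fun j => q j.1) a) := by
  induction a using induction_on with
  | hadd a b ha hb => simp only [map_add, ha, hb]
  | hpol p => rw [C_pol, markIncl_pol, C_pol, map_zero]
  | hy k a ha => rw [map_mul, markIncl_y, C_y_mul, C_y_mul, ha, map_sub, map_mul, map_mul, markIncl_y,
      markIncl_pol]

theorem contr_markIncl {k : o} (hk : ¬ mk k) (a : KA β {j // mk j}) :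
    contr k (markIncl β mk a) = 0 := by
  classical
  induction a using induction_on with
  | hadd a b ha hb => simp only [map_add, ha, hb, add_zero]
  | hpol p => rw [markIncl_pol, contr_pol]
  | hy j a ha =>
    rw [map_mul, markIncl_y, contr_y_mul, ha, if_neg (by rintro rfl; exact hk j.2), mul_zero,
      sub_zero]

theorem markIncl_sub_mem (a : KA β {j // mk j}) :
    markIncl β mk (a - pol (eps a)) ∈ markIdeal q mk := by
  induction a using induction_on with
  | hadd a b ha hb =>
    rw [map_add, map_add, add_sub_add_comm, map_add]
    exact add_mem ha hb
  | hpol p => rw [eps_pol, sub_self, map_zero]; exact zero_mem _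
  | hy j a ha =>
    rw [map_mul, eps_y, zero_mul, map_zero, sub_zero, map_mul, markIncl_y]
    exact y_mul_mem_markIdeal j.2 _

theorem exists_markIncl_eq {a : KA β o} (ha : ∀ j, ¬ mk j → contr j a = 0) :
    ∃ a', markIncl β mk a' = a := by
  classical
  have h0 : a ∈ G (0 : β → ℚ) (fun j => if mk j then 0 else 1) 0 := by
    rw [mem_G, NW_zero_left, zero_smul]
    refine Finset.sum_eq_zero fun j _ => ?_
    by_cases h : mk j
    · simp [h]
    · simp [ha j h]
  have key : a ∈ (markIncl β mk).range := by
    refine G_zero_le (fun _ => le_rfl) (fun j => ?_) (markIncl β mk).range (fun b _ => ⟨x b, markIncl_x b⟩)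
      (fun j hj => ?_) h0
    · split_ifs <;> norm_num
    · by_cases h : mk j
      · exact ⟨y ⟨j, h⟩, markIncl_y _⟩
      · simp [h] at hj
  exact key

/-- The ideal of marked generators is acyclic. -/
theorem exact_of_mem_markIdeal [Fintype β] [Fintype {j // mk j}]
    (hq : ∀ j, mk j → (q j).IsHomogeneous 2)
    (hX : ∀ b, (X b : MvPolynomial β ℚ) ∈
      (Ideal.span (Set.range fun j : {j // mk j} => q j)).radical)
    (hc : Fintype.card {j // mk j} ≤ Fintype.card β) {a : KA β o} (ha : a ∈ markIdeal q mk)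
    (hda : C q a = 0) : ∃ b ∈ markIdeal q mk, C q b = a := by
  classical
  suffices key : ∀ (s : Finset o), (∀ j ∈ s, ¬ mk j) → ∀ a ∈ markIdeal q mk, C q a = 0 →
      (∀ j, ¬ mk j → j ∉ s → contr j a = 0) →
      ∃ b ∈ markIdeal q mk, C q b = a ∧ ∀ j, ¬ mk j → j ∉ s → contr j b = 0 by
    obtain ⟨b, hb, h, -⟩ := key {j | ¬ mk j} (by simp) a ha hda (by
      intro j h1 h2; simp [h1] at h2)
    exact ⟨b, hb, h⟩
  clear hda ha a
  intro s
  induction s using Finset.induction_on with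
  | empty =>
    intro _ a ha hda hca
    obtain ⟨a', rfl⟩ := exists_markIncl_eq (mk := mk) fun j hj => hca j hj (by simp)
    rw [C_markIncl] at hda
    have hda' := markIncl_injective (hda.trans (map_zero _).symm)
    obtain ⟨e, he⟩ := exact_of_eps (p := fun j : {j // mk j} => q j) (fun j => hq j j.2) hX hc a'
      hda' (by rw [← eps_markIncl]; exact eps_mem_of_mem_markIdeal ha)
    refine ⟨markIncl β mk (e - pol (eps e)), markIncl_sub_mem e, ?_, fun j hj _ =>
      contr_markIncl hj _⟩
    rw [C_markIncl, map_sub, C_pol, sub_zero, he]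
  | insert k s hk ih =>
    intro hs a ha hda hca
    have hmk := hs k (Finset.mem_insert_self _ _)
    have ih := ih fun j hj => hs j (Finset.mem_insert_of_mem hj)
    have hcc : ∀ j (a : KA β o), C q (contr j a) = - contr j (C q a) := fun j a => by
      rw [contr_eq_C, contr_eq_C, C_C]
    have hcc' : ∀ i j (a : KA β o), contr i (contr j a) = - contr j (contr i a) := fun i j a => by
      rw [contr_eq_C, contr_eq_C, contr_eq_C, contr_eq_C, C_C]
    have hc0 : contr k (contr k a) = 0 := by rw [contr_eq_C, contr_eq_C, C_sq]
    have hca' : ∀ j, ¬ mk j → j ∉ s → contr j (contr k a) = 0 := by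
      intro j hj hjs
      by_cases hjk : j = k
      · subst hjk
        exact hc0
      · rw [hcc', hca j hj (by simp [hjk, hjs]), map_zero, neg_zero]
    obtain ⟨b1, hb1, hdb1, hcb1⟩ := ih (contr k a) (contr_mem_markIdeal hmk ha)
      (by rw [hcc, hda, map_zero, neg_zero]) hca'
    obtain ⟨b2, hb2, hdb2, hcb2⟩ := ih (a + C q (y k * b1))
      (add_mem ha (C_mem_markIdeal (Ideal.mul_mem_left _ _ hb1)))
      (by rw [map_add, hda, C_sq, add_zero]) (by
        intro j hj hjs
        rw [C_y_mul, hdb1, map_add, map_sub, contr_pol_mul, hcb1 j hj hjs, contr_y_mul,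
          hca' j hj hjs]
        by_cases hjk : j = k
        · subst hjk; simp
        · rw [hca j hj (by simp [hjk, hjs])]; simp [Ne.symm hjk])
    refine ⟨b2 - y k * b1, sub_mem hb2 (Ideal.mul_mem_left _ _ hb1), ?_, ?_⟩
    · rw [map_sub, hdb2, add_sub_cancel_right]
    · intro j hj hjs
      rw [Finset.mem_insert, not_or] at hjs
      rw [map_sub, hcb2 j hj hjs.2, contr_y_mul, if_neg (Ne.symm hjs.1), hcb1 j hj hjs.2]
      simp

end MarkIdeal
end KA

end

section

section Filtration
variable {E : Type} [Ring E] [Algebra ℚ E]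

theorem top_mul_eq {K : Submodule ℚ E} (h : ⊤ * K ≤ K) : ⊤ * K = K :=
  le_antisymm h fun a ha => by
    rw [← one_mul a]
    exact Submodule.mul_mem_mul Submodule.mem_top ha

theorem mul_top_eq {K : Submodule ℚ E} (h : K * ⊤ ≤ K) : K * ⊤ = K :=
  le_antisymm h fun a ha => by
    rw [← mul_one a]
    exact Submodule.mul_mem_mul ha Submodule.mem_top

theorem top_mul_top_eq : (⊤ * ⊤ : Submodule ℚ E) = ⊤ := top_mul_eq le_top

theorem mem_top_pow_mul_iff {K : Submodule ℚ E} (h : ⊤ * K ≤ K) {n : ℕ} (hn : n ≠ 0) :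
    ⊤ * K ^ n = K ^ n := by
  obtain ⟨n, rfl⟩ := Nat.exists_eq_succ_of_ne_zero hn
  rw [pow_succ', ← mul_assoc, top_mul_eq h]

/-- A homogeneous map whose generators of positive degree lie in an ideal sends elements of
degree `n` to the `n`-th power of the ideal. -/
theorem IsGenGraded.map_mem_pow {F : Type} [Ring F] [Algebra ℚ F] {G : ℕ → Submodule ℚ F}
    {s : Set F} (h : IsGenGraded G s) {K : Submodule ℚ E} (hl : ⊤ * K ≤ K) (hr : K * ⊤ ≤ K)
    (f : F →ₐ[ℚ] E) (gen : ∀ a ∈ s, a ∈ G 0 ∨ a ∈ G 1 ∧ f a ∈ K) {n : ℕ} (hn : n ≠ 0) {a : F}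
    (ha : a ∈ G n) : f a ∈ K ^ n := by
  rw [← mem_top_pow_mul_iff hl hn]
  have hc : Commute (⊤ : Submodule ℚ E) K := (top_mul_eq hl).trans (mul_top_eq hr).symm
  refine h.map_mem (H := fun n => ⊤ * K ^ n) ?_ ?_ f ?_ n a ha
  · rw [pow_zero, mul_one]; exact Submodule.mem_top
  · intro i j a b ha hb
    have := Submodule.mul_mem_mul ha hb
    rwa [(hc.pow_right i).eq, mul_assoc, ← mul_assoc ⊤ ⊤, top_mul_top_eq, ← mul_assoc,
      ← (hc.pow_right i).eq, mul_assoc, ← pow_add] at this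
  · intro a ha
    rcases gen a ha with h0 | ⟨h1, h2⟩
    · exact ⟨0, h0, by rw [pow_zero, mul_one]; exact Submodule.mem_top⟩
    · exact ⟨1, h1, by rw [pow_one, top_mul_eq hl]; exact h2⟩

theorem sup_pow_le {J M : Submodule ℚ E} (hl : ⊤ * J ≤ J) (hr : J * ⊤ ≤ J) (n : ℕ) :
    (J ⊔ M) ^ n ≤ J ⊔ M ^ n := by
  induction n with
  | zero => rw [pow_zero, pow_zero]; exact le_sup_right
  | succ n ih =>
    rw [pow_succ, pow_succ]
    refine (mul_le_mul_left ih _).trans ?_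
    rw [Submodule.sup_mul, Submodule.mul_sup, sup_le_iff, sup_le_iff, Submodule.mul_sup, sup_le_iff]
    refine ⟨⟨?_, ?_⟩, ?_, le_sup_right⟩
    · exact (mul_le_mul_right le_top _).trans (hr.trans le_sup_left)
    · exact (mul_le_mul_right le_top _).trans (hr.trans le_sup_left)
    · exact (mul_le_mul_left le_top _).trans (hl.trans le_sup_left)

theorem add_pow_le_of_commute {P Q J : Submodule ℚ E} (hc : Commute P Q) {n : ℕ}
    (h : ∀ i j, i + j = n → P ^ i * Q ^ j ≤ J) : (P ⊔ Q) ^ n ≤ J := by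
  rw [← Submodule.add_eq_sup, hc.add_pow']
  have hs : ∀ (m : ℕ) (S : Submodule ℚ E), S ≤ J → m • S ≤ J := by
    intro m S hS
    induction m with
    | zero => rw [zero_smul]; exact bot_le
    | succ m ih => rw [succ_nsmul, Submodule.add_eq_sup]; exact sup_le ih hS
  refine Finset.sum_induction _ (fun S => S ≤ J) (fun a b ha hb => ?_) bot_le fun p hp => ?_
  · rw [Submodule.add_eq_sup]; exact sup_le ha hb
  · exact hs _ _ (h _ _ (Finset.HasAntidiagonal.mem_antidiagonal.mp hp))

end Filtration

namespace KA
open MvPolynomial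
variable {β o γ : Type} [Fintype o] [Fintype γ]

theorem mul_eq_of_anticomm {u : KA β o} (hu : ∀ k, u * y k = -(y k * u)) (a : KA β o) :
    (∃ c, a * u = u * c) ∧ ∃ c, u * a = c * u := by
  induction a using induction_on with
  | hadd a b ha hb =>
    obtain ⟨⟨c, hc⟩, c', hc'⟩ := ha
    obtain ⟨⟨d, hd⟩, d', hd'⟩ := hb
    exact ⟨⟨c + d, by rw [add_mul, hc, hd, mul_add]⟩, c' + d', by rw [mul_add, hc', hd', add_mul]⟩
  | hpol r => exact ⟨⟨pol r, pol_comm _ _⟩, pol r, (pol_comm _ _).symm⟩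
  | hy k a ha =>
    obtain ⟨⟨c, hc⟩, c', hc'⟩ := ha
    refine ⟨⟨-(y k * c), ?_⟩, -(y k * c'), ?_⟩
    · have hyu : y k * u = -(u * y k) := by rw [hu, neg_neg]
      rw [mul_assoc, hc, ← mul_assoc, hyu, neg_mul, mul_neg, mul_assoc]
    · rw [← mul_assoc, hu, neg_mul, mul_assoc, hc', neg_mul, mul_assoc]

theorem commute_top_span {u : γ → KA β o} (hu : ∀ c k, u c * y k = -(y k * u c)) :
    Commute (⊤ : Submodule ℚ (KA β o)) (Submodule.span ℚ (Set.range u)) := by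
  refine le_antisymm (Submodule.mul_le.mpr fun a _ b hb => ?_)
    (Submodule.mul_le.mpr fun b hb a _ => ?_)
  · induction hb using Submodule.span_induction with
    | mem b hb =>
      obtain ⟨c, rfl⟩ := hb
      obtain ⟨d, hd⟩ := (mul_eq_of_anticomm (hu c) a).1
      rw [hd]
      exact Submodule.mul_mem_mul (Submodule.subset_span ⟨c, rfl⟩) Submodule.mem_top
    | zero => rw [mul_zero]; exact zero_mem _
    | add b c _ _ hb hc => rw [mul_add]; exact add_mem hb hc
    | smul r b _ hb => rw [mul_smul_comm]; exact Submodule.smul_mem _ _ hb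
  · induction hb using Submodule.span_induction with
    | mem b hb =>
      obtain ⟨c, rfl⟩ := hb
      obtain ⟨d, hd⟩ := (mul_eq_of_anticomm (hu c) a).2
      rw [hd]
      exact Submodule.mul_mem_mul Submodule.mem_top (Submodule.subset_span ⟨c, rfl⟩)
    | zero => rw [zero_mul]; exact zero_mem _
    | add b c _ _ hb hc => rw [add_mul]; exact add_mem hb hc
    | smul r b _ hb => rw [smul_mul_assoc]; exact Submodule.smul_mem _ _ hb

theorem span_pow_eq_bot {u : γ → KA β o} (huu : ∀ c d, u c * u d + u d * u c = 0) {n : ℕ}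
    (hn : Fintype.card γ < n) : Submodule.span ℚ (Set.range u) ^ n = ⊥ := by
  let f : KA Empty γ →ₐ[ℚ] KA β o := lift Empty.elim u (fun i => i.elim) huu
  let U : Submodule ℚ (KA Empty γ) := Submodule.span ℚ (Set.range y)
  have hU : ∀ n : ℕ, U ^ n ≤ G 0 1 n := by
    intro n
    induction n with
    | zero =>
      rw [pow_zero, Submodule.one_le, Nat.cast_zero]
      exact one_mem_G _ _
    | succ n ih =>
      rw [pow_succ, Submodule.mul_le, Nat.cast_succ]
      refine fun a ha b hb => mul_mem_G _ _ _ _ (ih ha) ?_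
      have : U ≤ G 0 1 1 := Submodule.span_le.mpr (by
        rintro _ ⟨c, rfl⟩
        exact y_mem_G 0 1 c)
      exact this hb
  have hmap : Submodule.span ℚ (Set.range u) = U.map f.toLinearMap := by
    rw [Submodule.map_span, ← Set.range_comp]
    congr 2
    funext c
    exact (lift_y Empty.elim u (fun i => i.elim) huu c).symm
  rw [hmap, ← Submodule.map_pow, eq_bot_iff, Submodule.map_le_iff_le_comap]
  intro a ha
  rw [eq_zero_of_card_lt (by exact_mod_cast hn) (hU n ha)]
  exact zero_mem _

/-- Linear forms in the even generators. -/
def linForms (β o : Type) : Submodule ℚ (KA β o) :=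
  (homogeneousSubmodule β ℚ 1).map (pol : MvPolynomial β ℚ →ₐ[ℚ] KA β o).toLinearMap

theorem commute_linForms (K : Submodule ℚ (KA β o)) : Commute K (linForms β o) := by
  refine le_antisymm (Submodule.mul_le.mpr ?_) (Submodule.mul_le.mpr ?_)
  · rintro a ha _ ⟨r, hr, rfl⟩
    rw [AlgHom.toLinearMap_apply, ← pol_comm]
    exact Submodule.mul_mem_mul (Submodule.mem_map_of_mem (f := pol.toLinearMap) hr) ha
  · rintro _ ⟨r, hr, rfl⟩ a ha
    rw [AlgHom.toLinearMap_apply, pol_comm]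
    exact Submodule.mul_mem_mul ha (Submodule.mem_map_of_mem (f := pol.toLinearMap) hr)

theorem x_mem_linForms (b : β) : x b ∈ linForms β o :=
  ⟨X b, isHomogeneous_X ℚ b, rfl⟩

variable {q : o → MvPolynomial β ℚ} {mk : o → Prop}

theorem top_mul_markIdeal : ⊤ * (markIdeal q mk).restrictScalars ℚ ≤
    (markIdeal q mk).restrictScalars ℚ :=
  Submodule.mul_le.mpr fun a _ _ hb => Ideal.mul_mem_left _ a hb

theorem markIdeal_mul_top : (markIdeal q mk).restrictScalars ℚ * ⊤ ≤
    (markIdeal q mk).restrictScalars ℚ :=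
  Submodule.mul_le.mpr fun _ ha b _ => Ideal.mul_mem_right b _ ha

/-- The ideal generated by the marked odd generators, the even generators, and a family of
odd elements. -/
def bigIdeal (q : o → MvPolynomial β ℚ) (mk : o → Prop) (u : γ → KA β o) :
    Submodule ℚ (KA β o) :=
  (markIdeal q mk).restrictScalars ℚ ⊔ (⊤ * linForms β o ⊔ ⊤ * Submodule.span ℚ (Set.range u))

theorem top_mul_bigIdeal {u : γ → KA β o} : ⊤ * bigIdeal q mk u ≤ bigIdeal q mk u := by
  rw [bigIdeal, Submodule.mul_sup, Submodule.mul_sup, ← mul_assoc, ← mul_assoc, top_mul_top_eq]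
  exact sup_le_sup_right top_mul_markIdeal _

theorem bigIdeal_mul_top {u : γ → KA β o} (hu : ∀ c k, u c * y k = -(y k * u c)) :
    bigIdeal q mk u * ⊤ ≤ bigIdeal q mk u := by
  rw [bigIdeal, Submodule.sup_mul, Submodule.sup_mul, mul_assoc, mul_assoc,
    ← (commute_linForms ⊤).eq, ← (commute_top_span hu).eq, ← mul_assoc, ← mul_assoc,
    top_mul_top_eq]
  exact sup_le_sup_right markIdeal_mul_top _

theorem y_mem_bigIdeal {u : γ → KA β o} {j : o} (hj : mk j) : y j ∈ bigIdeal q mk u :=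
  Submodule.mem_sup_left (y_mem_markIdeal hj)

theorem x_mem_bigIdeal {u : γ → KA β o} (b : β) : x b ∈ bigIdeal q mk u :=
  Submodule.mem_sup_right (Submodule.mem_sup_left (by
    rw [← one_mul (x b)]
    exact Submodule.mul_mem_mul Submodule.mem_top (x_mem_linForms b)))

theorem mem_bigIdeal {u : γ → KA β o} (c : γ) : u c ∈ bigIdeal q mk u :=
  Submodule.mem_sup_right (Submodule.mem_sup_right (by
    rw [← one_mul (u c)]
    exact Submodule.mul_mem_mul Submodule.mem_top (Submodule.subset_span ⟨c, rfl⟩)))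

/-- A sufficiently high power lies in the ideal of marked generators. -/
theorem bigIdeal_pow_le [Fintype β] [Fintype {j // mk j}]
    (hq : ∀ j, mk j → (q j).IsHomogeneous 2)
    (hX : ∀ b, (X b : MvPolynomial β ℚ) ∈
      (Ideal.span (Set.range fun j : {j // mk j} => q j)).radical)
    {u : γ → KA β o} (hu : ∀ c k, u c * y k = -(y k * u c))
    (huu : ∀ c d, u c * u d + u d * u c = 0) {n : ℕ}
    (hn : Fintype.card {j // mk j} + Fintype.card γ < n) :
    bigIdeal q mk u ^ n ≤ (markIdeal q mk).restrictScalars ℚ := by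
  have hU := commute_top_span hu
  have hX' := commute_linForms (⊤ : Submodule ℚ (KA β o))
  refine (sup_pow_le top_mul_markIdeal markIdeal_mul_top n).trans (sup_le le_rfl ?_)
  refine add_pow_le_of_commute ?_ ?_
  · refine Commute.mul_left ?_ ?_
    · exact Commute.mul_right (Commute.refl _) hU
    · exact (commute_linForms _).symm
  · intro i j hij
    rw [hX'.mul_pow, hU.mul_pow]
    by_cases hj : Fintype.card γ < j
    · rw [span_pow_eq_bot huu hj, Submodule.mul_bot, Submodule.mul_bot]
      exact bot_le
    · have hi : Fintype.card {j // mk j} < i := by omega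
      have hle : linForms β o ^ i ≤ (markIdeal q mk).restrictScalars ℚ := by
        rw [linForms, ← Submodule.map_pow, Submodule.map_le_iff_le_comap]
        have hH : homogeneousSubmodule β ℚ 1 ^ i ≤ homogeneousSubmodule β ℚ i := by
          clear hi hij
          induction i with
          | zero =>
            rw [pow_zero, Submodule.one_le]
            exact isHomogeneous_one β ℚ
          | succ i ih =>
            rw [pow_succ, Submodule.mul_le]
            exact fun a ha b hb => (ih ha).mul hb
        intro r hr
        exact pol_mem_markIdeal (mem_span_of_card_lt
          (p := fun j : {j // mk j} => q j) (fun j => hq j j.2) hX hi (hH hr))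
      calc ⊤ ^ i * linForms β o ^ i * (⊤ ^ j * Submodule.span ℚ (Set.range u) ^ j)
          ≤ ⊤ * (markIdeal q mk).restrictScalars ℚ * ⊤ :=
            mul_le_mul' (mul_le_mul' le_top hle) le_top
        _ ≤ _ := (mul_le_mul' top_mul_markIdeal le_rfl).trans markIdeal_mul_top

end KA

end

section

/-- A left ideal from a subspace stable under left multiplication. -/
def leftIdeal {A : Type} [Ring A] [Algebra ℚ A] (I : Submodule ℚ A) (h : ⊤ * I ≤ I) : Ideal A where
  carrier := I
  add_mem' := I.add_mem
  zero_mem' := I.zero_mem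
  smul_mem' _ _ hb := h (Submodule.mul_mem_mul Submodule.mem_top hb)

section Graded
variable {A : Type} [GCDGA A]

theorem Dd_mem_mul {I J : Submodule ℚ A} (hI : IsGradedSub I) (hdI : ∀ a ∈ I, Dd A a ∈ I)
    (hdJ : ∀ a ∈ J, Dd A a ∈ J) : ∀ a ∈ I * J, Dd A a ∈ I * J := by
  intro a ha
  induction ha using Submodule.mul_induction_on' with
  | mem_mul_mem a ha b hb =>
    refine Submodule.iSup_induction (motive := fun a => Dd A (a * b) ∈ I * J) _ (hI ha) ?_
      (by simp) fun a a' h h' => by rw [add_mul, map_add]; exact add_mem h h'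
    intro i a ha
    rw [Dd_mul ha.2]
    exact add_mem (Submodule.mul_mem_mul (hdI _ ha.1) hb)
      (Submodule.smul_mem _ _ (Submodule.mul_mem_mul ha.1 (hdJ _ hb)))
  | add a _ b _ ha hb => rw [map_add]; exact add_mem ha hb

theorem Dd_mem_pow {I : Submodule ℚ A} (hI : IsGradedSub I) (hdI : ∀ a ∈ I, Dd A a ∈ I) (n : ℕ) :
    ∀ a ∈ I ^ n, Dd A a ∈ I ^ n := by
  induction n with
  | zero =>
    intro a ha
    rw [pow_zero] at ha ⊢
    obtain ⟨c, rfl⟩ := Submodule.mem_one.mp ha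
    rw [Algebra.algebraMap_eq_smul_one, map_smul, Dd_one, smul_zero]
    exact zero_mem _
  | succ n ih => rw [pow_succ]; exact Dd_mem_mul (hI.pow n) ih hdI

theorem isGradedSub_ker {B : Type} [GCDGA B] {f : A →ₐ[ℚ] B} (hf : IsDGAHom f) :
    IsGradedSub (LinearMap.ker f.toLinearMap) := by
  refine isGradedSub_of_mem fun s v hv h i hi => ?_
  rw [LinearMap.mem_ker, map_sum] at h
  exact (iSupIndep_iff_finsetSum_eq_zero_imp_eq_zero _).mp (iSupIndep_Gr B) s
    (fun i => f.toLinearMap (v i)) (fun i hi => hf.2 i _ (hv i hi)) h i hi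

theorem top_mul_ker {B : Type} [GCDGA B] (f : A →ₐ[ℚ] B) :
    ⊤ * LinearMap.ker f.toLinearMap ≤ LinearMap.ker f.toLinearMap :=
  Submodule.mul_le.mpr fun a _ b hb => by
    have hb' : f b = 0 := hb
    change f (a * b) = 0
    rw [map_mul, hb', mul_zero]

theorem ker_mul_top {B : Type} [GCDGA B] (f : A →ₐ[ℚ] B) :
    LinearMap.ker f.toLinearMap * ⊤ ≤ LinearMap.ker f.toLinearMap :=
  Submodule.mul_le.mpr fun a ha b _ => by
    have hb' : f a = 0 := ha
    change f (a * b) = 0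
    rw [map_mul, hb', zero_mul]

theorem pow_succ_mul_top {I : Submodule ℚ A} (h : I * ⊤ ≤ I) (n : ℕ) :
    I ^ (n + 1) * ⊤ ≤ I ^ (n + 1) := by
  rw [pow_succ, mul_assoc]
  exact mul_le_mul' le_rfl h

theorem top_mul_pow_succ {I : Submodule ℚ A} (h : ⊤ * I ≤ I) (n : ℕ) :
    ⊤ * I ^ (n + 1) ≤ I ^ (n + 1) := by
  rw [pow_succ', ← mul_assoc]
  exact mul_le_mul' h le_rfl

theorem TensorPower.mu_spec {r : ℕ} {T : Type} [GCDGA T] (TP : TensorPower A r T) :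
    IsDGAHom TP.mu ∧ ∀ j, TP.mu.comp (TP.ι j) = AlgHom.id ℚ A :=
  (TP.coprod A (fun _ => AlgHom.id ℚ A) (fun _ => isDGAHom_id A)).choose_spec.1

theorem TensorPower.mu_ι {r : ℕ} {T : Type} [GCDGA T] (TP : TensorPower A r T) (j : Fin r) (a : A) :
    TP.mu (TP.ι j a) = a := DFunLike.congr_fun (TP.mu_spec.2 j) a

end Graded

namespace Dat
variable {β o : Type} [Fintype o] (D : Dat β o)

theorem iSup_gr (a : KA β o) : a ∈ ⨆ i, D.gr i := D.isGenGraded.iSup_eq_top ▸ Submodule.mem_top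

theorem isGradedSub_markIdeal (mk : o → Prop) :
    IsGradedSub (A := D.Model) ((KA.markIdeal D.q mk).restrictScalars ℚ) := by
  let J : Submodule ℚ (KA β o) := (KA.markIdeal D.q mk).restrictScalars ℚ
  suffices h : ∀ a ∈ KA.markIdeal D.q mk, a ∈ ⨆ i, J ⊓ D.gr i from h
  intro a ha
  refine KA.markIdeal_induction (P := fun a => a ∈ ⨆ i, J ⊓ D.gr i) (zero_mem _)
    (fun a b => add_mem) (fun j hj a => ?_) (fun j hj a => ?_) ha
  · refine Submodule.iSup_induction (motive := fun a => KA.pol (D.q j) * a ∈ ⨆ i, J ⊓ D.gr i) _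
      (D.iSup_gr a) (fun i a ha => ?_) (by simp)
      fun a a' h h' => by rw [mul_add]; exact add_mem h h'
    exact Submodule.mem_iSup_of_mem _ ⟨KA.pol_mul_mem_markIdeal hj _,
      D.isGenGraded.mul_mem _ _ _ _ (D.q_mem j) ha⟩
  · refine Submodule.iSup_induction (motive := fun a => KA.y j * a ∈ ⨆ i, J ⊓ D.gr i) _
      (D.iSup_gr a) (fun i a ha => ?_) (by simp)
      fun a a' h h' => by rw [mul_add]; exact add_mem h h'
    exact Submodule.mem_iSup_of_mem _ ⟨KA.y_mul_mem_markIdeal hj _,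
      D.isGenGraded.mul_mem _ _ _ _ (D.y_mem j) ha⟩

open MvPolynomial in
/-- Projections killing an ideal contained in the ideal of marked generators have a homotopy
retraction. -/
theorem exists_htpyRetraction [Fintype β] {mk : o → Prop} [Fintype {j // mk j}]
    (hq : ∀ j, mk j → (D.q j).IsHomogeneous 2)
    (hX : ∀ b, (X b : MvPolynomial β ℚ) ∈
      (Ideal.span (Set.range fun j : {j // mk j} => D.q j)).radical)
    (hc : Fintype.card {j // mk j} ≤ Fintype.card β) {I : Submodule ℚ D.Model}
    (hl : ⊤ * I ≤ I) (hr : I * ⊤ ≤ I) (hg : IsGradedSub I) (hd : ∀ a ∈ I, Dd D.Model a ∈ I)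
    (hI : I ≤ ((KA.markIdeal D.q mk).restrictScalars ℚ : Submodule ℚ (KA β o))) :
    ∃ (Q : Type) (_ : GCDGA Q) (π : D.Model →ₐ[ℚ] Q), IsDGAHom π ∧ Function.Surjective π ∧
      LinearMap.ker π.toLinearMap = I ∧ Nonempty (HtpyRetraction π) := by
  have : (leftIdeal I hl).IsTwoSided :=
    ⟨fun b ha => hr (Submodule.mul_mem_mul ha Submodule.mem_top)⟩
  let J : Ideal D.Model := KA.markIdeal D.q mk
  have : J.IsTwoSided := inferInstanceAs (KA.markIdeal D.q mk).IsTwoSided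
  obtain ⟨Q, i, π, h1, h2, h3, h4⟩ := RHT.exists_htpyRetraction (leftIdeal I hl) J hI hd hg
    (fun a ha => KA.C_mem_markIdeal ha) (D.isGradedSub_markIdeal mk)
    (fun a ha hda => KA.exact_of_mem_markIdeal hq hX hc ha hda)
  exact ⟨Q, i, π, h1, h2, h3, h4⟩

end Dat

end

section

namespace KA
open MvPolynomial
variable {β β' κ o : Type}

/-- The map induced by maps of generators. -/
def ren (f : β → β') (g : κ → o) : KA β κ →ₐ[ℚ] KA β' o :=
  lift (fun b => x (f b)) (fun j => y (g j)) (fun _ _ => pol_comm _ _) fun _ _ => y_mul_y_add _ _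

theorem ren_x (f : β → β') (g : κ → o) (b : β) : ren f g (x b) = x (f b) := lift_x ..

theorem ren_y (f : β → β') (g : κ → o) (j : κ) : ren f g (y j) = y (g j) := lift_y ..

theorem ren_pol (f : β → β') (g : κ → o) (r : MvPolynomial β ℚ) :
    ren f g (pol r) = pol (rename f r) := by
  have : (ren f g).comp pol = pol.comp (rename f) := MvPolynomial.algHom_ext fun i => by
    refine (ren_x f g i).trans ?_
    rw [AlgHom.comp_apply, rename_X]
    rfl
  exact DFunLike.congr_fun this r

theorem ren_mem_G [Fintype κ] [Fintype o] (f : β → β') (g : κ → o) {w : β → ℚ} {v : κ → ℚ}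
    {w' : β' → ℚ} {v' : o → ℚ} (hw : ∀ b, w' (f b) = w b) (hv : ∀ j, v' (g j) = v j) {s : ℚ}
    {a : KA β κ} (ha : a ∈ G w v s) : ren f g a ∈ G w' v' s := by
  refine (isGenGraded w v).map_mem (one_mem_G _ _) mul_mem_G _ ?_ s a ha
  rintro _ (⟨b, rfl⟩ | ⟨k, rfl⟩)
  · exact ⟨_, x_mem_G _ _ b, by rw [ren_x, ← hw]; exact x_mem_G _ _ _⟩
  · exact ⟨_, y_mem_G _ _ k, by rw [ren_y, ← hv]; exact y_mem_G _ _ _⟩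

end KA

namespace Dat
open MvPolynomial
variable {β κ : Type} [Fintype κ] (D : Dat β κ)

/-- The data of a tensor power. -/
def power (r : ℕ) : Dat (β × Fin r) (κ × Fin r) where
  dx b := D.dx b.1
  dy j := D.dy j.1
  q j := rename (fun b => (b, j.2)) (D.q j.1)
  hq j := by
    have := KA.ren_mem_G (fun b => (b, j.2)) (fun i : κ => (i, j.2))
      (w' := fun b : β × Fin r => ((2 * D.dx b.1 : ℕ) : ℚ))
      (v' := fun i : κ × Fin r => ((2 * D.dy i.1 + 1 : ℕ) : ℚ)) (fun _ => rfl) (fun _ => rfl)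
      (D.hq j.1)
    rwa [KA.ren_pol] at this

/-- The inclusions of the factors of a tensor power. -/
def powerι (r : ℕ) (k : Fin r) : D.Model →ₐ[ℚ] (D.power r).Model :=
  KA.ren (fun b => (b, k)) (fun j : κ => (j, k))

theorem powerι_dga (r : ℕ) (k : Fin r) : IsDGAHom (D.powerι r k) := by
  refine D.isDGAHom_of_gen (B := (D.power r).Model) (KA.ren (fun b => (b, k)) fun j : κ => (j, k))
    (fun b => ?_) (fun j => ?_) (fun b => ?_) fun j => ?_
  · exact Set.mem_of_eq_of_mem (KA.ren_x _ _ b) ((D.power r).x_mem (b, k))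
  · exact Set.mem_of_eq_of_mem (KA.ren_y _ _ j) ((D.power r).y_mem (j, k))
  · exact (congrArg (KA.C (D.power r).q) (KA.ren_x _ _ b)).trans (KA.C_pol _ _)
  · exact (congrArg (KA.C (D.power r).q) (KA.ren_y _ _ j)).trans
      ((KA.C_y _ (j, k)).trans (KA.ren_pol _ _ _).symm)

section Coproduct
variable {B : Type} [GCDGA B] {r : ℕ} (f : Fin r → (D.Model →ₐ[ℚ] B)) (hf : ∀ k, IsDGAHom (f k))

/-- The algebra map out of the tensor power with prescribed restrictions. -/
def copairing : KA (β × Fin r) (κ × Fin r) →ₐ[ℚ] B :=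
  (D.power r).liftHom (fun b => f b.2 (D.toModel (KA.x b.1))) (fun j => f j.2 (D.toModel (KA.y j.1)))
    (fun b => (hf b.2).2 _ _ (D.x_mem b.1)) fun j => (hf j.2).2 _ _ (D.y_mem j.1)

theorem copairing_x (b : β × Fin r) :
    D.copairing f hf (KA.x b) = f b.2 (D.toModel (KA.x b.1)) := liftHom_x ..

theorem copairing_y (j : κ × Fin r) :
    D.copairing f hf (KA.y j) = f j.2 (D.toModel (KA.y j.1)) := liftHom_y ..

theorem copairing_ren (k : Fin r) (a : KA β κ) :
    D.copairing f hf (KA.ren (fun b => (b, k)) (fun j => (j, k)) a) = f k (D.toModel a) := by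
  have : (D.copairing f hf).comp (KA.ren (fun b => (b, k)) fun j => (j, k)) =
      (f k).comp D.toModel.toAlgHom := by
    refine KA.algHom_ext (fun b => ?_) fun j => ?_
    · rw [AlgHom.comp_apply, KA.ren_x, copairing_x]; rfl
    · rw [AlgHom.comp_apply, KA.ren_y, copairing_y]; rfl
  exact DFunLike.congr_fun this a

theorem copairing_dga : IsDGAHom ((D.copairing f hf).comp (D.power r).toModel.symm.toAlgHom) := by
  refine (D.power r).isDGAHom_of_gen _ (fun b => ?_) (fun j => ?_) (fun b => ?_) fun j => ?_
  · rw [copairing_x]; exact (hf b.2).2 _ _ (D.x_mem b.1)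
  · rw [copairing_y]; exact (hf j.2).2 _ _ (D.y_mem j.1)
  · rw [copairing_x, ← (hf b.2).1, Dd_toModel, KA.x, KA.C_pol, map_zero, map_zero]
  · rw [copairing_y, ← (hf j.2).1, Dd_toModel, KA.C_y, ← copairing_ren D f hf, KA.ren_pol]
    rfl

end Coproduct

/-- The concrete tensor power of a model. -/
def tensorPower (r : ℕ) : TensorPower D.Model r (D.power r).Model where
  ι := D.powerι r
  ι_dga := D.powerι_dga r
  coprod B _ f hf := by
    refine ⟨(D.copairing f hf).comp (D.power r).toModel.symm.toAlgHom,
      ⟨D.copairing_dga f hf, fun k => AlgHom.ext fun a => D.copairing_ren f hf k a⟩, ?_⟩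
    rintro g ⟨-, hg⟩
    have : g.comp (D.power r).toModel.toAlgHom = D.copairing f hf := by
      refine KA.algHom_ext (fun b => ?_) fun j => ?_
      · rw [copairing_x]
        exact (congrArg g (KA.ren_x (fun c => (c, b.2)) (fun j : κ => (j, b.2)) b.1).symm).trans
          (DFunLike.congr_fun (hg b.2) (D.toModel (KA.x b.1)))
      · rw [copairing_y]
        exact (congrArg g (KA.ren_y (fun c => (c, j.2)) (fun i : κ => (i, j.2)) j.1).symm).trans
          (DFunLike.congr_fun (hg j.2) (D.toModel (KA.y j.1)))
    rw [← this]
    rfl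

section Upper

theorem mu_x (r : ℕ) (b : β × Fin r) :
    (D.tensorPower r).mu ((D.power r).toModel (KA.x b)) = D.toModel (KA.x b.1) :=
  (congrArg (D.tensorPower r).mu
    (KA.ren_x (fun c => (c, b.2)) (fun j : κ => (j, b.2)) b.1).symm).trans
      ((D.tensorPower r).mu_ι b.2 (D.toModel (KA.x b.1)))

theorem mu_y (r : ℕ) (j : κ × Fin r) :
    (D.tensorPower r).mu ((D.power r).toModel (KA.y j)) = D.toModel (KA.y j.1) :=
  (congrArg (D.tensorPower r).mu
    (KA.ren_y (fun c => (c, j.2)) (fun i : κ => (i, j.2)) j.1).symm).trans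
      ((D.tensorPower r).mu_ι j.2 (D.toModel (KA.y j.1)))

variable [Fintype β] {mk : κ → Prop} [DecidablePred mk]

/-- Differences of the unmarked odd generators in a tensor power. -/
def oddDiff (β : Type) (mk : κ → Prop) (r : ℕ) (c : {j // ¬ mk j} × Fin r) :
    KA (β × Fin (r + 1)) (κ × Fin (r + 1)) :=
  KA.y (c.1.1, c.2.succ) - KA.y (c.1.1, 0)

theorem oddDiff_mul_y (r : ℕ) (c : {j // ¬ mk j} × Fin r) (k : κ × Fin (r + 1)) :
    oddDiff β mk r c * KA.y k = -(KA.y k * oddDiff β mk r c) := by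
  rw [oddDiff, sub_mul, mul_sub, KA.y_mul_y _ k, KA.y_mul_y (c.1.1, 0) k]
  abel

theorem oddDiff_mul_oddDiff (r : ℕ) (c d : {j // ¬ mk j} × Fin r) :
    oddDiff β mk r c * oddDiff β mk r d + oddDiff β mk r d * oddDiff β mk r c = 0 := by
  conv_lhs =>
    enter [1]
    rw [oddDiff.eq_def β mk r d, mul_sub, oddDiff_mul_y, oddDiff_mul_y]
  conv_lhs =>
    enter [2, 1]
    rw [oddDiff]
  rw [sub_mul]
  abel

theorem mem_bigIdeal_of_eq_zero {r : ℕ} (q : κ × Fin (r + 1) → MvPolynomial (β × Fin (r + 1)) ℚ)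
    (μ : KA (β × Fin (r + 1)) (κ × Fin (r + 1)) →ₐ[ℚ] KA β κ)
    (hμx : ∀ b, μ (KA.x b) = KA.x b.1) (hμy : ∀ j, μ (KA.y j) = KA.y j.1) {a} (ha : μ a = 0) :
    a ∈ KA.bigIdeal q (fun j => mk j.1) (oddDiff β mk r) := by
  let L := KA.bigIdeal q (fun j => mk j.1) (oddDiff β mk r)
  let s : KA β κ →ₐ[ℚ] KA (β × Fin (r + 1)) (κ × Fin (r + 1)) :=
    KA.ren (fun b => (b, 0)) (fun j : κ => (j, 0))
  suffices h : ∀ a, a - s (μ a) ∈ L by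
    have := h a
    rwa [ha, map_zero, sub_zero] at this
  clear ha
  intro a
  have ha : a ∈ Algebra.adjoin ℚ (Set.range (KA.x : _ → KA (β × Fin (r + 1)) (κ × Fin (r + 1))) ∪
      Set.range KA.y) := KA.adjoin_eq_top ▸ trivial
  induction ha using Algebra.adjoin_induction with
  | mem a ha =>
    rcases ha with ⟨⟨b, k⟩, rfl⟩ | ⟨⟨j, k⟩, rfl⟩
    · rw [hμx, KA.ren_x]
      exact sub_mem (KA.x_mem_bigIdeal _) (KA.x_mem_bigIdeal _)
    · rw [hμy, KA.ren_y]
      by_cases hj : mk j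
      · exact sub_mem (KA.y_mem_bigIdeal (mk := fun j : κ × Fin (r + 1) => mk j.1) hj)
          (KA.y_mem_bigIdeal (mk := fun j : κ × Fin (r + 1) => mk j.1) hj)
      · induction k using Fin.cases with
        | zero => rw [sub_self]; exact zero_mem _
        | succ k => exact KA.mem_bigIdeal (u := oddDiff β mk r) (⟨j, hj⟩, k)
  | algebraMap c => rw [AlgHom.commutes, AlgHom.commutes, sub_self]; exact zero_mem _
  | add a b _ _ ha hb =>
    rw [map_add, map_add, add_sub_add_comm]
    exact add_mem ha hb
  | mul a b _ _ ha hb =>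
    have : a * b - s (μ (a * b)) = (a - s (μ a)) * b + s (μ a) * (b - s (μ b)) := by
      rw [map_mul, map_mul]; noncomm_ring
    rw [this]
    exact add_mem (KA.bigIdeal_mul_top (oddDiff_mul_y r) (Submodule.mul_mem_mul ha Submodule.mem_top))
      (KA.top_mul_bigIdeal (Submodule.mul_mem_mul Submodule.mem_top hb))

/-- The kernel of the multiplication lies in the ideal generated by the even generators, the
marked odd generators, and differences of odd generators. -/
theorem kerMu_le (r : ℕ) :
    (D.tensorPower (r + 1)).kerMu ≤ KA.bigIdeal (D.power (r + 1)).q (fun j => mk j.1)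
      (oddDiff β mk r) :=
  fun _ ha => mem_bigIdeal_of_eq_zero (D.power (r + 1)).q
    (D.toModel.symm.toAlgHom.comp ((D.tensorPower (r + 1)).mu.comp (D.power (r + 1)).toModel.toAlgHom))
    (D.mu_x (r + 1)) (D.mu_y (r + 1)) ha

theorem card_marked_power (r : ℕ) :
    Fintype.card {j : κ × Fin r // mk j.1} = Fintype.card {j // mk j} * r := by
  have e : {j : κ × Fin r // mk j.1} ≃ {j // mk j} × Fin r :=
    { toFun := fun j => (⟨j.1.1, j.2⟩, j.1.2)
      invFun := fun j => ⟨(j.1.1, j.2), j.1.2⟩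
      left_inv := fun _ => rfl
      right_inv := fun _ => rfl }
  rw [Fintype.card_congr e, Fintype.card_prod, Fintype.card_fin]

theorem X_mem_radical_power
    (hX : ∀ b, (X b : MvPolynomial β ℚ) ∈
      (Ideal.span (Set.range fun j : {j // mk j} => D.q j)).radical) (r : ℕ) (b : β × Fin r) :
    (X b : MvPolynomial (β × Fin r) ℚ) ∈
      (Ideal.span (Set.range fun j : {j : κ × Fin r // mk j.1} => (D.power r).q j)).radical := by
  obtain ⟨b, k⟩ := b
  obtain ⟨N, hN⟩ := hX b
  refine ⟨N, ?_⟩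
  have hle : Ideal.span (Set.range fun j : {j // mk j} => D.q j) ≤
      (Ideal.span (Set.range fun j : {j : κ × Fin r // mk j.1} =>
        (D.power r).q j)).comap (rename fun b => (b, k)) := by
    rw [Ideal.span_le]
    rintro _ ⟨j, rfl⟩
    exact Ideal.subset_span ⟨⟨(j, k), j.2⟩, rfl⟩
  have := hle hN
  rwa [Ideal.mem_comap, map_pow, rename_X] at this

theorem bigIdeal_power_le (hq : ∀ j, mk j → (D.q j).IsHomogeneous 2)
    (hX : ∀ b, (X b : MvPolynomial β ℚ) ∈
      (Ideal.span (Set.range fun j : {j // mk j} => D.q j)).radical)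
    (r : ℕ) {n : ℕ} (hn : r * Fintype.card κ + Fintype.card {j // mk j} < n) :
    KA.bigIdeal (D.power (r + 1)).q (fun j => mk j.1) (oddDiff β mk r) ^ n ≤
      (KA.markIdeal (D.power (r + 1)).q (fun j => mk j.1)).restrictScalars ℚ := by
  refine KA.bigIdeal_pow_le (fun j hj => (hq j.1 hj).rename_isHomogeneous)
    (D.X_mem_radical_power hX (r + 1)) (oddDiff_mul_y r) (oddDiff_mul_oddDiff r)
    (lt_of_eq_of_lt ?_ hn)
  rw [card_marked_power, Fintype.card_prod, Fintype.card_fin, Fintype.card_subtype_compl]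
  obtain ⟨d, hd⟩ := Nat.exists_eq_add_of_le (Fintype.card_subtype_le mk)
  rw [hd, Nat.add_sub_cancel_left]
  ring

/-- Upper bound for the module topological complexity. -/
theorem nonempty_MTCWitness (hq : ∀ j, mk j → (D.q j).IsHomogeneous 2)
    (hX : ∀ b, (X b : MvPolynomial β ℚ) ∈
      (Ideal.span (Set.range fun j : {j // mk j} => D.q j)).radical)
    (hc : Fintype.card {j // mk j} ≤ Fintype.card β) (r : ℕ) {n : ℕ}
    (hn : r * Fintype.card κ + Fintype.card β ≤ n) : Nonempty (MTCWitness D.Model (r + 1) n) := by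
  have hμ := (D.tensorPower (r + 1)).mu_spec.1
  have hdk : ∀ a ∈ (D.tensorPower (r + 1)).kerMu,
      Dd (D.power (r + 1)).Model a ∈ (D.tensorPower (r + 1)).kerMu := by
    intro a ha
    have ha' : (D.tensorPower (r + 1)).mu a = 0 := ha
    change (D.tensorPower (r + 1)).mu _ = 0
    rw [hμ.1, ha', map_zero]
  have hI : (D.tensorPower (r + 1)).kerMu ^ (n + 1) ≤
      ((KA.markIdeal (D.power (r + 1)).q fun j => mk j.1).restrictScalars ℚ :
        Submodule ℚ (KA (β × Fin (r + 1)) (κ × Fin (r + 1)))) :=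
    (pow_le_pow_left' (D.kerMu_le (mk := mk) r) (n + 1)).trans
      (D.bigIdeal_power_le hq hX r (by omega))
  obtain ⟨Q, iQ, π, h1, h2, h3, ⟨R⟩⟩ := (D.power (r + 1)).exists_htpyRetraction
    (mk := fun j => mk j.1) (fun j hj => (hq j.1 hj).rename_isHomogeneous)
    (D.X_mem_radical_power hX (r + 1))
    (by
      rw [card_marked_power, Fintype.card_prod, Fintype.card_fin]
      exact Nat.mul_le_mul_right _ hc)
    (I := (D.tensorPower (r + 1)).kerMu ^ (n + 1))
    (top_mul_pow_succ (top_mul_ker _) n) (pow_succ_mul_top (ker_mul_top _) n)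
    ((isGradedSub_ker hμ).pow _) (Dd_mem_pow (isGradedSub_ker hμ) hdk _) hI
  exact ⟨⟨_, D.tensorPower (r + 1), Q, π, h1, h2, h3, ⟨R.toMod⟩⟩⟩

/-- Elements of large word length. -/
def longWords (β κ : Type) [Fintype κ] (n : ℕ) : Submodule ℚ (KA β κ) :=
  ⨆ k : ℕ, ⨆ (_ : n < k), KA.G (fun _ => ((1 : ℕ) : ℚ)) (fun _ => ((1 : ℕ) : ℚ)) (k : ℚ)

theorem longWords_le (hq : ∀ j, (D.q j).IsHomogeneous 2)
    (hX : ∀ b, (X b : MvPolynomial β ℚ) ∈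
      (Ideal.span (Set.range fun j : {j // mk j} => D.q j)).radical)
    {n : ℕ} (hn : Fintype.card κ ≤ n) :
    longWords β κ n ≤ (KA.markIdeal D.q mk).restrictScalars ℚ := by
  let u : {j // ¬ mk j} → KA β κ := fun c => KA.y c.1
  have hu : ∀ c k, u c * KA.y k = -(KA.y k * u c) := fun c k => KA.y_mul_y _ _
  refine iSup_le fun k => iSup_le fun hk a ha => ?_
  refine KA.bigIdeal_pow_le (u := u) (fun j _ => hq j) hX hu (fun c d => KA.y_mul_y_add _ _)
    (n := k) ?_ ((KA.isGenGraded_nat (fun _ : β => 1) fun _ : κ => 1).map_mem_pow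
      (K := KA.bigIdeal D.q mk u) KA.top_mul_bigIdeal (KA.bigIdeal_mul_top hu) (AlgHom.id ℚ _) ?_
      (by omega) ha)
  · rw [Fintype.card_subtype_compl]
    have := Fintype.card_subtype_le mk
    omega
  · rintro _ (⟨b, rfl⟩ | ⟨j, rfl⟩)
    · exact Or.inr ⟨KA.x_mem_G _ _ b, KA.x_mem_bigIdeal b⟩
    · refine Or.inr ⟨KA.y_mem_G _ _ j, ?_⟩
      by_cases hj : mk j
      · exact KA.y_mem_bigIdeal hj
      · exact KA.mem_bigIdeal (u := u) ⟨j, hj⟩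

theorem mul_mem_longWords {n : ℕ} {a b : KA β κ} (h : a ∈ longWords β κ n ∨ b ∈ longWords β κ n) :
    a * b ∈ longWords β κ n := by
  have hG := KA.isGenGraded_nat (fun _ : β => 1) fun _ : κ => 1
  have key : ∀ i j : ℕ, ∀ a b : KA β κ, n < i ∨ n < j →
      a ∈ KA.G (fun _ => ((1 : ℕ) : ℚ)) (fun _ => ((1 : ℕ) : ℚ)) (i : ℚ) →
      b ∈ KA.G (fun _ => ((1 : ℕ) : ℚ)) (fun _ => ((1 : ℕ) : ℚ)) (j : ℚ) →
      a * b ∈ longWords β κ n := fun i j a b hij ha hb =>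
    Submodule.mem_iSup_of_mem (i + j) (Submodule.mem_iSup_of_mem (by omega) (hG.mul_mem i j a b ha hb))
  have htop : ∀ c : KA β κ, c ∈ ⨆ i : ℕ,
      KA.G (fun _ => ((1 : ℕ) : ℚ)) (fun _ => ((1 : ℕ) : ℚ)) (i : ℚ) := fun c =>
    hG.iSup_eq_top ▸ Submodule.mem_top
  rcases h with h | h
  · have : longWords β κ n ≤ (longWords β κ n).comap (LinearMap.mulRight ℚ b) := by
      refine iSup_le fun i => iSup_le fun hi a ha => ?_
      refine Submodule.iSup_induction (motive := fun b => a * b ∈ longWords β κ n) _ (htop b)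
        (fun j b hb => key i j a b (Or.inl hi) ha hb) (by simp)
        fun c c' hc hc' => by rw [mul_add]; exact add_mem hc hc'
    exact this h
  · have : longWords β κ n ≤ (longWords β κ n).comap (LinearMap.mulLeft ℚ a) := by
      refine iSup_le fun j => iSup_le fun hj b hb => ?_
      refine Submodule.iSup_induction (motive := fun a => a * b ∈ longWords β κ n) _ (htop a)
        (fun i a ha => key i j a b (Or.inr hj) ha hb) (by simp)
        fun c c' hc hc' => by rw [add_mul]; exact add_mem hc hc'
    exact this h

theorem C_mem_longWords (hq : ∀ j, (D.q j).IsHomogeneous 2) {n : ℕ} {a : KA β κ}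
    (ha : a ∈ longWords β κ n) : KA.C D.q a ∈ longWords β κ n := by
  have : longWords β κ n ≤ (longWords β κ n).comap (KA.C D.q) := by
    refine iSup_le fun k => iSup_le fun hk a ha => ?_
    refine Submodule.mem_iSup_of_mem (k + 1) (Submodule.mem_iSup_of_mem (by omega) ?_)
    have := KA.C_mem_G D.q (-1) (fun j => by
      have := KA.pol_mem_G_of_isWeightedHomogeneous (v := fun _ : κ => ((1 : ℕ) : ℚ)) (hq j)
      convert this using 1
      congr 1
      norm_num) ha
    convert this using 1
    congr 1
    push_cast; ring
  exact this ha

theorem isGradedSub_longWords (n : ℕ) :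
    IsGradedSub (A := D.Model) (longWords β κ n : Submodule ℚ (KA β κ)) := by
  have hG := KA.isGenGraded_nat (fun _ : β => 1) fun _ : κ => 1
  let G : ℕ → Submodule ℚ (KA β κ) := fun k =>
    KA.G (fun _ => ((1 : ℕ) : ℚ)) (fun _ => ((1 : ℕ) : ℚ)) (k : ℚ)
  suffices h : longWords β κ n ≤ ⨆ i, longWords β κ n ⊓ D.gr i from h
  have key : ∀ k, G k ≤ ⨆ i, G k ⊓ D.gr i := by
    refine hG.le_of_gen (fun k => iSup_le fun i => inf_le_left)
      (Submodule.mem_iSup_of_mem 0 ⟨hG.one_mem, D.isGenGraded.one_mem⟩) ?_ ?_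
    · intro i j a b ha hb
      refine Submodule.iSup_induction (motive := fun a => a * b ∈ ⨆ k, G (i + j) ⊓ D.gr k) _ ha
        (fun k a ha => ?_) (by simp) fun c c' hc hc' => by rw [add_mul]; exact add_mem hc hc'
      refine Submodule.iSup_induction (motive := fun b => a * b ∈ ⨆ k, G (i + j) ⊓ D.gr k) _ hb
        (fun l b hb => ?_) (by simp) fun c c' hc hc' => by rw [mul_add]; exact add_mem hc hc'
      exact Submodule.mem_iSup_of_mem _ ⟨hG.mul_mem _ _ _ _ ha.1 hb.1,
        D.isGenGraded.mul_mem _ _ _ _ ha.2 hb.2⟩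
    · rintro _ (⟨b, rfl⟩ | ⟨j, rfl⟩)
      · exact ⟨1, Submodule.mem_iSup_of_mem _ ⟨KA.x_mem_G _ _ b, D.x_mem b⟩⟩
      · exact ⟨1, Submodule.mem_iSup_of_mem _ ⟨KA.y_mem_G _ _ j, D.y_mem j⟩⟩
  refine iSup_le fun k => iSup_le fun hk => (key k).trans (iSup_mono fun i => inf_le_inf_right _ ?_)
  exact le_iSup₂_of_le k hk le_rfl

/-- Upper bound for the category. -/
theorem exists_htpyRetraction_longWords (hq : ∀ j, (D.q j).IsHomogeneous 2)
    (hX : ∀ b, (X b : MvPolynomial β ℚ) ∈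
      (Ideal.span (Set.range fun j : {j // mk j} => D.q j)).radical)
    (hc : Fintype.card {j // mk j} ≤ Fintype.card β) {n : ℕ} (hn : Fintype.card κ ≤ n) :
    ∃ (Q : Type) (_ : GCDGA Q) (π : D.Model →ₐ[ℚ] Q), IsDGAHom π ∧ Function.Surjective π ∧
      LinearMap.ker π.toLinearMap = longWords β κ n ∧ Nonempty (HtpyRetraction π) := by
  refine D.exists_htpyRetraction (mk := mk) (fun j _ => hq j) hX hc ?_ ?_
    (D.isGradedSub_longWords n) (fun a ha => D.C_mem_longWords hq ha) (D.longWords_le hq hX hn)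
  · exact Submodule.mul_le.mpr fun a _ b hb => mul_mem_longWords (Or.inr hb)
  · exact Submodule.mul_le.mpr fun a ha b _ => mul_mem_longWords (Or.inl ha)

end Upper
end Dat

end

section

open MvPolynomial

namespace Quadrics

/-- Evaluating a homogeneous polynomial at multiples of one element. -/
theorem aeval_smul {σ R : Type} [CommRing R] [Algebra ℚ R] {F : MvPolynomial σ ℚ} {n : ℕ}
    (hF : F.IsHomogeneous n) (c : σ → ℚ) (t : R) :
    aeval (fun j => c j • t) F = eval c F • t ^ n := by
  induction hF using IsWeightedHomogeneous.induction_on with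
  | zero => simp
  | add p q _ _ hp hq => rw [map_add, map_add, hp, hq, add_smul]
  | monomial d r hr =>
    rw [aeval_monomial, eval_monomial, ← hr, Finsupp.prod, Finsupp.prod, Finsupp.weight_apply,
      Finsupp.sum, ← Finset.prod_pow_eq_pow_sum]
    simp only [smul_pow, Pi.one_apply, smul_eq_mul, mul_one]
    rw [Finset.prod_smul, Algebra.algebraMap_eq_smul_one, smul_mul_assoc, one_mul, smul_smul]

/-- More homogeneous quadrics than variables satisfy a homogeneous relation. -/
theorem exists_relation {σ τ : Type} [Fintype σ] [Fintype τ] {f : τ → MvPolynomial σ ℚ}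
    (hf : ∀ j, (f j).IsHomogeneous 2) (hc : Fintype.card σ < Fintype.card τ) :
    ∃ (F : MvPolynomial τ ℚ) (n : ℕ), F.IsHomogeneous n ∧ F ≠ 0 ∧ n ≠ 0 ∧ aeval f F = 0 := by
  have hdep : ¬ AlgebraicIndependent ℚ f := by
    intro h
    have := h.cardinalMk_le_trdeg
    rw [MvPolynomial.trdeg_of_isDomain] at this
    simp at this
    omega
  rw [algebraicIndependent_iff] at hdep
  push Not at hdep
  obtain ⟨F, hF, hF0⟩ := hdep
  have hcomp : ∀ n, aeval f (homogeneousComponent n F) = 0 := by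
    intro n
    have h1 : homogeneousComponent (2 * n) (aeval f F) = aeval f (homogeneousComponent n F) := by
      conv_lhs => rw [← sum_homogeneousComponent F, map_sum, map_sum]
      rw [Finset.sum_eq_single n]
      · exact homogeneousComponent_eq_self ((homogeneousComponent_isHomogeneous n F).aeval f hf)
      · intro k _ hk
        rw [homogeneousComponent_of_mem ((homogeneousComponent_isHomogeneous k F).aeval f hf),
          if_neg (by omega)]
      · intro hn
        rw [homogeneousComponent_eq_zero n F (by simpa using hn), map_zero, map_zero]
    rw [← h1, hF, map_zero]
  obtain ⟨n, hn⟩ : ∃ n, homogeneousComponent n F ≠ 0 := by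
    by_contra! h
    apply hF0
    rw [← sum_homogeneousComponent F]
    exact Finset.sum_eq_zero fun n _ => h n
  refine ⟨_, n, homogeneousComponent_isHomogeneous n F, hn, ?_, hcomp n⟩
  rintro rfl
  have := hcomp 0
  rw [homogeneousComponent_zero, ← algebraMap_eq, AlgHom.commutes] at this
  apply hn
  rw [homogeneousComponent_zero]
  simpa using this

variable {β κ : Type} [Fintype β] [Fintype κ] (dx : β → ℕ)

/-- Restriction to the variables of a given degree. -/
def proj (g : ℕ) : MvPolynomial β ℚ →ₐ[ℚ] MvPolynomial {b // dx b = g} ℚ :=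
  aeval fun b => if h : dx b = g then X ⟨b, h⟩ else 0

/-- Inclusion of the variables of a given degree. -/
def incl (g : ℕ) : MvPolynomial {b // dx b = g} ℚ →ₐ[ℚ] MvPolynomial β ℚ := rename Subtype.val

theorem incl_proj_X (g : ℕ) (b : β) : incl dx g (proj dx g (X b)) = if dx b = g then X b else 0 := by
  rw [proj, aeval_X]
  split_ifs with h
  · rw [incl, rename_X]
  · rw [map_zero]

theorem isHomogeneous_proj {g n : ℕ} {r : MvPolynomial β ℚ} (hr : r.IsHomogeneous n) :
    (proj dx g r).IsHomogeneous n := by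
  have := hr.aeval (S := ℚ) (n := 1) (fun b => if h : dx b = g then X (⟨b, h⟩ : {b // dx b = g}) else 0)
    (fun b => by
      split_ifs with h
      · exact isHomogeneous_X _ _
      · exact isHomogeneous_zero _ _ _)
  rwa [one_mul] at this

theorem sub_incl_proj_mem {g : ℕ} {P : Ideal (MvPolynomial β ℚ)} (hP : ∀ b, dx b ≠ g → X b ∈ P)
    (r : MvPolynomial β ℚ) : r - incl dx g (proj dx g r) ∈ P := by
  have : ((Ideal.Quotient.mkₐ ℚ P).comp ((incl dx g).comp (proj dx g))) = Ideal.Quotient.mkₐ ℚ P := by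
    refine MvPolynomial.algHom_ext fun b => ?_
    simp only [AlgHom.comp_apply]
    rw [incl_proj_X]
    split_ifs with h
    · rfl
    · rw [map_zero]
      exact (Ideal.Quotient.eq_zero_iff_mem.mpr (hP b h)).symm
  rw [← Ideal.Quotient.eq_zero_iff_mem, map_sub, sub_eq_zero]
  exact (DFunLike.congr_fun this r).symm

theorem incl_proj_monomial_of_ne {g : ℕ} {s : β →₀ ℕ} {b : β} (hb : b ∈ s.support) (h : dx b ≠ g)
    (c : ℚ) : incl dx g (proj dx g (monomial s c)) = 0 := by
  rw [proj, aeval_monomial, map_mul, Finsupp.prod, map_prod,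
    Finset.prod_eq_zero hb, mul_zero]
  rw [dif_neg h, zero_pow (by simpa using hb), map_zero]

theorem incl_proj_eq_zero {g e : ℕ} (he : e ≠ 2 * g) {r : MvPolynomial β ℚ} (h2 : r.IsHomogeneous 2)
    (hw : IsWeightedHomogeneous dx r e) : incl dx g (proj dx g r) = 0 := by
  rw [r.as_sum, map_sum, map_sum]
  refine Finset.sum_eq_zero fun s hs => ?_
  have h1 := h2.degree_eq_sum_deg_support hs
  have h3 := hw (mem_support_iff.mp hs)
  obtain ⟨b, hb, hne⟩ : ∃ b ∈ s.support, dx b ≠ g := by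
    by_contra! h
    apply he
    rw [← h3, Finsupp.weight_apply, Finsupp.sum, Finset.sum_congr rfl fun b hb => by rw [h b hb],
      ← Finset.sum_smul, h1, smul_eq_mul]
  exact incl_proj_monomial_of_ne dx hb hne _

theorem incl_proj_sub_mem {g : ℕ} {P : Ideal (MvPolynomial β ℚ)} (hP : ∀ b, dx b < g → X b ∈ P)
    {r : MvPolynomial β ℚ} (h2 : r.IsHomogeneous 2) (hw : IsWeightedHomogeneous dx r (2 * g)) :
    incl dx g (proj dx g r) - r ∈ P := by
  rw [r.as_sum, map_sum, map_sum, ← Finset.sum_sub_distrib]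
  refine sum_mem fun s hs => ?_
  have h1 := h2.degree_eq_sum_deg_support hs
  have h3 := hw (mem_support_iff.mp hs)
  by_cases hall : ∀ b ∈ s.support, dx b = g
  · have : incl dx g (proj dx g (monomial s (coeff s r))) = monomial s (coeff s r) := by
      rw [proj, aeval_monomial, map_mul, Finsupp.prod, map_prod, algebraMap_eq,
        Finset.prod_congr rfl (g := fun b => (X b : MvPolynomial β ℚ) ^ s b), monomial_eq]
      · rw [incl, rename_C]; rfl
      · intro b hb
        rw [dif_pos (hall b hb), map_pow, incl, rename_X]
    rw [this, sub_self]
    exact zero_mem _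
  · push Not at hall
    obtain ⟨b, hb, hne⟩ := hall
    rw [incl_proj_monomial_of_ne dx hb hne, zero_sub, neg_mem_iff]
    obtain ⟨b', hb', hlt⟩ : ∃ b' ∈ s.support, dx b' < g := by
      by_contra! h
      rw [Finsupp.weight_apply, Finsupp.sum] at h3
      have : ∑ b ∈ s.support, s b * g < ∑ b ∈ s.support, s b * dx b := by
        refine Finset.sum_lt_sum (fun i hi => Nat.mul_le_mul_left _ (h i hi)) ⟨b, hb, ?_⟩
        exact Nat.mul_lt_mul_of_pos_left (lt_of_le_of_ne (h b hb) hne.symm)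
          (Nat.pos_of_ne_zero (by simpa using hb))
      rw [← Finset.sum_mul, ← h1] at this
      simp only [smul_eq_mul] at h3
      omega
    obtain ⟨d, hd⟩ : (X b' : MvPolynomial β ℚ) ∣ monomial s (coeff s r) := by
      rw [X_dvd_monomial]
      exact Or.inr (by simpa using hb')
    rw [hd]
    exact P.mul_mem_right _ (hP b' hlt)

/-- The marked polynomials cut out the origin in every single degree. -/
def CutsOut (q : κ → MvPolynomial β ℚ) (s : Finset κ) : Prop :=
  ∀ (g : ℕ) (P : Ideal (MvPolynomial β ℚ)), P.IsPrime → (∀ b, dx b ≠ g → X b ∈ P) →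
    (∀ j ∈ s, q j ∈ P) → ∀ b, X b ∈ P

theorem CutsOut.mem_radical {q : κ → MvPolynomial β ℚ} {s : Finset κ} (h : CutsOut dx q s)
    {e : κ → ℕ} (h2 : ∀ j, (q j).IsHomogeneous 2) (hw : ∀ j, IsWeightedHomogeneous dx (q j) (e j))
    (b : β) : (X b : MvPolynomial β ℚ) ∈ (Ideal.span (q '' s)).radical := by
  rw [Ideal.radical_eq_sInf, Submodule.mem_sInf]
  rintro P ⟨hle, hP⟩
  have hq : ∀ j ∈ s, q j ∈ P := fun j hj => hle (Ideal.subset_span ⟨j, hj, rfl⟩)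
  induction hg : dx b using Nat.strong_induction_on generalizing b with
  | _ g ih =>
    have ih' : ∀ b, dx b < g → (X b : MvPolynomial β ℚ) ∈ P := fun b hb => ih _ hb b rfl
    have := h g (Ideal.comap ((incl dx g).comp (proj dx g)) P) (Ideal.comap_isPrime _ _) (fun b hb => ?_)
      (fun j hj => ?_) b
    · rw [Ideal.mem_comap, AlgHom.comp_apply, incl_proj_X, if_pos hg] at this
      exact this
    · rw [Ideal.mem_comap, AlgHom.comp_apply, incl_proj_X, if_neg hb]
      exact zero_mem _
    · rw [Ideal.mem_comap, AlgHom.comp_apply]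
      by_cases he : e j = 2 * g
      · exact (P.sub_mem_iff_left (hq j hj)).mp (incl_proj_sub_mem dx ih' (h2 j) (he ▸ hw j))
      · rw [incl_proj_eq_zero dx he (h2 j) (hw j)]
        exact zero_mem _

theorem mem_of_ne {P : Ideal (MvPolynomial β ℚ)} {g e : ℕ} (hP : ∀ b, dx b ≠ g → X b ∈ P)
    (he : e ≠ 2 * g) {r : MvPolynomial β ℚ} (h2 : r.IsHomogeneous 2)
    (hw : IsWeightedHomogeneous dx r e) : r ∈ P := by
  have := sub_incl_proj_mem dx hP r
  rwa [incl_proj_eq_zero dx he h2 hw, sub_zero] at this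

variable [DecidableEq κ]

/-- Degreewise linear changes of a family of polynomials. -/
def Equivalent (e : κ → ℕ) (q q' : κ → MvPolynomial β ℚ) : Prop :=
  ∃ M N : Matrix κ κ ℚ, M * N = 1 ∧ N * M = 1 ∧
    (∀ i k, M i k ≠ 0 → e i = e k) ∧ (∀ i k, N i k ≠ 0 → e i = e k) ∧
    ∀ i, q' i = ∑ k, M i k • q k

theorem Equivalent.refl (e : κ → ℕ) (q : κ → MvPolynomial β ℚ) : Equivalent e q q := by
  have h : ∀ i k, (1 : Matrix κ κ ℚ) i k ≠ 0 → e i = e k := by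
    intro i k h
    by_contra hne
    exact h (Matrix.one_apply_ne fun hik => hne (congrArg e hik))
  exact ⟨1, 1, one_mul 1, one_mul 1, h, h, fun i => by simp [Matrix.one_apply]⟩

theorem mul_apply_ne {e : κ → ℕ} {M N : Matrix κ κ ℚ} (hM : ∀ i k, M i k ≠ 0 → e i = e k)
    (hN : ∀ i k, N i k ≠ 0 → e i = e k) (i k : κ) (h : (M * N) i k ≠ 0) : e i = e k := by
  rw [Matrix.mul_apply] at h
  obtain ⟨j, -, hj⟩ := Finset.exists_ne_zero_of_sum_ne_zero h
  exact (hM i j (left_ne_zero_of_mul hj)).trans (hN j k (right_ne_zero_of_mul hj))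

theorem Equivalent.trans {e : κ → ℕ} {q q' q'' : κ → MvPolynomial β ℚ} (h : Equivalent e q q')
    (h' : Equivalent e q' q'') : Equivalent e q q'' := by
  obtain ⟨M, N, h1, h2, h3, h4, h5⟩ := h
  obtain ⟨M', N', h1', h2', h3', h4', h5'⟩ := h'
  refine ⟨M' * M, N * N', ?_, ?_, mul_apply_ne h3' h3, mul_apply_ne h4 h4', fun i => ?_⟩
  · rw [mul_assoc, ← mul_assoc M, h1, one_mul, h1']
  · rw [mul_assoc, ← mul_assoc N', h2', one_mul, h2]
  · simp only [h5', h5, Matrix.mul_apply, Finset.sum_smul, Finset.smul_sum, smul_smul]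
    exact Finset.sum_comm

theorem equivalent_shear {e : κ → ℕ} (q : κ → MvPolynomial β ℚ) (t : κ → ℚ) {l : κ} (hl : t l = 0)
    (ht : ∀ j, t j ≠ 0 → e j = e l) : Equivalent e q fun j => q j - t j • q l := by
  let T : Matrix κ κ ℚ := Matrix.vecMulVec t (Pi.single l 1)
  have hT : T * T = 0 := by
    rw [Matrix.vecMulVec_mul_vecMulVec]
    simp [hl]
  have hTe : ∀ i k, T i k ≠ 0 → e i = e k := by
    intro i k h
    simp only [T, Matrix.vecMulVec_apply] at h
    have hk : k = l := by
      by_contra hk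
      exact right_ne_zero_of_mul h (Pi.single_eq_of_ne hk 1)
    rw [hk]
    exact ht i (left_ne_zero_of_mul h)
  have h1 : ∀ i k, (1 : Matrix κ κ ℚ) i k ≠ 0 → e i = e k := by
    intro i k h
    by_contra hne
    exact h (Matrix.one_apply_ne fun hik => hne (congrArg e hik))
  refine ⟨1 - T, 1 + T, by noncomm_ring [hT], by noncomm_ring [hT], ?_, ?_, ?_⟩
  · intro i k h
    by_contra hne
    have ha : (1 : Matrix κ κ ℚ) i k = 0 := by_contra fun h => hne (h1 _ _ h)
    have hb : T i k = 0 := by_contra fun h => hne (hTe _ _ h)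
    exact h (by rw [Matrix.sub_apply, ha, hb, sub_zero])
  · intro i k h
    by_contra hne
    have ha : (1 : Matrix κ κ ℚ) i k = 0 := by_contra fun h => hne (h1 _ _ h)
    have hb : T i k = 0 := by_contra fun h => hne (hTe _ _ h)
    exact h (by rw [Matrix.add_apply, ha, hb, add_zero])
  · intro i
    simp only [Matrix.sub_apply, sub_smul, Finset.sum_sub_distrib, T, Matrix.vecMulVec_apply]
    simp [Matrix.one_apply, Pi.single_apply]

theorem Equivalent.isHomogeneous {e : κ → ℕ} {q q' : κ → MvPolynomial β ℚ} (h : Equivalent e q q')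
    (h2 : ∀ j, (q j).IsHomogeneous 2) (j : κ) : (q' j).IsHomogeneous 2 := by
  obtain ⟨M, N, -, -, -, -, h5⟩ := h
  rw [h5]
  exact sum_mem (S := homogeneousSubmodule β ℚ 2) fun k _ => Submodule.smul_mem _ _ (h2 k)

theorem Equivalent.isWeightedHomogeneous {e : κ → ℕ} {q q' : κ → MvPolynomial β ℚ}
    (h : Equivalent e q q') (hw : ∀ j, IsWeightedHomogeneous dx (q j) (e j)) (j : κ) :
    IsWeightedHomogeneous dx (q' j) (e j) := by
  obtain ⟨M, N, -, -, h3, -, h5⟩ := h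
  rw [h5]
  refine sum_mem (S := weightedHomogeneousSubmodule ℚ dx (e j)) fun k _ => ?_
  by_cases hM : M j k = 0
  · rw [hM, zero_smul]; exact zero_mem _
  · rw [h3 _ _ hM]
    exact Submodule.smul_mem _ _ (hw k)

theorem exists_reduction {q : κ → MvPolynomial β ℚ} {s : Finset κ} (h : CutsOut dx q s)
    {e : κ → ℕ} (h2 : ∀ j, (q j).IsHomogeneous 2) (hw : ∀ j, IsWeightedHomogeneous dx (q j) (e j))
    (hc : Fintype.card β < s.card) :
    ∃ q' s', Equivalent e q q' ∧ CutsOut dx q' s' ∧ s'.card < s.card := by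
  by_cases hodd : ∃ j ∈ s, ∀ g, e j ≠ 2 * g
  · obtain ⟨j, hj, hne⟩ := hodd
    refine ⟨q, s.erase j, Equivalent.refl e q, fun g P hP hX hq => h g P hP hX fun i hi => ?_,
      Finset.card_erase_lt_of_mem hj⟩
    by_cases hij : i = j
    · exact hij ▸ mem_of_ne dx hX (hne g) (h2 j) (hw j)
    · exact hq i (Finset.mem_erase.mpr ⟨hij, hi⟩)
  push Not at hodd
  obtain ⟨g, hg⟩ : ∃ g, Fintype.card {b // dx b = g} < Fintype.card {j // j ∈ s ∧ e j = 2 * g} := by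
    by_contra! hle
    have h1 : s.card = ∑ g ∈ s.image (fun j => e j / 2), (s.filter fun j => e j / 2 = g).card :=
      Finset.card_eq_sum_card_image _ _
    have h3 : ∀ g ∈ s.image (fun j => e j / 2), (s.filter fun j => e j / 2 = g).card ≤
        (Finset.univ.filter fun b => dx b = g).card := by
      intro g _
      refine le_trans (le_of_eq ?_) ((hle g).trans_eq (Fintype.card_subtype _))
      rw [Fintype.card_subtype]
      congr 1
      ext j
      simp only [Finset.mem_filter, Finset.mem_univ, true_and]
      refine and_congr_right fun hj => ?_
      obtain ⟨g', hg'⟩ := hodd j hj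
      omega
    have h4 : ∑ g ∈ s.image (fun j => e j / 2), (Finset.univ.filter fun b => dx b = g).card ≤
        Fintype.card β := by
      classical
      rw [← Finset.card_biUnion]
      · exact Finset.card_le_univ _
      · intro a _ b _ hab
        rw [Function.onFun, Finset.disjoint_filter]
        rintro c - rfl h
        exact hab h
    have := Finset.sum_le_sum h3
    omega
  obtain ⟨F, n, hF, hF0, hn, hFq⟩ := exists_relation
    (f := fun j : {j // j ∈ s ∧ e j = 2 * g} => proj dx g (q j))
    (fun j => isHomogeneous_proj dx (h2 j)) hg
  obtain ⟨c, hcF⟩ : ∃ c, eval c F ≠ 0 := by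
    by_contra! h
    exact hF0 (MvPolynomial.funext fun x => by rw [h, map_zero])
  obtain ⟨l, hl⟩ : ∃ l, c l ≠ 0 := by
    by_contra! h
    apply hcF
    have : c = 0 := _root_.funext h
    rw [this, MvPolynomial.eval_zero, constantCoeff_eq]
    exact hF.coeff_eq_zero (by simpa using hn.symm)
  let t : κ → ℚ := fun j => if h : (j ∈ s ∧ e j = 2 * g) ∧ j ≠ l.1 then c ⟨j, h.1⟩ / c l else 0
  have ht : ∀ j : {j // j ∈ s ∧ e j = 2 * g}, j ≠ l → t j = c j / c l := fun j hj =>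
    dif_pos ⟨j.2, fun h => hj (Subtype.ext h)⟩
  refine ⟨_, s.erase l, equivalent_shear (l := l.1) q t (dif_neg fun h => h.2 rfl) ?_, ?_,
    Finset.card_erase_lt_of_mem l.2.1⟩
  · intro j hj
    by_cases hj' : (j ∈ s ∧ e j = 2 * g) ∧ j ≠ l.1
    · rw [hj'.1.2, l.2.2]
    · exact absurd (dif_neg hj') hj
  · intro g' P hP hX hq
    have key : q l ∈ P → ∀ b, X b ∈ P := fun hlP => h g' P hP hX fun j hj => by
      by_cases hjl : j = l
      · rw [hjl]; exact hlP
      · have := add_mem (hq j (Finset.mem_erase.mpr ⟨hjl, hj⟩))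
          (P.mul_mem_left (C (t j)) hlP)
        rwa [← smul_eq_C_mul, sub_add_cancel] at this
    apply key
    by_cases hgg : g' = g
    · subst hgg
      let m := Ideal.Quotient.mkₐ ℚ P
      have hm : ∀ r, m r = m (incl dx g' (proj dx g' r)) := fun r => by
        rw [← sub_eq_zero, ← map_sub]
        exact Ideal.Quotient.eq_zero_iff_mem.mpr (sub_incl_proj_mem dx hX r)
      have hml : ∀ j : {j // j ∈ s ∧ e j = 2 * g'}, m (q j) = c j • ((c l)⁻¹ • m (q l)) := by
        intro j
        by_cases hj : j = l
        · rw [hj, smul_smul, mul_inv_cancel₀ hl, one_smul]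
        · have := hq j (Finset.mem_erase.mpr ⟨fun h => hj (Subtype.ext h), j.2.1⟩)
          have h0 : m (q j - t j • q l) = 0 := Ideal.Quotient.eq_zero_iff_mem.mpr this
          rw [map_sub, map_smul, sub_eq_zero] at h0
          rw [h0, ht j hj, smul_smul, div_eq_mul_inv]
      have h0 := congrArg (m.comp (incl dx g')) hFq
      rw [map_zero, ← AlgHom.comp_apply, comp_aeval] at h0
      have hfun : (fun j : {j // j ∈ s ∧ e j = 2 * g'} => (m.comp (incl dx g')) (proj dx g' (q j))) =
          fun j => c j • ((c l)⁻¹ • m (q l)) := _root_.funext fun j => (hm _).symm.trans (hml j)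
      rw [hfun, aeval_smul hF] at h0
      have h5 : ((c l)⁻¹ • m (q l)) ^ n = 0 := by
        simpa only [smul_smul, inv_mul_cancel₀ hcF, one_smul, smul_zero] using
          congrArg (fun a => (eval c F)⁻¹ • a) h0
      have h6 := congrArg (fun a => c l • a) (pow_eq_zero_iff hn |>.mp h5)
      simp only [smul_smul, mul_inv_cancel₀ hl, one_smul, smul_zero] at h6
      exact Ideal.Quotient.eq_zero_iff_mem.mp h6
    · exact mem_of_ne dx hX (by rw [l.2.2]; omega) (h2 l) (hw l)

/-- Degreewise linear changes make a small subfamily cut out the origin. -/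
theorem exists_marking {q : κ → MvPolynomial β ℚ} {e : κ → ℕ} (h2 : ∀ j, (q j).IsHomogeneous 2)
    (hw : ∀ j, IsWeightedHomogeneous dx (q j) (e j))
    (hX : ∀ b, (X b : MvPolynomial β ℚ) ∈ (Ideal.span (Set.range q)).radical) :
    ∃ (q' : κ → MvPolynomial β ℚ) (s : Finset κ), Equivalent e q q' ∧ s.card ≤ Fintype.card β ∧
      ∀ b, (X b : MvPolynomial β ℚ) ∈ (Ideal.span (Set.range fun j : {j // j ∈ s} => q' j)).radical := by
  have key : ∀ (n : ℕ) (q : κ → MvPolynomial β ℚ) (s : Finset κ), s.card = n →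
      (∀ j, (q j).IsHomogeneous 2) → (∀ j, IsWeightedHomogeneous dx (q j) (e j)) →
      CutsOut dx q s → ∃ q' s', Equivalent e q q' ∧ CutsOut dx q' s' ∧ s'.card ≤ Fintype.card β := by
    intro n
    induction n using Nat.strong_induction_on with
    | _ n ih =>
      intro q s hs h2 hw h
      by_cases hc : s.card ≤ Fintype.card β
      · exact ⟨q, s, Equivalent.refl e q, h, hc⟩
      obtain ⟨q1, s1, h1, h1', hlt⟩ := exists_reduction dx h h2 hw (not_le.mp hc)
      obtain ⟨q', s', h3, h4, h5⟩ := ih _ (hs ▸ hlt) q1 s1 rfl (h1.isHomogeneous h2)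
        (h1.isWeightedHomogeneous dx hw) h1'
      exact ⟨q', s', h1.trans h3, h4, h5⟩
  obtain ⟨q', s, h1, h3, h4⟩ := key _ q Finset.univ rfl h2 hw fun g P hP _ hq b => by
    have : Ideal.span (Set.range q) ≤ P :=
      Ideal.span_le.mpr (by rintro _ ⟨j, rfl⟩; exact hq j (Finset.mem_univ j))
    exact (hP.radical_le_iff.mpr this) (hX b)
  refine ⟨q', s, h1, h4, fun b => ?_⟩
  have := h3.mem_radical dx (h1.isHomogeneous h2) (h1.isWeightedHomogeneous dx hw) b
  rwa [Set.image_eq_range] at this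

end Quadrics

end

section

open MvPolynomial

namespace KA

theorem coeff_euler {β : Type} (w : β → ℕ) (r : MvPolynomial β ℚ) (d : β →₀ ℕ) :
    coeff d (mkDerivation ℚ (fun b => (w b : ℚ) • (X b : MvPolynomial β ℚ)) r) =
      (Finsupp.weight w d : ℚ) * coeff d r := by
  classical
  induction r using MvPolynomial.induction_on' with
  | add p q hp hq => rw [map_add, coeff_add, coeff_add, hp, hq, mul_add]
  | monomial s c =>
    have h : mkDerivation ℚ (fun b => (w b : ℚ) • (X b : MvPolynomial β ℚ)) (monomial s c) =
        (Finsupp.weight w s : ℚ) • monomial s c := by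
      rw [mkDerivation_monomial, Finsupp.weight_apply, Finsupp.sum, Finsupp.sum, Nat.cast_sum,
        Finset.sum_smul, Finset.smul_sum]
      refine Finset.sum_congr rfl fun i hi => ?_
      have hi' : Finsupp.single i 1 ≤ s := by
        rw [Finsupp.single_le_iff]
        exact Nat.one_le_iff_ne_zero.mpr (Finsupp.mem_support_iff.mp hi)
      rw [smul_eq_mul, mul_smul_comm, X, monomial_mul, tsub_add_cancel_of_le hi', smul_monomial,
        smul_monomial, smul_monomial]
      congr 1
      simp only [smul_eq_mul, Nat.cast_mul]
      ring
    rw [h, coeff_smul, coeff_monomial]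
    split_ifs with hs
    · rw [hs, smul_eq_mul]
    · simp

variable {β o : Type} [Fintype o]

theorem isWeightedHomogeneous_of_pol_mem_G {w : β → ℕ} {v : o → ℚ} {r : MvPolynomial β ℚ} {n : ℕ}
    (h : (pol r : KA β o) ∈ G (fun b => (w b : ℚ)) v n) : IsWeightedHomogeneous w r n := by
  intro d hd
  rw [mem_G, NW_pol, ← map_smul] at h
  have := congrArg (coeff d) (pol_injective h)
  rw [coeff_euler, coeff_smul, smul_eq_mul] at this
  exact_mod_cast mul_right_cancel₀ hd this

end KA

/-- Elements of a given word length. -/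
def words (β κ : Type) [Fintype κ] (k : ℕ) : Submodule ℚ (KA β κ) :=
  KA.G (fun _ => ((1 : ℕ) : ℚ)) (fun _ => ((1 : ℕ) : ℚ)) (k : ℚ)

theorem words_isGenGraded (β κ : Type) [Fintype κ] :
    IsGenGraded (words β κ) (Set.range (KA.x : β → KA β κ) ∪ Set.range KA.y) :=
  KA.isGenGraded_nat _ _

/-- An identification of a minimal Sullivan model with a pure free model. -/
structure Presentation {A : Type} [GCDGA A] (S : MinimalSullivan A) {β κ : Type} [Fintype κ]
    (D : Dat β κ) where
  e : KA β κ ≃ₐ[ℚ] A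
  comm : ∀ a, e (KA.C D.q a) = Dd A (e a)
  gr : ∀ n a, e a ∈ Gr A n ↔ a ∈ D.gr n
  lam : ∀ k a, e a ∈ S.lam k ↔ a ∈ words β κ k

namespace MinimalSullivan

variable {A : Type} [GCDGA A] (S : MinimalSullivan A)

theorem finite_ne_bot [FiniteDimensional ℚ (⨆ n, S.V n : Submodule ℚ A)] :
    Finite {n // S.V n ≠ ⊥} := by
  have hind : iSupIndep S.V := (iSupIndep_Gr A).mono S.V_le
  choose v hv hv0 using fun i : {n // S.V n ≠ ⊥} => Submodule.exists_mem_ne_zero_of_ne_bot i.2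
  have h1 : LinearIndependent ℚ v :=
    (hind.comp Subtype.val_injective).linearIndependent _ hv hv0
  let u : {n // S.V n ≠ ⊥} → (⨆ n, S.V n : Submodule ℚ A) := fun i =>
    ⟨v i, Submodule.mem_iSup_of_mem i.1 (hv i)⟩
  have h2 : LinearIndependent ℚ u := LinearIndependent.of_comp (Submodule.subtype _) h1
  exact h2.finite

instance finiteDimensional_V (n : ℕ) : FiniteDimensional ℚ (S.V n) := S.V_fin n

/-- Indices of a basis for generators in the degrees `f n`. -/
abbrev Index (f : ℕ → ℕ) : Type := Σ n : ℕ, Fin (Module.finrank ℚ (S.V (f n)))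

theorem finite_index [FiniteDimensional ℚ (⨆ n, S.V n : Submodule ℚ A)] {f : ℕ → ℕ}
    (hf : Function.Injective f) : Finite (S.Index f) := by
  have := S.finite_ne_bot
  have hne : ∀ b : S.Index f, S.V (f b.1) ≠ ⊥ := fun b h => by
    have h0 : Module.finrank ℚ (S.V (f b.1)) = 0 := Submodule.finrank_eq_zero.mpr h
    exact (Fin.cast h0 b.2).elim0
  have : Finite {n // S.V (f n) ≠ ⊥} :=
    Finite.of_injective (fun n => (⟨f n.1, n.2⟩ : {n // S.V n ≠ ⊥})) fun a b h =>
      Subtype.ext (hf (congrArg Subtype.val h))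
  refine Finite.of_injective (fun b : S.Index f =>
    (⟨⟨b.1, hne b⟩, b.2⟩ : Σ n : {n // S.V (f n) ≠ ⊥}, Fin (Module.finrank ℚ (S.V (f n.1))))) ?_
  rintro ⟨n, i⟩ ⟨m, j⟩ h
  simp only [Sigma.mk.injEq, Subtype.mk.injEq] at h ⊢
  exact h

/-- Basis elements of the space of generators. -/
def basisElt (f : ℕ → ℕ) (b : S.Index f) : A := (Module.finBasis ℚ (S.V (f b.1)) b.2 : S.V (f b.1))

theorem basisElt_mem (f : ℕ → ℕ) (b : S.Index f) : S.basisElt f b ∈ S.V (f b.1) :=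
  Subtype.property _

theorem V_le_span (f : ℕ → ℕ) (n : ℕ) :
    S.V (f n) ≤ Submodule.span ℚ (Set.range (S.basisElt f)) := by
  intro v hv
  have h := (Module.finBasis ℚ (S.V (f n))).sum_repr ⟨v, hv⟩
  have h' := congrArg (S.V (f n)).subtype h
  rw [map_sum] at h'
  have h2 : v = ∑ i, (S.V (f n)).subtype (((Module.finBasis ℚ (S.V (f n))).repr ⟨v, hv⟩) i •
    (Module.finBasis ℚ (S.V (f n))) i) := h'.symm
  rw [h2]
  refine Submodule.sum_mem _ fun i _ => ?_
  rw [map_smul]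
  exact Submodule.smul_mem _ _ (Submodule.subset_span ⟨⟨n, i⟩, rfl⟩)

/-- Free extension of prescribed values on bases of the even and odd generators. -/
theorem exists_extension (B : Type) [GCDGA B] (p : S.Index (fun n => 2 * n) → B)
    (r : S.Index (fun n => 2 * n + 1) → B) (hp : ∀ b, p b ∈ Gr B (2 * b.1))
    (hr : ∀ b, r b ∈ Gr B (2 * b.1 + 1)) :
    ∃ g : A →ₐ[ℚ] B, (∀ (i : ℕ) (a : A), a ∈ Gr A i → g a ∈ Gr B i) ∧
      (∀ b, g (S.basisElt _ b) = p b) ∧ ∀ b, g (S.basisElt _ b) = r b := by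
  have key : ∀ n, ∃ h : S.V n →ₗ[ℚ] B, (∀ v, h v ∈ Gr B n) ∧
      (∀ m (hm : 2 * m = n) i, h ⟨S.basisElt (fun n => 2 * n) ⟨m, i⟩,
        hm ▸ S.basisElt_mem (fun n => 2 * n) ⟨m, i⟩⟩ = p ⟨m, i⟩) ∧
      ∀ m (hm : 2 * m + 1 = n) i, h ⟨S.basisElt (fun n => 2 * n + 1) ⟨m, i⟩,
        hm ▸ S.basisElt_mem (fun n => 2 * n + 1) ⟨m, i⟩⟩ = r ⟨m, i⟩ := by
    intro n
    have hle : ∀ {n : ℕ} (c : Fin (Module.finrank ℚ (S.V n)) → B) (hc : ∀ i, c i ∈ Gr B n) (v),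
        (Module.finBasis ℚ (S.V n)).constr ℚ c v ∈ Gr B n := fun c hc v => by
      rw [Module.Basis.constr_apply_fintype]
      exact Submodule.sum_mem _ fun i _ => Submodule.smul_mem _ _ (hc i)
    obtain ⟨k, rfl | rfl⟩ := Nat.even_or_odd' n
    · refine ⟨(Module.finBasis ℚ (S.V (2 * k))).constr ℚ fun i => p ⟨k, i⟩,
        hle _ fun i => hp ⟨k, i⟩, ?_, fun m hm => by omega⟩
      intro m hm i
      obtain rfl : m = k := by omega
      exact Module.Basis.constr_basis _ _ _ _
    · refine ⟨(Module.finBasis ℚ (S.V (2 * k + 1))).constr ℚ fun i => r ⟨k, i⟩,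
        hle _ fun i => hr ⟨k, i⟩, fun m hm => by omega, ?_⟩
      intro m hm i
      obtain rfl : m = k := by omega
      exact Module.Basis.constr_basis _ _ _ _
  choose h h1 h2 h3 using key
  obtain ⟨g, ⟨g1, g2⟩, -⟩ := S.free B h h1
  exact ⟨g, g1, fun b => (g2 _ ⟨_, S.basisElt_mem _ b⟩).trans (h2 _ _ rfl _),
    fun b => (g2 _ ⟨_, S.basisElt_mem _ b⟩).trans (h3 _ _ rfl _)⟩

/-- A graded endomorphism fixing the basis elements is the identity. -/
theorem eq_id (g : A →ₐ[ℚ] A) (hg : ∀ (i : ℕ) (a : A), a ∈ Gr A i → g a ∈ Gr A i)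
    (hx : ∀ b, g (S.basisElt (fun n => 2 * n) b) = S.basisElt _ b)
    (hy : ∀ b, g (S.basisElt (fun n => 2 * n + 1) b) = S.basisElt _ b) : g = AlgHom.id ℚ A := by
  obtain ⟨_, -, huniq⟩ := S.free A (fun n => (S.V n).subtype) fun n v => S.V_le n v.2
  refine (huniq g ⟨hg, fun n v => ?_⟩).trans (huniq (AlgHom.id ℚ A) ⟨fun _ _ h => h, fun _ _ => rfl⟩).symm
  have hspan : ∀ f : ℕ → ℕ, (∀ b, g (S.basisElt f b) = S.basisElt f b) → ∀ n, ∀ v ∈ S.V (f n), g v = v := by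
    intro f hf n v hv
    refine Submodule.span_induction (p := fun v _ => g v = v) ?_ (map_zero g) ?_ ?_ (S.V_le_span f n hv)
    · rintro _ ⟨b, rfl⟩
      exact hf b
    · intro a b _ _ ha hb
      rw [map_add, ha, hb]
    · intro c a _ ha
      rw [map_smul, ha]
  obtain ⟨k, rfl | rfl⟩ := Nat.even_or_odd' n
  · exact hspan (fun n => 2 * n) hx k v v.2
  · exact hspan (fun n => 2 * n + 1) hy k v v.2

end MinimalSullivan

end

section

open MvPolynomial

namespace MinimalSullivan

variable {A : Type} [GCDGA A] (S : MinimalSullivan A)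

/-- A pure coformal model with finitely many generators is a pure free model. -/
theorem exists_presentation (hp : S.Pure) (hc : S.Coformal) (he : Elliptic A S) :
    ∃ (β κ : Type) (_ : Fintype β) (_ : Fintype κ) (D : Dat β κ),
      Nonempty (Presentation S D) ∧ ∀ j, (D.q j).IsHomogeneous 2 := by
  have := he.1
  let β := S.Index (fun n => 2 * n)
  let κ := S.Index (fun n => 2 * n + 1)
  have : Finite β := S.finite_index fun a b h => by simpa using h
  have : Finite κ := S.finite_index fun a b h => by simpa using h
  have : Fintype β := Fintype.ofFinite β
  have : Fintype κ := Fintype.ofFinite κ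
  let D₀ : Dat β κ := ⟨fun b => b.1, fun j => j.1, 0, fun j => by
    rw [Pi.zero_apply, map_zero]; exact zero_mem _⟩
  have hfx : ∀ b : β, S.basisElt _ b ∈ Gr A (2 * D₀.dx b) := fun b => S.V_le _ (S.basisElt_mem _ b)
  have hgy : ∀ j : κ, S.basisElt _ j ∈ Gr A (2 * D₀.dy j + 1) := fun j => S.V_le _ (S.basisElt_mem _ j)
  let Φ : KA β κ →ₐ[ℚ] A := D₀.liftHom (S.basisElt _) (S.basisElt _) hfx hgy
  have hΦx : ∀ b, Φ (KA.x b) = S.basisElt _ b := fun b => D₀.liftHom_x hfx hgy b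
  have hΦy : ∀ j, Φ (KA.y j) = S.basisElt _ j := fun j => D₀.liftHom_y hfx hgy j
  have hΦgr : ∀ n a, a ∈ D₀.gr n → Φ a ∈ Gr A n := by
    refine D₀.isGenGraded.map_mem (one_mem_Gr A) (fun i j a b => mul_mem_Gr) Φ ?_
    rintro _ (⟨b, rfl⟩ | ⟨j, rfl⟩)
    · exact ⟨_, D₀.x_mem b, by rw [hΦx]; exact hfx b⟩
    · exact ⟨_, D₀.y_mem j, by rw [hΦy]; exact hgy j⟩
  have hone : ∀ {f : ℕ → ℕ} (b : S.Index f), S.basisElt f b ∈ S.lam 1 := fun {f} b => by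
    rw [S.lam_one]
    exact Submodule.mem_iSup_of_mem (f b.1) (S.basisElt_mem f b)
  have hΦlam : ∀ k a, a ∈ words β κ k → Φ a ∈ S.lam k := by
    refine (words_isGenGraded β κ).map_mem ?_ (fun i j a b ha hb => ?_) Φ ?_
    · rw [S.lam_zero]; exact Submodule.one_le.mp le_rfl
    · exact S.lam_mul i j (Submodule.mul_mem_mul ha hb)
    rintro _ (⟨b, rfl⟩ | ⟨j, rfl⟩)
    · exact ⟨1, KA.x_mem_G _ _ b, by rw [hΦx]; exact hone b⟩
    · exact ⟨1, KA.y_mem_G _ _ j, by rw [hΦy]; exact hone j⟩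
  obtain ⟨Ψ', hΨgr, hΨx, hΨy⟩ := S.exists_extension D₀.Model (fun b => D₀.toModel (KA.x b))
    (fun j => D₀.toModel (KA.y j)) D₀.x_mem D₀.y_mem
  let Ψ : A →ₐ[ℚ] KA β κ := D₀.toModel.symm.toAlgHom.comp Ψ'
  have hΨΦ : Ψ.comp Φ = AlgHom.id ℚ _ := KA.algHom_ext
    (fun b => by
      change Ψ (Φ _) = _
      rw [hΦx]
      exact hΨx b)
    (fun j => by
      change Ψ (Φ _) = _
      rw [hΦy]
      exact hΨy j)
  have hΦΨ : Φ.comp Ψ = AlgHom.id ℚ A := S.eq_id _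
    (fun i a ha => hΦgr i _ (hΨgr i a ha))
    (fun b => by
      have : Ψ (S.basisElt _ b) = KA.x b := hΨx b
      change Φ (Ψ _) = _
      rw [this, hΦx])
    (fun j => by
      have : Ψ (S.basisElt _ j) = KA.y j := hΨy j
      change Φ (Ψ _) = _
      rw [this, hΦy])
  let e : KA β κ ≃ₐ[ℚ] A := AlgEquiv.ofAlgHom Φ Ψ hΦΨ hΨΦ
  have hgr : ∀ n a, e a ∈ Gr A n ↔ a ∈ D₀.gr n := fun n a => by
    refine ⟨fun h => ?_, hΦgr n a⟩
    have := hΨgr n _ h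
    have h2 : Ψ (Φ a) = a := DFunLike.congr_fun hΨΦ a
    have h3 : Ψ (Φ a) ∈ D₀.gr n := this
    rwa [h2] at h3
  have hlam : ∀ k a, e a ∈ S.lam k ↔ a ∈ words β κ k := fun k a => by
    refine ⟨fun h => ?_, hΦlam k a⟩
    have hle := eq_of_le_of_iSup_eq_top (G := S.lam)
      (G' := fun k => (words β κ k).map Φ.toLinearMap) S.lam_internal.submodule_iSupIndep
      (fun k => Submodule.map_le_iff_le_comap.mpr (hΦlam k)) (by
        rw [← Submodule.map_iSup, (words_isGenGraded β κ).iSup_eq_top, Submodule.map_top,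
          LinearMap.range_eq_top]
        exact e.surjective) k h
    obtain ⟨b, hb, hbe⟩ := hle
    rwa [e.injective (show e b = e a from hbe)] at hb
  have hq : ∀ j : κ, ∃ q : MvPolynomial β ℚ, Φ (KA.pol q) = Dd A (S.basisElt _ j) := by
    intro j
    have h1 : Dd A (S.basisElt _ j) ∈ Algebra.adjoin ℚ (S.Veven : Set A) :=
      hp.2 _ (Submodule.mem_iSup_of_mem j.1 (S.basisElt_mem _ j))
    have h2 : Algebra.adjoin ℚ (S.Veven : Set A) ≤ (Φ.comp KA.pol).range := by
      refine Algebra.adjoin_le fun v hv => ?_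
      have : S.Veven ≤ Subalgebra.toSubmodule (Φ.comp KA.pol).range := by
        refine iSup_le fun n => (S.V_le_span (fun n => 2 * n) n).trans (Submodule.span_le.mpr ?_)
        rintro _ ⟨b, rfl⟩
        exact ⟨X b, hΦx b⟩
      exact this hv
    exact h2 h1
  choose q hq using hq
  have hqgr : ∀ j, KA.pol (q j) ∈ D₀.gr (2 * D₀.dy j + 2) := fun j => by
    refine (hgr _ _).mp ?_
    change Φ (KA.pol (q j)) ∈ Gr A _
    rw [hq]
    exact Dd_mem_Gr (hgy j)
  let D : Dat β κ := ⟨D₀.dx, D₀.dy, q, hqgr⟩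
  have hdga := D.isDGAHom_of_gen Φ (fun b => by rw [hΦx]; exact hfx b)
    (fun j => by rw [hΦy]; exact hgy j)
    (fun b => by
      rw [hΦx]
      exact hp.1 _ (Submodule.mem_iSup_of_mem b.1 (S.basisElt_mem (fun n => 2 * n) b)))
    (fun j => by rw [hΦy]; exact (hq j).symm)
  refine ⟨β, κ, inferInstance, inferInstance, D, ⟨⟨e, hdga.1, hgr, hlam⟩⟩, fun j => ?_⟩
  refine KA.isWeightedHomogeneous_of_pol_mem_G (o := κ) (v := fun _ => ((1 : ℕ) : ℚ)) ?_
  refine (hlam 2 _).mp ?_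
  change Φ (KA.pol (q j)) ∈ S.lam 2
  rw [hq]
  exact hc _ _ (S.basisElt_mem _ j)

end MinimalSullivan

section

variable {A : Type} [GCDGA A] {S : MinimalSullivan A} {β κ : Type} [Fintype κ] {D : Dat β κ}

/-- Finite-dimensional cohomology forces the differentials to cut out the origin. -/
theorem Presentation.mem_radical (p : Presentation S D) (hq : ∀ j, (D.q j).IsHomogeneous 2)
    (hfin : FiniteDimensional ℚ (CohClasses A)) (b : β) :
    (X b : MvPolynomial β ℚ) ∈ (Ideal.span (Set.range D.q)).radical := by
  let I := Ideal.span (Set.range D.q)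
  let z : ℕ → LinearMap.ker (Dd A) := fun k => ⟨p.e (KA.pol (X b ^ k)), by
    rw [LinearMap.mem_ker, ← p.comm, KA.C_pol, map_zero]⟩
  let cl : LinearMap.ker (Dd A) →ₗ[ℚ] CohClasses A := Submodule.mkQ _
  have hdep : ¬ LinearIndependent ℚ fun k => cl (z k) := fun h => by
    have := h.finite
    exact not_finite ℕ
  rw [not_linearIndependent_iff] at hdep
  obtain ⟨s, c, hsum, i, hi, hci⟩ := hdep
  have h1 : ∑ k ∈ s, c k • z k ∈
      (LinearMap.range (Dd A)).comap (LinearMap.ker (Dd A)).subtype := by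
    rw [← Submodule.Quotient.mk_eq_zero]
    refine Eq.trans ?_ hsum
    simp only [← map_smul, ← map_sum]
    rfl
  obtain ⟨a, ha⟩ := h1
  obtain ⟨a, rfl⟩ := p.e.surjective a
  rw [← p.comm] at ha
  have h2 : p.e (KA.C D.q a) = p.e (KA.pol (∑ k ∈ s, c k • X b ^ k)) := by
    rw [ha, map_sum, map_sum, map_sum]
    refine Finset.sum_congr rfl fun k _ => ?_
    rw [map_smul, map_smul, map_smul]
    rfl
  have h3 : (∑ k ∈ s, c k • X b ^ k : MvPolynomial β ℚ) ∈ I := by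
    have := KA.eps_C_mem D.q a
    rwa [p.e.injective h2, KA.eps_pol] at this
  let := gradedAlgebra (σ := β) (R := ℚ)
  have hI : I.IsHomogeneous (homogeneousSubmodule β ℚ) := by
    refine Ideal.homogeneous_span _ _ ?_
    rintro _ ⟨j, rfl⟩
    exact ⟨2, hq j⟩
  have h4 := homogeneousComponent_mem_of_mem hI h3 i
  have h5 : homogeneousComponent i (∑ k ∈ s, c k • X b ^ k : MvPolynomial β ℚ) = c i • X b ^ i := by
    rw [map_sum, Finset.sum_eq_single_of_mem i hi]
    · rw [map_smul, homogeneousComponent_eq_self (by simpa using (isHomogeneous_X ℚ b).pow i)]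
    · intro k _ hk
      rw [map_smul, homogeneousComponent_of_mem (n := k)
        (show X b ^ k ∈ homogeneousSubmodule β ℚ k by simpa using (isHomogeneous_X ℚ b).pow k),
        if_neg (Ne.symm hk), smul_zero]
  rw [h5, smul_eq_C_mul] at h4
  refine ⟨i, ?_⟩
  have := I.mul_mem_left (C (c i)⁻¹) h4
  rwa [← mul_assoc, ← map_mul, inv_mul_cancel₀ hci, map_one, one_mul] at this

end

end

section

open MvPolynomial

namespace KA

variable {β κ : Type} [Fintype κ] [DecidableEq κ]

/-- The endomorphism applying a matrix to the odd generators. -/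
def shear (β : Type) (M : Matrix κ κ ℚ) : KA β κ →ₐ[ℚ] KA β κ :=
  linMap X fun j k => MvPolynomial.C (M j k)

theorem shear_comp {M N : Matrix κ κ ℚ} (h : M * N = 1) :
    (shear β N).comp (shear β M) = AlgHom.id ℚ _ := by
  refine algHom_ext (fun b => ?_) fun j => ?_
  · change shear β N (shear β M (x b)) = x b
    unfold shear
    rw [linMap_x]
    exact linMap_x _ _ b
  · change shear β N (shear β M (y j)) = y j
    unfold shear
    rw [linMap_y, linMap_lin, ← lin_single j]
    congr 1
    funext k
    simp only [algHom_C, algebraMap_eq, ← map_mul, ← map_sum]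
    rw [← Matrix.mul_apply, h, Matrix.one_apply, Pi.single_apply]
    by_cases hjk : j = k
    · simp [hjk]
    · simp [hjk, Ne.symm hjk]

theorem shear_mem_G {M : Matrix κ κ ℚ} {w : β → ℚ} {v : κ → ℚ} (h : ∀ j k, M j k ≠ 0 → v j = v k)
    {g : ℚ} {a : KA β κ} (ha : a ∈ G w v g) : shear β M a ∈ G w v g :=
  linMap_mem_G (fun b => x_mem_G _ _ b) (fun j k => by
    by_cases hjk : M j k = 0
    · rw [hjk, map_zero, map_zero]; exact zero_mem _
    · rw [h j k hjk, sub_self]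
      have : (pol (MvPolynomial.C (M j k)) : KA β κ) = M j k • 1 := by
        rw [← mul_one (MvPolynomial.C (M j k)), ← smul_eq_C_mul, map_smul, map_one]
      rw [this]
      exact Submodule.smul_mem _ _ (one_mem_G _ _)) ha

theorem C_shear {M : Matrix κ κ ℚ} {q q' : κ → MvPolynomial β ℚ} (h : ∀ j, q' j = ∑ k, M j k • q k)
    (a : KA β κ) : C q (shear β M a) = shear β M (C q' a) :=
  C_linMap _ _ _ _ (fun j => by
    rw [aeval_X_left_apply, h]
    simp only [smul_eq_C_mul]) a

end KA

theorem Dat.isWeightedHomogeneous {β κ : Type} [Fintype κ] (D : Dat β κ) (j : κ) :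
    IsWeightedHomogeneous (fun b => 2 * D.dx b) (D.q j) (2 * D.dy j + 2) :=
  KA.isWeightedHomogeneous_of_pol_mem_G (D.hq j)

/-- Every pure coformal elliptic model has a presentation in which few odd generators already
cut out the origin. -/
theorem MinimalSullivan.exists_marked_presentation {A : Type} [GCDGA A] (S : MinimalSullivan A)
    (hp : S.Pure) (hc : S.Coformal) (he : Elliptic A S) :
    ∃ (β κ : Type) (_ : Fintype β) (_ : Fintype κ) (D : Dat β κ) (mk : κ → Prop)
      (_ : DecidablePred mk), Nonempty (Presentation S D) ∧ (∀ j, (D.q j).IsHomogeneous 2) ∧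
      Fintype.card {j // mk j} ≤ Fintype.card β ∧
      ∀ b, (X b : MvPolynomial β ℚ) ∈
        (Ideal.span (Set.range fun j : {j // mk j} => D.q j)).radical := by
  classical
  obtain ⟨β, κ, iβ, iκ, D, ⟨p⟩, hq⟩ := S.exists_presentation hp hc he
  obtain ⟨q', s, heq, hs, hX⟩ := Quadrics.exists_marking (fun b => 2 * D.dx b)
    (e := fun j => 2 * D.dy j + 2) hq D.isWeightedHomogeneous (p.mem_radical hq he.2)
  have hw := heq.isWeightedHomogeneous _ D.isWeightedHomogeneous
  have h2 := heq.isHomogeneous hq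
  obtain ⟨M, N, hMN, hNM, hM, hN, hM'⟩ := heq
  let D' : Dat β κ := ⟨D.dx, D.dy, q', fun j => KA.pol_mem_G_of_isWeightedHomogeneous (hw j)⟩
  let σ : KA β κ ≃ₐ[ℚ] KA β κ := AlgEquiv.ofAlgHom (KA.shear β M) (KA.shear β N)
    (KA.shear_comp hNM) (KA.shear_comp hMN)
  have hG : ∀ {w : β → ℚ} {v : κ → ℚ} (_ : ∀ j k, D.dy j = D.dy k → v j = v k) {g a},
      σ a ∈ KA.G w v g ↔ a ∈ KA.G w v g := by
    intro w v hv g a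
    constructor
    · intro h
      have := KA.shear_mem_G (M := N) (fun j k hjk => hv j k (by simpa using hN j k hjk)) h
      rwa [show KA.shear β N (σ a) = a from σ.symm_apply_apply a] at this
    · exact KA.shear_mem_G fun j k hjk => hv j k (by simpa using hM j k hjk)
  refine ⟨β, κ, iβ, iκ, D', (· ∈ s), inferInstance, ⟨⟨σ.trans p.e, fun a => ?_, fun n a => ?_,
    fun k a => ?_⟩⟩, h2, by simpa using hs, hX⟩
  · change p.e (KA.shear β M _) = Dd A (p.e (KA.shear β M a))
    rw [← p.comm, KA.C_shear hM']
  · exact (p.gr n _).trans (hG fun j k hjk => by rw [hjk])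
  · exact (p.lam k _).trans (hG fun j k _ => rfl)

end

section

open MvPolynomial

section Transfer

variable {A B Q : Type} [GCDGA A] [GCDGA B] [GCDGA Q] (u : A ≃ₐ[ℚ] B)

/-- Homotopy retractions can be transported along isomorphisms. -/
def HtpyRetraction.transfer {ρ : B →ₐ[ℚ] Q} (R : HtpyRetraction ρ) (hu : IsDGAHom u.toAlgHom)
    (hu' : IsDGAHom u.symm.toAlgHom) : HtpyRetraction (ρ.comp u.toAlgHom) where
  C := R.C
  j := R.j.comp u.toAlgHom
  q := R.q
  τ := u.symm.toAlgHom.comp R.τ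
  j_dga := ⟨fun a => (congrArg R.j (hu.1 a)).trans (R.j_dga.1 _), fun i a h => R.j_dga.2 i _ (hu.2 i a h)⟩
  q_dga := R.q_dga
  τ_dga := ⟨fun a => (congrArg u.symm (R.τ_dga.1 a)).trans (hu'.1 _),
    fun i a h => hu'.2 i _ (R.τ_dga.2 i a h)⟩
  q_surj := R.q_surj
  q_quasi := R.q_quasi
  hqj := by rw [← AlgHom.comp_assoc, R.hqj]
  hτj := AlgHom.ext fun a => by
    have := DFunLike.congr_fun R.hτj (u a)
    change u.symm (R.τ (R.j (u a))) = a
    rw [show R.τ (R.j (u a)) = u a from this, u.symm_apply_apply]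

/-- Tensor powers can be transported along isomorphisms. -/
def TensorPower.transfer {r : ℕ} {T : Type} [GCDGA T] (TP : TensorPower B r T)
    (hu : IsDGAHom u.toAlgHom) (hu' : IsDGAHom u.symm.toAlgHom) : TensorPower A r T where
  ι j := (TP.ι j).comp u.toAlgHom
  ι_dga j := ⟨fun a => (congrArg (TP.ι j) (hu.1 a)).trans ((TP.ι_dga j).1 _),
    fun i a h => (TP.ι_dga j).2 i _ (hu.2 i a h)⟩
  coprod E _ f hf := by
    obtain ⟨g, ⟨h1, h2⟩, h3⟩ := TP.coprod E (fun j => (f j).comp u.symm.toAlgHom) fun j =>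
      ⟨fun a => (congrArg (f j) (hu'.1 a)).trans ((hf j).1 _), fun i a h => (hf j).2 i _ (hu'.2 i a h)⟩
    refine ⟨g, ⟨h1, fun j => AlgHom.ext fun a => ?_⟩, fun g' hg' => h3 g' ⟨hg'.1, fun j =>
      AlgHom.ext fun b => ?_⟩⟩
    · have := DFunLike.congr_fun (h2 j) (u a)
      refine this.trans (congrArg (f j) (u.symm_apply_apply a))
    · have := DFunLike.congr_fun (hg'.2 j) (u.symm b)
      refine Eq.trans ?_ this
      exact congrArg (fun c => g' (TP.ι j c)) (u.apply_symm_apply b).symm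

theorem TensorPower.kerMu_transfer {r : ℕ} {T : Type} [GCDGA T] (TP : TensorPower B r T)
    (hu : IsDGAHom u.toAlgHom) (hu' : IsDGAHom u.symm.toAlgHom) :
    (TP.transfer u hu hu').kerMu = TP.kerMu := by
  have h := (TP.transfer u hu hu').mu_spec
  have h2 : u.toAlgHom.comp (TP.transfer u hu hu').mu = TP.mu := by
    obtain ⟨g, -, hg⟩ := TP.coprod B (fun _ => AlgHom.id ℚ B) fun _ => isDGAHom_id B
    refine (hg _ ⟨⟨fun a => ?_, fun i a ha => hu.2 i _ (h.1.2 i a ha)⟩, fun j => AlgHom.ext fun b => ?_⟩).trans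
      (hg _ TP.mu_spec).symm
    · exact (congrArg u (h.1.1 a)).trans (hu.1 _)
    · have := DFunLike.congr_fun (h.2 j) (u.symm b)
      have h3 : (TP.transfer u hu hu').mu (TP.ι j (u (u.symm b))) = u.symm b := this
      rw [u.apply_symm_apply] at h3
      exact (congrArg u h3).trans (u.apply_symm_apply b)
  ext a
  change (TP.transfer u hu hu').mu a = 0 ↔ TP.mu a = 0
  rw [← h2]
  exact (map_eq_zero_iff u u.injective).symm

theorem nonempty_MTCWitness_transfer {r n : ℕ} (hu : IsDGAHom u.toAlgHom)
    (hu' : IsDGAHom u.symm.toAlgHom) (h : Nonempty (MTCWitness B r n)) :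
    Nonempty (MTCWitness A r n) := by
  obtain ⟨⟨T, TP, Q, ρ, h1, h2, h3, h4⟩⟩ := h
  exact ⟨⟨T, TP.transfer u hu hu', Q, ρ, h1, h2, by rw [h3, TP.kerMu_transfer u], h4⟩⟩

end Transfer

namespace Presentation

variable {A : Type} [GCDGA A] {S : MinimalSullivan A} {β κ : Type} [Fintype β] [Fintype κ]
  {D : Dat β κ}

/-- The isomorphism with the free model. -/
def iso (p : Presentation S D) : A ≃ₐ[ℚ] D.Model := p.e.symm.trans D.toModel

theorem iso_dga (p : Presentation S D) : IsDGAHom p.iso.toAlgHom := by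
  refine ⟨fun a => ?_, fun i a ha => ?_⟩
  · change p.e.symm (Dd A a) = KA.C D.q (p.e.symm a)
    rw [AlgEquiv.symm_apply_eq, p.comm, p.e.apply_symm_apply]
  · change p.e.symm a ∈ D.gr i
    rwa [← p.gr, p.e.apply_symm_apply]

theorem iso_symm_dga (p : Presentation S D) : IsDGAHom p.iso.symm.toAlgHom :=
  ⟨fun a => p.comm a, fun i a ha => (p.gr i a).mpr ha⟩

theorem nonempty_MTCWitness_iff (p : Presentation S D) (r n : ℕ) :
    Nonempty (MTCWitness A r n) ↔ Nonempty (MTCWitness D.Model r n) :=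
  ⟨nonempty_MTCWitness_transfer p.iso.symm p.iso_symm_dga p.iso_dga,
    nonempty_MTCWitness_transfer p.iso p.iso_dga p.iso_symm_dga⟩

theorem ker_comp_iso (p : Presentation S D) {Q : Type} [GCDGA Q] (π : D.Model →ₐ[ℚ] Q) {n : ℕ}
    (h : LinearMap.ker π.toLinearMap = Dat.longWords β κ n) :
    LinearMap.ker (π.comp p.iso.toAlgHom).toLinearMap = ⨆ k, ⨆ (_ : n < k), S.lam k := by
  have hmap : ∀ k, (words β κ k).map p.e.toAlgHom.toLinearMap = S.lam k := fun k => by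
    ext a
    refine ⟨?_, fun ha => ⟨p.e.symm a, (p.lam k _).mp ?_, p.e.apply_symm_apply a⟩⟩
    · rintro ⟨b, hb, rfl⟩
      exact (p.lam k b).mpr hb
    · rwa [p.e.apply_symm_apply]
  have h2 : (Dat.longWords β κ n).map p.e.toAlgHom.toLinearMap = ⨆ k, ⨆ (_ : n < k), S.lam k := by
    unfold Dat.longWords
    simp only [Submodule.map_iSup]
    exact iSup_congr fun k => iSup_congr fun _ => hmap k
  rw [← h2]
  ext a
  have h3 : ∀ b : KA β κ, π (D.toModel b) = 0 ↔ b ∈ Dat.longWords β κ n := fun b => by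
    rw [← h]; rfl
  refine ⟨fun ha => ⟨p.e.symm a, (h3 _).mp ha, p.e.apply_symm_apply a⟩, ?_⟩
  rintro ⟨b, hb, rfl⟩
  have := (h3 b).mpr hb
  change π (D.toModel (p.e.symm (p.e b))) = 0
  rwa [p.e.symm_apply_apply]

theorem card_le_of_catWitness (p : Presentation S D) (hq : ∀ j, (D.q j).IsHomogeneous 2)
    (hX : ∀ b, (X b : MvPolynomial β ℚ) ∈ (Ideal.span (Set.range D.q)).radical) {n : ℕ}
    (W : CatWitness A S n) : Fintype.card κ ≤ n := by
  classical
  by_contra! hn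
  obtain ⟨ω, hω, hd, hne⟩ := KA.exists_nonexact (fun j => KA.sum_half_pderiv (hq j)) hX 1 1 0
    (fun j b => by
      have := KA.pol_mem_G_of_isHomogeneous (o := κ ⊕ β) (v := Sum.elim 1 0)
        (KA.isHomogeneous_half_pderiv (hq j) b)
      simpa using this)
  obtain ⟨Q, π, -, -, hker, ⟨R⟩⟩ := W
  have hlam : p.e ω ∈ S.lam (Fintype.card κ) := by
    rw [p.lam]
    unfold words
    convert hω using 2
    all_goals simp
    all_goals rfl
  have hk : π (p.e ω) = 0 := by
    have : p.e ω ∈ LinearMap.ker π.toLinearMap := by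
      rw [hker]
      exact Submodule.mem_iSup_of_mem _ (Submodule.mem_iSup_of_mem hn hlam)
    exact this
  obtain ⟨c, hc⟩ := R.toMod.exact_of_map_eq_zero (by rw [← p.comm, hd, map_zero]) hk
  obtain ⟨c, rfl⟩ := p.e.surjective c
  rw [← p.comm] at hc
  exact hne c (p.e.injective hc)

theorem cat_eq (p : Presentation S D) {mk : κ → Prop} [DecidablePred mk] (hq : ∀ j, (D.q j).IsHomogeneous 2)
    (hc : Fintype.card {j // mk j} ≤ Fintype.card β)
    (hX : ∀ b, (X b : MvPolynomial β ℚ) ∈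
      (Ideal.span (Set.range fun j : {j // mk j} => D.q j)).radical) :
    cat A S = Fintype.card κ := by
  have hX' : ∀ b, (X b : MvPolynomial β ℚ) ∈ (Ideal.span (Set.range D.q)).radical := fun b =>
    Ideal.radical_mono (Ideal.span_mono (Set.range_comp_subset_range Subtype.val D.q)) (hX b)
  obtain ⟨Q, iQ, π, h1, h2, h3, ⟨R⟩⟩ := D.exists_htpyRetraction_longWords hq hX hc le_rfl
  have hmem : Fintype.card κ ∈ {n | Nonempty (CatWitness A S n)} :=
    ⟨⟨Q, π.comp p.iso.toAlgHom,
      ⟨fun a => (congrArg π (p.iso_dga.1 a)).trans (h1.1 _), fun i a h => h1.2 i _ (p.iso_dga.2 i a h)⟩,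
      h2.comp p.iso.surjective, p.ker_comp_iso π h3, ⟨R.transfer p.iso p.iso_dga p.iso_symm_dga⟩⟩⟩
  refine le_antisymm (Nat.sInf_le hmem) ?_
  obtain ⟨W⟩ := Nat.sInf_mem ⟨_, hmem⟩
  exact p.card_le_of_catWitness hq hX' W

end Presentation

end

section

open MvPolynomial

namespace KA

variable {β κ ι : Type} [Fintype κ] [DecidableEq κ] [Fintype ι] [DecidableEq ι]

/-- The endomorphism mixing the copies of the generators according to a matrix. -/
def mix (β κ : Type) [Fintype κ] [DecidableEq κ] (F : Matrix ι ι ℚ) :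
    KA (β × ι) (κ × ι) →ₐ[ℚ] KA (β × ι) (κ × ι) :=
  linMap (fun b => ∑ l, F b.2 l • X (b.1, l))
    fun j j' => if j'.1 = j.1 then MvPolynomial.C (F j.2 j'.2) else 0

theorem mix_x (F : Matrix ι ι ℚ) (b : β × ι) :
    mix β κ F (x b) = ∑ l, F b.2 l • x (b.1, l) := by
  rw [mix, linMap_x, map_sum]
  simp only [map_smul]
  rfl

theorem mix_y (F : Matrix ι ι ℚ) (j : κ × ι) :
    mix β κ F (y j) = ∑ l, F j.2 l • y (j.1, l) := by
  rw [mix, linMap_y, lin, Fintype.sum_prod_type, Finset.sum_eq_single j.1]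
  · refine Finset.sum_congr rfl fun l _ => ?_
    rw [if_pos rfl, ← mul_one (MvPolynomial.C (F j.2 l)), ← smul_eq_C_mul, map_smul, map_one,
      smul_mul_assoc, one_mul]
  · intro k _ hk
    simp [hk]
  · simp

theorem mix_comp {F F' : Matrix ι ι ℚ} (h : F * F' = 1) :
    (mix β κ F').comp (mix β κ F) = AlgHom.id ℚ _ := by
  have key : ∀ (z : ι → KA (β × ι) (κ × ι)) (k : ι),
      ∑ l, F k l • ∑ i, F' l i • z i = z k := fun z k => by
    simp only [Finset.smul_sum, smul_smul]
    rw [Finset.sum_comm]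
    simp only [← Finset.sum_smul, ← Matrix.mul_apply, h, Matrix.one_apply, ite_smul, one_smul,
      zero_smul]
    simp
  refine algHom_ext (fun b => ?_) fun j => ?_
  · rw [AlgHom.comp_apply, mix_x, map_sum]
    simp only [map_smul, mix_x]
    exact key (fun i => x (b.1, i)) b.2
  · rw [AlgHom.comp_apply, mix_y, map_sum]
    simp only [map_smul, mix_y]
    exact key (fun i => y (j.1, i)) j.2

theorem C_mix {F : Matrix ι ι ℚ} {p q : κ × ι → MvPolynomial (β × ι) ℚ}
    (h : ∀ j k, ∑ l, F k l • q (j, l) = aeval (fun b => ∑ l, F b.2 l • X (b.1, l)) (p (j, k)))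
    (a : KA (β × ι) (κ × ι)) : C q (mix β κ F a) = mix β κ F (C p a) :=
  C_linMap _ _ _ _ (fun k => by
    rw [← h, Fintype.sum_prod_type, Finset.sum_eq_single k.1]
    · simp [smul_eq_C_mul]
    · intro j _ hj
      simp [hj]
    · simp) a

end KA

theorem pderiv_comm {β : Type} (b c : β) (q : MvPolynomial β ℚ) :
    pderiv c (pderiv b q) = pderiv b (pderiv c q) := by
  classical
  have h : ⁅pderiv (R := ℚ) c, pderiv b⁆ = 0 := derivation_ext fun i => by
    rw [Derivation.commutator_apply, pderiv_X, pderiv_X, Pi.single_apply, Pi.single_apply]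
    split_ifs <;> simp
  rw [← sub_eq_zero, ← Derivation.commutator_apply, h]
  rfl

/-- Quadratic forms are given by symmetric matrices. -/
theorem exists_symm_matrix {β : Type} [Fintype β] {q : MvPolynomial β ℚ} (hq : q.IsHomogeneous 2) :
    ∃ M : Matrix β β ℚ, M.transpose = M ∧ q = ∑ b, (∑ c, M b c • X c) * X b := by
  refine ⟨Matrix.of fun b c => constantCoeff (pderiv c ((1 / 2 : ℚ) • pderiv b q)), ?_, ?_⟩
  · ext b c
    simp only [Matrix.transpose_apply, Matrix.of_apply]
    rw [Derivation.map_smul, Derivation.map_smul, pderiv_comm]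
  · conv_lhs => rw [← KA.sum_half_pderiv hq]
    refine Finset.sum_congr rfl fun b _ => ?_
    congr 1
    have h1 := KA.isHomogeneous_half_pderiv hq b
    have := h1.sum_X_mul_pderiv
    rw [one_smul] at this
    conv_lhs => rw [← this]
    refine Finset.sum_congr rfl fun c _ => ?_
    have h0 : (pderiv c ((1 / 2 : ℚ) • pderiv b q)).IsHomogeneous 0 := h1.pderiv
    rw [← totalDegree_zero_iff_isHomogeneous, totalDegree_eq_zero_iff_eq_C,
      ← constantCoeff_eq] at h0
    rw [Matrix.of_apply, mul_comm, smul_eq_C_mul (X c), ← h0]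

/-- The pairing of two families of polynomials defined by a matrix. -/
def bil {β σ : Type} [Fintype β] (M : Matrix β β ℚ) (s t : β → MvPolynomial σ ℚ) :
    MvPolynomial σ ℚ := ∑ b, (∑ c, M b c • s c) * t b

section Bil
variable {β σ : Type} [Fintype β] {M : Matrix β β ℚ} 

theorem bil_add_left (s s' t : β → MvPolynomial σ ℚ) : bil M (s + s') t = bil M s t + bil M s' t := by
  simp [bil, Finset.sum_add_distrib, add_mul]

theorem bil_add_right (s t t' : β → MvPolynomial σ ℚ) : bil M s (t + t') = bil M s t + bil M s t' := by
  simp [bil, Finset.sum_add_distrib, mul_add]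

theorem bil_smul_left (r : ℚ) (s t : β → MvPolynomial σ ℚ) : bil M (r • s) t = r • bil M s t := by
  simp only [bil, Finset.smul_sum, Pi.smul_apply, smul_comm r, ← smul_mul_assoc]

theorem bil_smul_right (r : ℚ) (s t : β → MvPolynomial σ ℚ) : bil M s (r • t) = r • bil M s t := by
  simp only [bil, Finset.smul_sum, Pi.smul_apply, mul_smul_comm]

theorem bil_sub_left (s s' t : β → MvPolynomial σ ℚ) : bil M (s - s') t = bil M s t - bil M s' t := by
  simp [bil, smul_sub, Finset.sum_sub_distrib, sub_mul]

theorem bil_sub_right (s t t' : β → MvPolynomial σ ℚ) : bil M s (t - t') = bil M s t - bil M s t' := by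
  simp [bil, Finset.sum_sub_distrib, mul_sub]

theorem bil_symm (hM : M.transpose = M) (s t : β → MvPolynomial σ ℚ) : bil M s t = bil M t s := by
  simp only [bil, Finset.sum_mul]
  rw [Finset.sum_comm]
  refine Finset.sum_congr rfl fun b _ => Finset.sum_congr rfl fun c _ => ?_
  rw [← hM, Matrix.transpose_apply, hM, smul_mul_assoc, smul_mul_assoc, mul_comm]

theorem aeval_bil {τ : Type} (f : σ → MvPolynomial τ ℚ) (s t : β → MvPolynomial σ ℚ) :
    aeval f (bil M s t) = bil M (fun b => aeval f (s b)) fun b => aeval f (t b) := by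
  simp [bil]

end Bil

section Mixing

variable {β κ ι : Type} [Fintype β] [Fintype κ] [Fintype ι] [DecidableEq ι] (i₀ i₁ : ι)

/-- The change of coordinates from the diagonal coordinates to the copies. -/
def mixMatrix : Matrix ι ι ℚ := Matrix.of fun k l =>
  if k = i₀ then (if l = i₀ then 1 / 2 else 0) + (if l = i₁ then 1 / 2 else 0)
  else (if l = k then 1 else 0) - (if l = i₀ then 1 else 0)

/-- The inverse of `mixMatrix`. -/
def unmixMatrix : Matrix ι ι ℚ := Matrix.of fun k l =>
  (if l = i₀ then 1 else 0) - (if l = i₁ then 1 / 2 else 0) + (if k = i₀ then 0 else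
    if l = k then 1 else 0)

theorem sum_mixMatrix {E : Type} [AddCommGroup E] [Module ℚ E] (z : ι → E) (k : ι) :
    ∑ l, mixMatrix i₀ i₁ k l • z l =
      if k = i₀ then (1 / 2 : ℚ) • (z i₀ + z i₁) else z k - z i₀ := by
  unfold mixMatrix
  split_ifs with h <;>
    simp [h, add_smul, sub_smul, Finset.sum_add_distrib, Finset.sum_sub_distrib]

theorem mixMatrix_mul_unmixMatrix (h : i₁ ≠ i₀) : mixMatrix i₀ i₁ * unmixMatrix i₀ i₁ = 1 := by
  ext k l
  rw [Matrix.mul_apply]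
  have := sum_mixMatrix i₀ i₁ (fun i => unmixMatrix i₀ i₁ i l) k
  simp only [smul_eq_mul] at this
  rw [this]
  unfold unmixMatrix
  simp only [Matrix.of_apply, Matrix.one_apply, if_neg h, if_true]
  split_ifs <;> first | (exfalso; subst_vars; simp_all; done) | norm_num

theorem unmixMatrix_mul_mixMatrix (h : i₁ ≠ i₀) : unmixMatrix i₀ i₁ * mixMatrix i₀ i₁ = 1 :=
  mul_eq_one_comm.mp (mixMatrix_mul_unmixMatrix i₀ i₁ h)

/-- The linear forms attached to a symmetric matrix. -/
def linForm (M : Matrix β β ℚ) (b : β) (i : ι) : MvPolynomial (β × ι) ℚ :=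
  ∑ c, M b c • X (c, i)

/-- The coefficients of the mixed quadrics. -/
def mixCoeff (M : Matrix β β ℚ) (k : ι) (b : β × ι) : MvPolynomial (β × ι) ℚ :=
  (if b.2 = i₀ then if k = i₀ then linForm M b.1 i₀ else (2 : ℚ) • linForm M b.1 k else 0) +
  (if b.2 = i₁ then if k = i₀ then (1 / 4 : ℚ) • linForm M b.1 i₁ else 0 else 0) +
  (if b.2 = k then if k = i₀ then 0 else linForm M b.1 k - linForm M b.1 i₁ else 0)

/-- The weight of the mixed generators. -/
def mixWeight (k : ι) : ℕ := if k = i₀ then 0 else 1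

theorem linForm_mem (M : Matrix β β ℚ) (b : β) (i : ι) {o : Type} [Fintype o] (v : o → ℚ) :
    (KA.pol (linForm M b i) : KA (β × ι) o) ∈ KA.G (fun b => (mixWeight i₀ b.2 : ℚ)) v
      (mixWeight i₀ i) := by
  unfold linForm
  rw [map_sum]
  refine Submodule.sum_mem _ fun c _ => ?_
  rw [map_smul]
  exact Submodule.smul_mem _ _ (KA.x_mem_G (fun b : β × ι => (mixWeight i₀ b.2 : ℚ)) v (c, i))

theorem mixCoeff_mem (h : i₁ ≠ i₀) (M : Matrix β β ℚ) (k : ι) (b : β × ι) {o : Type} [Fintype o]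
    (v : o → ℚ) :
    (KA.pol (mixCoeff i₀ i₁ M k b) : KA (β × ι) o) ∈ KA.G (fun b => (mixWeight i₀ b.2 : ℚ)) v
      (mixWeight i₀ k - if b.2 = i₁ then -1 else 0) := by
  have h0 := linForm_mem i₀ M b.1 i₀ v
  have h1 := linForm_mem i₀ M b.1 i₁ v
  have hk := linForm_mem i₀ M b.1 k v
  unfold mixCoeff
  simp only [mixWeight, h, if_true, if_false, Nat.cast_zero, Nat.cast_one] at h0 h1 hk ⊢
  by_cases hk0 : k = i₀
  · subst hk0
    simp only [if_true]
    by_cases hb0 : b.2 = k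
    · have : b.2 ≠ i₁ := fun h' => h (h'.symm.trans hb0)
      simpa [hb0, this, h.symm] using h0
    · by_cases hb1 : b.2 = i₁
      · simpa [hb1, h] using Submodule.smul_mem _ (1 / 4 : ℚ) h1
      · simp [hb0, hb1]
  · simp only [hk0, if_false] at hk ⊢
    by_cases hb0 : b.2 = i₀
    · simpa [hb0, h.symm, Ne.symm hk0] using Submodule.smul_mem _ (2 : ℚ) hk
    · by_cases hbk : b.2 = k
      · by_cases hk1 : k = i₁
        · simp [hk1, hbk, h]
        · simpa [hk1, hbk, hk0] using sub_mem hk h1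
      · simp [hb0, hbk]

/-- The quadrics in the mixed coordinates. -/
def mixQuadric (M : Matrix β β ℚ) (k : ι) : MvPolynomial (β × ι) ℚ :=
  ∑ b, mixCoeff i₀ i₁ M k b * X b

theorem mixQuadric_eq (M : Matrix β β ℚ) (k : ι) : mixQuadric i₀ i₁ M k =
    if k = i₀ then bil M (fun c => X (c, i₀)) (fun c => X (c, i₀)) +
      (1 / 4 : ℚ) • bil M (fun c => X (c, i₁)) (fun c => X (c, i₁))
    else (2 : ℚ) • bil M (fun c => X (c, k)) (fun c => X (c, i₀)) +
      (bil M (fun c => X (c, k)) (fun c => X (c, k)) -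
        bil M (fun c => X (c, i₁)) (fun c => X (c, k))) := by
  unfold mixQuadric mixCoeff bil
  rw [Fintype.sum_prod_type]
  by_cases hk0 : k = i₀
  · subst hk0
    simp [add_mul, Finset.sum_add_distrib, ite_mul, linForm, ← Finset.smul_sum]
  · simp [hk0, add_mul, Finset.sum_add_distrib, ite_mul, linForm, ← Finset.smul_sum,
      sub_mul]

theorem sum_mixMatrix_eq_aeval (h : i₁ ≠ i₀) {M : Matrix β β ℚ} (hM : M.transpose = M) (k : ι) :
    ∑ l, mixMatrix i₀ i₁ k l • bil M (fun c => X (c, l)) (fun c => X (c, l)) =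
      aeval (fun b : β × ι => ∑ l, mixMatrix i₀ i₁ b.2 l • X (R := ℚ) (b.1, l))
        (mixQuadric i₀ i₁ M k) := by
  have e0 : (fun c : β => (1 / 2 : ℚ) • (X (R := ℚ) (c, i₀) + X (c, i₁))) =
    (1 / 2 : ℚ) • ((fun c => X (c, i₀)) + fun c => X (c, i₁)) := rfl
  have e : ∀ k, (fun c : β => (X (R := ℚ) (c, k) - X (c, i₀))) =
    (fun c => X (c, k)) - fun c => X (c, i₀) := fun k => rfl
  rw [sum_mixMatrix, mixQuadric_eq]
  by_cases hk0 : k = i₀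
  · subst hk0
    simp only [if_true, map_add, map_smul, aeval_bil, aeval_X, sum_mixMatrix, h, if_false, e0, e]
    simp only [bil_add_left, bil_add_right, bil_smul_left, bil_smul_right, bil_sub_left,
      bil_sub_right, bil_symm hM (fun c => X (c, i₁)) fun c => X (c, k)]
    module
  · simp only [hk0, if_true, map_add, map_sub, map_smul, aeval_bil, aeval_X, sum_mixMatrix, h,
      if_false, e0, e]
    simp only [bil_add_right, bil_smul_right, bil_sub_left, bil_sub_right,
      bil_symm hM (fun c => X (c, i₁)) fun c => X (c, k),
      bil_symm hM (fun c => X (c, i₀)) fun c => X (c, k),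
      bil_symm hM (fun c => X (c, i₁)) fun c => X (c, i₀)]
    module

end Mixing

end

section

open MvPolynomial

namespace Dat

variable {β κ : Type} [Fintype β] [Fintype κ] (D : Dat β κ)

/-- Cocycles in tensor powers that are not exact and have many factors in the diagonal ideal. -/
theorem exists_power_nonexact [DecidableEq κ] (hq : ∀ j, (D.q j).IsHomogeneous 2)
    (hX : ∀ b, (X b : MvPolynomial β ℚ) ∈ (Ideal.span (Set.range D.q)).radical) {N : ℕ}
    {i₀ i₁ : Fin N} (h : i₁ ≠ i₀) :
    ∃ ω ∈ KA.G (fun b : β × Fin N => (mixWeight i₀ b.2 : ℚ))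
        (fun j : κ × Fin N => (mixWeight i₀ j.2 : ℚ))
        (((N - 1) * Fintype.card κ + Fintype.card β : ℕ) : ℚ),
      KA.C (D.power N).q (KA.mix β κ (mixMatrix i₀ i₁) ω) = 0 ∧
      ∀ η, KA.C (D.power N).q η ≠ KA.mix β κ (mixMatrix i₀ i₁) ω := by
  classical
  choose M hM hMq using fun j => exists_symm_matrix (hq j)
  have hpow : ∀ j k, (D.power N).q (j, k) = bil (M j) (fun c => X (c, k)) fun c => X (c, k) := by
    intro j k
    change rename (fun b => (b, k)) (D.q j) = _
    conv_lhs => rw [hMq j]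
    simp [bil]
  let p : κ × Fin N → MvPolynomial (β × Fin N) ℚ := fun j => mixQuadric i₀ i₁ (M j.1) j.2
  let f : β × Fin N → MvPolynomial (β × Fin N) ℚ := fun b =>
    ∑ l, mixMatrix i₀ i₁ b.2 l • X (b.1, l)
  let f' : β × Fin N → MvPolynomial (β × Fin N) ℚ := fun b =>
    ∑ l, unmixMatrix i₀ i₁ b.2 l • X (b.1, l)
  have hcol : ∀ {F F' : Matrix (Fin N) (Fin N) ℚ} (_ : F * F' = 1) {E : Type} [AddCommGroup E]
      [Module ℚ E] (z : Fin N → E) (k : Fin N), ∑ l, F k l • ∑ i, F' l i • z i = z k := by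
    intro F F' hF E _ _ z k
    simp only [Finset.smul_sum, smul_smul]
    rw [Finset.sum_comm]
    simp only [← Finset.sum_smul, ← Matrix.mul_apply, hF, Matrix.one_apply, ite_smul, one_smul,
      zero_smul]
    simp
  have h1 := mixMatrix_mul_unmixMatrix i₀ i₁ h
  have h2 := unmixMatrix_mul_mixMatrix i₀ i₁ h
  have hff' : ∀ a, aeval f' (aeval f a) = a := fun a => by
    have : (aeval f').comp (aeval f) = AlgHom.id ℚ (MvPolynomial (β × Fin N) ℚ) :=
      MvPolynomial.algHom_ext fun b => by
        simp only [AlgHom.comp_apply, aeval_X, f, f', map_sum, map_smul]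
        exact hcol h1 (fun i => X (b.1, i)) b.2
    exact DFunLike.congr_fun this a
  have hchain : ∀ j k, ∑ l, mixMatrix i₀ i₁ k l • (D.power N).q (j, l) = aeval f (p (j, k)) := by
    intro j k
    simp only [hpow]
    exact sum_mixMatrix_eq_aeval i₀ i₁ h (hM j) k
  have hchain' : ∀ j k, aeval f' ((D.power N).q (j, k)) = ∑ l, unmixMatrix i₀ i₁ k l • p (j, l) := by
    intro j k
    rw [← hcol h2 (fun l => (D.power N).q (j, l)) k]
    simp only [hchain, map_sum, map_smul, hff']
  have hXp : ∀ b, (X b : MvPolynomial (β × Fin N) ℚ) ∈ (Ideal.span (Set.range p)).radical := by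
    have key : ∀ b, f' b ∈ (Ideal.span (Set.range p)).radical := by
      rintro ⟨b, k⟩
      let g : MvPolynomial β ℚ →ₐ[ℚ] MvPolynomial (β × Fin N) ℚ :=
        (aeval f').comp (rename fun b => (b, k))
      have hg : Ideal.span (Set.range D.q) ≤ (Ideal.span (Set.range p)).comap g := by
        rw [Ideal.span_le]
        rintro _ ⟨j, rfl⟩
        change aeval f' ((D.power N).q (j, k)) ∈ Ideal.span (Set.range p)
        rw [hchain']
        refine Submodule.sum_mem _ fun l _ => Submodule.smul_of_tower_mem _ _ ?_
        exact Ideal.subset_span ⟨_, rfl⟩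
      have := Ideal.radical_mono hg (hX b)
      rw [← Ideal.comap_radical, Ideal.mem_comap] at this
      simpa [g] using this
    intro b
    have := hcol h1 (fun i => (X (b.1, i) : MvPolynomial (β × Fin N) ℚ)) b.2
    rw [show (X b : MvPolynomial (β × Fin N) ℚ) = X (b.1, b.2) from rfl, ← this]
    exact Submodule.sum_mem _ fun l _ => Submodule.smul_of_tower_mem _ _ (key (b.1, l))
  obtain ⟨ω, hω, hd, hne⟩ := KA.exists_nonexact (p := p) (fun _ => rfl) hXp
    (fun b => (mixWeight i₀ b.2 : ℚ)) (fun j => (mixWeight i₀ j.2 : ℚ))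
    (fun b => if b.2 = i₁ then -1 else 0) fun j b => mixCoeff_mem i₀ i₁ h (M j.1) j.2 b _
  refine ⟨ω, ?_, ?_, fun η hη => ?_⟩
  · convert hω using 2
    have hcard : ((N - 1 : ℕ) : ℚ) = N - 1 := by
      rw [Nat.cast_sub (Fin.pos i₀), Nat.cast_one]
    have hs : ∀ k : Fin N, (mixWeight i₀ k : ℚ) = 1 - if k = i₀ then 1 else 0 := fun k => by
      unfold mixWeight; split_ifs <;> simp
    rw [Fintype.sum_prod_type, Fintype.sum_prod_type]
    simp [hs, hcard]
    ring
  · rw [KA.C_mix hchain, hd, map_zero]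
  · have hinv := DFunLike.congr_fun (KA.mix_comp (β := β) (κ := κ) h2) η
    have hinv' := fun a => DFunLike.congr_fun (KA.mix_comp (β := β) (κ := κ) h1) a
    rw [AlgHom.comp_apply, AlgHom.id_apply] at hinv
    rw [← hinv, KA.C_mix hchain] at hη
    have := congrArg (KA.mix β κ (unmixMatrix i₀ i₁)) hη
    rw [← AlgHom.comp_apply, ← AlgHom.comp_apply, hinv', hinv'] at this
    exact hne _ this

theorem le_of_MTCWitness (hq : ∀ j, (D.q j).IsHomogeneous 2)
    (hX : ∀ b, (X b : MvPolynomial β ℚ) ∈ (Ideal.span (Set.range D.q)).radical) {r n : ℕ}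
    (hr : r ≠ 0) (W : MTCWitness D.Model (r + 1) n) :
    r * Fintype.card κ + Fintype.card β ≤ n := by
  classical
  by_contra! hn
  obtain ⟨T, TP, Q, ρ, h1, h2, hker, ⟨R⟩⟩ := W
  have : NeZero r := ⟨hr⟩
  have h01 : (Fin.last r) ≠ 0 := by simpa [Fin.ext_iff] using hr
  obtain ⟨ω, hω, hd, hne⟩ := D.exists_power_nonexact hq hX h01
  set σ := KA.mix β κ (mixMatrix (0 : Fin (r + 1)) (Fin.last r)) with hσ
  let g := D.copairing TP.ι TP.ι_dga
  have hgd : ∀ a, g (KA.C (D.power (r + 1)).q a) = Dd T (g a) := (D.copairing_dga TP.ι TP.ι_dga).1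
  obtain ⟨h, ⟨hh, hhι⟩, -⟩ := TP.coprod (D.power (r + 1)).Model (D.powerι (r + 1))
    (D.powerι_dga (r + 1))
  have hhg : h.comp g = (D.power (r + 1)).toModel.toAlgHom := by
    refine KA.algHom_ext (fun b => ?_) fun j => ?_
    · exact (congrArg h (D.copairing_x TP.ι TP.ι_dga b)).trans
        ((DFunLike.congr_fun (hhι b.2) (D.toModel (KA.x b.1))).trans
          (KA.ren_x (fun c => (c, b.2)) (fun j : κ => (j, b.2)) b.1))
    · exact (congrArg h (D.copairing_y TP.ι TP.ι_dga j)).trans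
        ((DFunLike.congr_fun (hhι j.2) (D.toModel (KA.y j.1))).trans
          (KA.ren_y (fun c => (c, j.2)) (fun i : κ => (i, j.2)) j.1))
  have hdiff : ∀ (k l : Fin (r + 1)) a, TP.ι k a - TP.ι l a ∈ TP.kerMu := fun k l a => by
    change TP.mu (TP.ι k a - TP.ι l a) = 0
    rw [map_sub, TP.mu_ι, TP.mu_ι, sub_self]
  have hl : ⊤ * TP.kerMu ≤ TP.kerMu := top_mul_ker TP.mu
  have hrr : TP.kerMu * ⊤ ≤ TP.kerMu := ker_mul_top TP.mu
  have hpow : g (σ ω) ∈ TP.kerMu ^ (r * Fintype.card κ + Fintype.card β) := by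
    refine (KA.isGenGraded_nat (fun b : β × Fin (r + 1) => mixWeight 0 b.2)
      (fun j : κ × Fin (r + 1) => mixWeight 0 j.2)).map_mem_pow hl hrr (g.comp σ) ?_ (by omega) hω
    rintro _ (⟨⟨b, k⟩, rfl⟩ | ⟨⟨j, k⟩, rfl⟩)
    · have hmem := KA.x_mem_G (fun b : β × Fin (r + 1) => (mixWeight 0 b.2 : ℚ))
        (fun j : κ × Fin (r + 1) => (mixWeight 0 j.2 : ℚ)) (b, k)
      by_cases hk : k = 0
      · left; simpa [mixWeight, hk] using hmem
      · right
        refine ⟨by simpa [mixWeight, hk] using hmem, ?_⟩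
        rw [AlgHom.comp_apply, hσ, KA.mix_x, sum_mixMatrix, if_neg hk, map_sub, D.copairing_x,
          D.copairing_x]
        exact hdiff _ _ _
    · have hmem := KA.y_mem_G (fun b : β × Fin (r + 1) => (mixWeight 0 b.2 : ℚ))
        (fun j : κ × Fin (r + 1) => (mixWeight 0 j.2 : ℚ)) (j, k)
      by_cases hk : k = 0
      · left; simpa [mixWeight, hk] using hmem
      · right
        refine ⟨by simpa [mixWeight, hk] using hmem, ?_⟩
        rw [AlgHom.comp_apply, hσ, KA.mix_y, sum_mixMatrix, if_neg hk, map_sub, D.copairing_y,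
          D.copairing_y]
        exact hdiff _ _ _
  have hρ : ρ (g (σ ω)) = 0 := by
    have hle : TP.kerMu ^ (r * Fintype.card κ + Fintype.card β) ≤ TP.kerMu ^ (n + 1) := by
      obtain ⟨m, hm⟩ := Nat.exists_eq_add_of_le hn
      rw [hm, Nat.succ_eq_add_one, pow_add]
      exact (mul_le_mul' le_rfl le_top).trans (pow_succ_mul_top hrr n)
    have := hle hpow
    rw [← hker] at this
    exact this
  obtain ⟨c, hc⟩ := R.exact_of_map_eq_zero (by rw [← hgd, hd, map_zero]) hρ
  refine hne ((D.power (r + 1)).toModel.symm (h c)) ?_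
  have h3 := congrArg h hc
  have h4 : h (g (σ ω)) = (D.power (r + 1)).toModel (σ ω) := DFunLike.congr_fun hhg (σ ω)
  exact (hh.1 c).symm.trans (h3.trans h4)

end Dat

theorem Presentation.MTC_eq {A : Type} [GCDGA A] {S : MinimalSullivan A} {β κ : Type} [Fintype β]
    [Fintype κ] {D : Dat β κ} (p : Presentation S D) {mk : κ → Prop} [DecidablePred mk]
    (hq : ∀ j, (D.q j).IsHomogeneous 2) (hc : Fintype.card {j // mk j} ≤ Fintype.card β)
    (hX : ∀ b, (X b : MvPolynomial β ℚ) ∈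
      (Ideal.span (Set.range fun j : {j // mk j} => D.q j)).radical) {r : ℕ} (hr : r ≠ 0) :
    MTC A (r + 1) = r * Fintype.card κ + Fintype.card β := by
  have hX' : ∀ b, (X b : MvPolynomial β ℚ) ∈ (Ideal.span (Set.range D.q)).radical := fun b =>
    Ideal.radical_mono (Ideal.span_mono (Set.range_comp_subset_range Subtype.val D.q)) (hX b)
  have hmem : r * Fintype.card κ + Fintype.card β ∈ {n | Nonempty (MTCWitness A (r + 1) n)} :=
    (p.nonempty_MTCWitness_iff _ _).mpr
      (D.nonempty_MTCWitness (fun j _ => hq j) hX hc r le_rfl)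
  refine le_antisymm (Nat.sInf_le hmem) ?_
  obtain ⟨W⟩ := (p.nonempty_MTCWitness_iff _ _).mp (Nat.sInf_mem ⟨_, hmem⟩)
  exact D.le_of_MTCWitness hq hX' hr W

end

/-- The generating function of an eventually linear sequence. -/
theorem mk_linear_mul_sq (m n : ℚ) :
    PowerSeries.mk (fun r : ℕ => if r = 0 then (0 : ℚ) else r * m + n) * (1 - PowerSeries.X) ^ 2 =
      PowerSeries.C m * PowerSeries.X + PowerSeries.C n * PowerSeries.X * (1 - PowerSeries.X) := by
  have h1 : PowerSeries.mk (fun r : ℕ => if r = 0 then (0 : ℚ) else r * m + n) *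
      (1 - PowerSeries.X) =
      PowerSeries.mk fun r : ℕ => if r = 0 then 0 else m + if r = 1 then n else 0 := by
    ext r
    rw [mul_sub, mul_one, map_sub]
    rcases r with - | - | r
    · simp
    · simp [PowerSeries.coeff_succ_mul_X]
    · simp [PowerSeries.coeff_succ_mul_X]
      ring
  rw [pow_two, ← mul_assoc, h1]
  ext r
  rw [mul_sub, mul_one, map_sub, mul_sub, mul_one, ← add_sub_assoc, map_sub, map_add]
  rcases r with - | - | - | r <;>
    simp [PowerSeries.coeff_succ_mul_X, PowerSeries.coeff_X, PowerSeries.coeff_C]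

/-- For a pure coformal elliptic minimal Sullivan model, the
generating function `F(x) = Σ_{r≥1} MTC_{r+1}(ΛV)·x^r` is a rational function
of the form `P(x)/(1−x)²`, where `P` is an integer polynomial with
`P(1) = cat(ΛV)`. -/
theorem MTC_generating_function (A : Type) [GCDGA A] (S : MinimalSullivan A)
    (hpure : S.Pure) (hcof : S.Coformal) (hell : Elliptic A S) :
    ∃ P : Polynomial ℤ, P.eval 1 = (cat A S : ℤ) ∧
      PowerSeries.mk (fun r => if r = 0 then (0 : ℚ) else (MTC A (r + 1) : ℚ)) *
          (1 - PowerSeries.X) ^ 2 =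
        ((P.map (Int.castRingHom ℚ) : Polynomial ℚ) : PowerSeries ℚ) := by
  obtain ⟨β, κ, _, _, D, mk, _, ⟨p⟩, hq, hc, hX⟩ := S.exists_marked_presentation hpure hcof hell
  refine ⟨Polynomial.C (Fintype.card κ : ℤ) * Polynomial.X +
    Polynomial.C (Fintype.card β : ℤ) * Polynomial.X * (1 - Polynomial.X), ?_, ?_⟩
  · simp [p.cat_eq hq hc hX]
  · have h := mk_linear_mul_sq (Fintype.card κ) (Fintype.card β)
    have hfun : (fun r => if r = 0 then (0 : ℚ) else (MTC A (r + 1) : ℚ)) =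
        fun r : ℕ => if r = 0 then (0 : ℚ) else r * Fintype.card κ + Fintype.card β := by
      funext r
      split_ifs with hr
      · rfl
      · rw [p.MTC_eq hq hc hX hr]
        push_cast
        rfl
    rw [hfun, h]
    simp only [Polynomial.map_add, Polynomial.map_mul, Polynomial.map_sub, Polynomial.map_one,
      Polynomial.map_X, Polynomial.map_C, Polynomial.coe_add, Polynomial.coe_mul,
      Polynomial.coe_sub, Polynomial.coe_one, Polynomial.coe_X, Polynomial.coe_C, eq_intCast (Int.castRingHom ℚ),
      Int.cast_natCast]

end RHT
end
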